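/- Let f, g ∈ ℂ[z₁,…,zₙ] be irreducible homogeneous polynomials such that Sing V(f) ⊆ {0} (i.e., V(f) has an isolated singularity at the origin). If there exists a bi-Lipschitz homeomorphism φ : (ℂⁿ, V(f), 0) → (ℂⁿ, V(g), 0), then Sing V(g) ⊆ {0} and deg f = deg g. -/

import Mathlib

noncomputable section

/-- `ℂⁿ` with the Euclidean metric. -/
abbrev En (n : ℕ) := EuclideanSpace ℂ (Fin n)

/-- The zero set `V(p) ⊆ ℂⁿ` of a polynomial `p ∈ ℂ[z₁,…,zₙ]`. -/
def pV {n : ℕ} (p : MvPolynomial (Fin n) ℂ) : Set (En n) :=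
  {x | MvPolynomial.eval (x : Fin n → ℂ) p = 0}

/-- The singular set `Sing V(p) = {x ∈ V(p) : ∂p/∂z₁(x) = ⋯ = ∂p/∂zₙ(x) = 0}`. -/
def SingV {n : ℕ} (p : MvPolynomial (Fin n) ℂ) : Set (En n) :=
  {x | MvPolynomial.eval (x : Fin n → ℂ) p = 0 ∧
       ∀ i, MvPolynomial.eval (x : Fin n → ℂ) (MvPolynomial.pderiv i p) = 0}

/-- A bi-Lipschitz homeomorphism of germs `φ : (ℂⁿ, X, 0) → (ℂⁿ, Y, 0)`. -/
def BiLipGermHomeo {n : ℕ} (X Y : Set (En n)) : Prop :=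
  ∃ (U U' : Set (En n)) (φ ψ : En n → En n) (K : NNReal),
    IsOpen U ∧ IsOpen U' ∧ (0 : En n) ∈ U ∧ (0 : En n) ∈ U' ∧
    φ 0 = 0 ∧
    Set.MapsTo φ U U' ∧ Set.MapsTo ψ U' U ∧
    Set.LeftInvOn ψ φ U ∧ Set.RightInvOn ψ φ U' ∧
    LipschitzOnWith K φ U ∧ LipschitzOnWith K ψ U' ∧
    φ '' (X ∩ U) = Y ∩ U'

open MeasureTheory Metric Set Filter Topology

lemma det_interp {E : Type*} [NormedAddCommGroup E] [NormedSpace ℝ E] [FiniteDimensional ℝ E]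
    (v : ℕ → ℝ) (hv : Function.Injective v) : ∃ (N : ℕ) (c : ℕ → ℝ), ∀ A : E →L[ℝ] E,
      A.det = ∑ i ∈ Finset.range N, c i * (v i • (1 : E →L[ℝ] E) + A).det := by
  classical
  let b := Module.finBasis ℝ E
  refine ⟨Module.finrank ℝ E + 1, fun i =>
    ((Lagrange.basis (Finset.range (Module.finrank ℝ E + 1)) v i).eval 0), fun A => ?_⟩
  set M := LinearMap.toMatrix b b (A : E →ₗ[ℝ] E) with hM
  have key : ∀ t : ℝ, ((-M).charpoly).eval t = (t • (1 : E →L[ℝ] E) + A).det := by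
    intro t
    have h1 : (t • (1 : E →L[ℝ] E) + A).det =
      LinearMap.det (t • (1 : E →ₗ[ℝ] E) + (A : E →ₗ[ℝ] E)) := rfl
    rw [h1, ← LinearMap.det_toMatrix b, map_add, map_smul, ← hM, LinearMap.toMatrix_one,
      Matrix.eval_charpoly, Matrix.scalar_apply, sub_neg_eq_add, Matrix.smul_one_eq_diagonal]
  have hdeg : (-M).charpoly.degree < (Finset.range (Module.finrank ℝ E + 1)).card := by
    rw [Finset.card_range, Matrix.charpoly_degree_eq_dim, Fintype.card_fin]
    exact_mod_cast Nat.lt_succ_self _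
  have h2 := Lagrange.eq_interpolate_of_eval_eq (fun i => (v i • (1 : E →L[ℝ] E) + A).det)
    hv.injOn hdeg (fun i _ => key (v i))
  have h3 := key 0
  rw [zero_smul, zero_add, h2, Lagrange.interpolate_apply] at h3
  rw [← h3, Polynomial.eval_finsetSum]
  simp [mul_comm]

lemma det_pos_of_small {E : Type*} [NormedAddCommGroup E] [NormedSpace ℝ E] [FiniteDimensional ℝ E]
    (A : E →L[ℝ] E) (t : ℝ) (hA : ‖A‖ < t) : 0 < (t • (1 : E →L[ℝ] E) + A).det := by
  have ht : 0 < t := lt_of_le_of_lt (norm_nonneg _) hA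
  by_contra hneg
  push Not at hneg
  have hc : ContinuousOn (fun s : ℝ => (t • (1 : E →L[ℝ] E) + s • A).det) (Icc 0 1) :=
    (ContinuousLinearMap.continuous_det.comp (by fun_prop)).continuousOn
  have := intermediate_value_Icc' zero_le_one hc
  have h0 : (0 : ℝ) ∈ Icc ((t • (1 : E →L[ℝ] E) + (1 : ℝ) • A).det)
      ((t • (1 : E →L[ℝ] E) + (0 : ℝ) • A).det) := by
    constructor
    · simpa using hneg
    · rw [zero_smul, add_zero]
      have : (t • (1 : E →L[ℝ] E)).det = t ^ Module.finrank ℝ E * LinearMap.det (1 : E →ₗ[ℝ] E) :=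
        LinearMap.det_smul t (1 : E →ₗ[ℝ] E)
      rw [this, map_one]; positivity
  obtain ⟨s, hs, h⟩ := this h0
  have hn : ‖-((t⁻¹ * s) • A)‖ < 1 := by
    rw [norm_neg, norm_smul, Real.norm_of_nonneg (mul_nonneg (by positivity) hs.1), mul_assoc,
      inv_mul_lt_iff₀ ht, mul_one]
    exact lt_of_le_of_lt (mul_le_of_le_one_left (norm_nonneg _) hs.2) hA
  have : CompleteSpace E := FiniteDimensional.complete ℝ E
  have hu := isUnit_one_sub_of_norm_lt_one hn
  have h4 : IsUnit (LinearMap.det ((1 - -((t⁻¹ * s) • A) : E →L[ℝ] E) : E →ₗ[ℝ] E)) :=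
    LinearMap.isUnit_det _ (hu.map (ContinuousLinearMap.toLinearMapRingHom (R₁ := ℝ) (M₁ := E)))
  apply h4.ne_zero
  have h5 : (t • (1 : E →L[ℝ] E) + s • A) = t • (1 - -((t⁻¹ * s) • A)) := by
    rw [sub_neg_eq_add, smul_add, smul_smul, mul_inv_cancel_left₀ ht.ne']
  have h6 : (t • (1 : E →L[ℝ] E) + s • A).det = t ^ Module.finrank ℝ E *
      LinearMap.det ((1 - -((t⁻¹ * s) • A) : E →L[ℝ] E) : E →ₗ[ℝ] E) := by
    rw [h5]; exact LinearMap.det_smul t _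
  simp only [h6] at h
  exact (mul_eq_zero.1 h).resolve_left (by positivity)

theorem milnor_rogers {E : Type*} [NormedAddCommGroup E] [NormedSpace ℝ E] [FiniteDimensional ℝ E]
    [MeasurableSpace E] [BorelSpace E] (μ : Measure E) [μ.IsAddHaarMeasure]
    (Z W : E → E) (hZ : ContDiff ℝ 1 Z) (hW : ContDiff ℝ 1 W) (C : NNReal)
    (hZC : LipschitzWith C Z) (hWC : LipschitzWith C W) (R : ℝ) (hR : ∀ x, R ≤ ‖x‖ → Z x = W x) :
    ∫ x in ball 0 R, (fderiv ℝ Z x).det ∂μ = ∫ x in ball 0 R, (fderiv ℝ W x).det ∂μ := by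
  have : CompleteSpace E := FiniteDimensional.complete ℝ E
  have : ProperSpace E := FiniteDimensional.proper_real E
  have bij : ∀ Z : E → E, LipschitzWith C Z → ∀ t : ℝ, (C : ℝ) < t →
      Function.Bijective (fun x => t • x + Z x) := by
    intro Z hZC t ht
    have ht0 : 0 < t := lt_of_le_of_lt C.2 ht
    have happ : ApproximatesLinearOn (fun x => t • x + Z x)
        ((ContinuousLinearEquiv.smulLeft (Units.mk0 t ht0.ne') : E ≃L[ℝ] E) : E →L[ℝ] E)
        univ C := by
      intro x _ y _
      have h5 := hZC.dist_le_mul x y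
      rw [dist_eq_norm, dist_eq_norm] at h5
      refine le_trans (le_of_eq (congrArg norm ?_)) h5
      change t • x + Z x - (t • y + Z y) - t • (x - y) = Z x - Z y
      rw [smul_sub]; abel
    refine (happ.toHomeomorph _ ?_).bijective
    rcases subsingleton_or_nontrivial E with h | h
    · exact Or.inl h
    · right
      have : ‖((ContinuousLinearEquiv.smulLeft (Units.mk0 t ht0.ne') : E ≃L[ℝ] E).symm :
          E →L[ℝ] E)‖ = t⁻¹ := by
        have : ((ContinuousLinearEquiv.smulLeft (Units.mk0 t ht0.ne') : E ≃L[ℝ] E).symm :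
          E →L[ℝ] E) = t⁻¹ • ContinuousLinearMap.id ℝ E := by ext x; rfl
        rw [this, norm_smul, ContinuousLinearMap.norm_id, mul_one, Real.norm_of_nonneg (by positivity)]
      rw [← NNReal.coe_lt_coe, NNReal.coe_inv, coe_nnnorm, this, inv_inv]
      exact ht
  have cv : ∀ Z : E → E, ContDiff ℝ 1 Z → LipschitzWith C Z → ∀ t : ℝ, (C : ℝ) < t →
      ∫ x in ball 0 R, (t • (1 : E →L[ℝ] E) + fderiv ℝ Z x).det ∂μ =
      μ.real ((fun x => t • x + Z x) '' ball 0 R) := by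
    intro Z hZ hZC t ht
    have hFd : ∀ x, HasFDerivAt (fun x => t • x + Z x) (t • (1 : E →L[ℝ] E) + fderiv ℝ Z x) x :=
      fun x => ((hasFDerivAt_id x).const_smul t).add (hZ.differentiable one_ne_zero x).hasFDerivAt
    have hcv := integral_image_eq_integral_abs_det_fderiv_smul μ (s := ball (0 : E) R)
      measurableSet_ball (fun x _ => (hFd x).hasFDerivWithinAt) (bij Z hZC t ht).1.injOn
      (fun _ => (1 : ℝ))
    have h6 : ∫ x in ((fun x => t • x + Z x) '' ball 0 R), (1 : ℝ) ∂μ =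
      μ.real ((fun x => t • x + Z x) '' ball 0 R) := by simp
    rw [← h6, hcv]
    congr 1; ext x
    rw [smul_eq_mul, mul_one, abs_of_pos]
    exact det_pos_of_small _ _ (lt_of_le_of_lt (norm_fderiv_le_of_lipschitz ℝ hZC) ht)
  have img : ∀ Z W : E → E, LipschitzWith C Z → LipschitzWith C W → (∀ x, R ≤ ‖x‖ → Z x = W x) →
      ∀ t : ℝ, (C : ℝ) < t →
      (fun x => t • x + Z x) '' ball 0 R ⊆ (fun x => t • x + W x) '' ball 0 R := by
    rintro Z W hZC hWC hR t ht _ ⟨x, hx, rfl⟩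
    obtain ⟨y, hy⟩ := (bij W hWC t ht).2 (t • x + Z x)
    refine ⟨y, ?_, hy⟩
    by_contra h
    simp only [mem_ball_zero_iff, not_lt] at h hx
    have h1 : t • y + Z y = t • x + Z x := by rw [hR y h]; exact hy
    have := (bij Z hZC t ht).1 h1
    rw [this] at h; linarith
  have main : ∀ t : ℝ, C < t →
      ∫ x in ball 0 R, (t • (1 : E →L[ℝ] E) + fderiv ℝ Z x).det ∂μ =
      ∫ x in ball 0 R, (t • (1 : E →L[ℝ] E) + fderiv ℝ W x).det ∂μ := by
    intro t ht
    rw [cv Z hZ hZC t ht, cv W hW hWC t ht]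
    congr 1
    exact Subset.antisymm (img Z W hZC hWC hR t ht)
      (img W Z hWC hZC (fun x hx => (hR x hx).symm) t ht)
  obtain ⟨N, c, hc⟩ := det_interp (E := E) (fun i => (C : ℝ) + 1 + i) (fun i j h => by simpa using h)
  have hint : ∀ Z : E → E, ContDiff ℝ 1 Z → ∀ t : ℝ,
      IntegrableOn (fun x => (t • (1 : E →L[ℝ] E) + fderiv ℝ Z x).det) (ball 0 R) μ := by
    intro Z hZ t
    have hcont : Continuous (fun x => (t • (1 : E →L[ℝ] E) + fderiv ℝ Z x).det) :=
      ContinuousLinearMap.continuous_det.comp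
        (continuous_const.add (hZ.continuous_fderiv one_ne_zero))
    exact (hcont.continuousOn.integrableOn_compact (isCompact_closedBall 0 R)).mono_set
      ball_subset_closedBall
  have e1 : ∀ Z : E → E, ContDiff ℝ 1 Z → ∫ x in ball 0 R, (fderiv ℝ Z x).det ∂μ =
      ∑ i ∈ Finset.range N, c i *
        ∫ x in ball 0 R, (((C : ℝ) + 1 + i) • (1 : E →L[ℝ] E) + fderiv ℝ Z x).det ∂μ := by
    intro Z hZ
    rw [show (fun x => (fderiv ℝ Z x).det) = fun x => ∑ i ∈ Finset.range N,
      c i * (((C : ℝ) + 1 + i) • (1 : E →L[ℝ] E) + fderiv ℝ Z x).det from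
      funext fun x => hc (fderiv ℝ Z x)]
    rw [integral_finsetSum _ (fun i _ => (hint Z hZ _).const_mul (c i))]
    refine Finset.sum_congr rfl (fun i _ => ?_)
    rw [integral_const_mul]
  rw [e1 Z hZ, e1 W hW]
  refine Finset.sum_congr rfl (fun i _ => ?_)
  rw [main _ (by have : (0 : ℝ) ≤ i := Nat.cast_nonneg i
                 linarith)]

open MeasureTheory Metric Set Filter Topology

lemma step_fun (ε : ℝ) (hε : 0 < ε) : ∃ h : ℝ → ℝ, ∃ h' : ℝ → ℝ, (∀ t, HasDerivAt h (h' t) t) ∧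
    Continuous h' ∧ (∀ t, 0 ≤ h' t) ∧ (∀ t, h' t ≤ ε) ∧ (∀ t, ε ≤ |t| → h' t = 0) ∧ 0 < h' 0 := by
  have hc : Continuous (fun t : ℝ => max 0 (ε - |t|)) := by fun_prop
  refine ⟨fun t => ∫ s in (0:ℝ)..t, max 0 (ε - |s|), fun t => max 0 (ε - |t|), fun t => ?_, hc,
    fun t => le_max_left _ _, fun t => ?_, fun t ht => ?_, ?_⟩
  · exact intervalIntegral.integral_hasDerivAt_right (hc.intervalIntegrable _ _)
      (hc.stronglyMeasurableAtFilter _ _) hc.continuousAt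
  · exact max_le hε.le (by linarith [abs_nonneg t])
  · exact max_eq_left (by linarith)
  · simpa using hε

theorem degree_formula {E : Type*} [NormedAddCommGroup E] [NormedSpace ℝ E] [FiniteDimensional ℝ E]
    [MeasurableSpace E] [BorelSpace E] (μ : Measure E) [μ.IsAddHaarMeasure] (y : E) (δ : ℝ)
    (hδ : 0 < δ) : ∃ η : E → ℝ, Continuous η ∧ (∀ v, 0 ≤ η v) ∧ (∀ v, δ ≤ ‖v - y‖ → η v = 0) ∧
      0 < ∫ v, η v ∂μ ∧ ∀ (Z : E → E) (R : ℝ), ContDiff ℝ 1 Z → (∀ x, R ≤ ‖x‖ → Z x = x) →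
        ∫ x, η (Z x) * (fderiv ℝ Z x).det ∂μ = ∫ x, η x ∂μ := by
  classical
  have : CompleteSpace E := FiniteDimensional.complete ℝ E
  have : ProperSpace E := FiniteDimensional.proper_real E
  let b := Module.finBasis ℝ E
  set N := Module.finrank ℝ E
  let L : Fin N → E →L[ℝ] ℝ := fun i => LinearMap.toContinuousLinearMap (b.coord i)
  have hLb : ∀ i j, L i (b j) = if j = i then 1 else 0 := by
    intro i j
    simp [L, Finsupp.single_apply]
  obtain ⟨S, hS, hSb⟩ : ∃ S : ℝ, 0 < S ∧ ∑ i, ‖b i‖ < S :=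
    ⟨∑ i, ‖b i‖ + 1, by positivity, by linarith⟩
  have hsum : ∀ v : E, v = ∑ i, L i v • b i := fun v => (b.sum_repr v).symm
  obtain ⟨h, h', hd, hc', h0, hle, hz, hpos⟩ := step_fun (δ / S) (by positivity)
  have hcont : Continuous h := continuous_iff_continuousAt.2 fun t => (hd t).continuousAt
  let θ : E → E := fun v => ∑ i, h (L i (v - y)) • b i
  let D : E → E →L[ℝ] E := fun v => ∑ i, h' (L i (v - y)) • (L i).smulRight (b i)
  have hθ : ∀ v, HasFDerivAt θ (D v) v := by
    intro v
    refine HasFDerivAt.fun_sum fun i _ => ?_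
    have h1 : HasFDerivAt (fun v => L i (v - y)) (L i) v :=
      HasFDerivAt.comp (g := L i) v (L i).hasFDerivAt ((hasFDerivAt_id v).sub_const y)
    have h2 := ((hd (L i (v - y))).comp_hasFDerivAt v h1).smul_const (b i)
    refine h2.congr_fderiv ?_
    ext w; simp [smul_smul]
  have hDc : Continuous D := by
    refine continuous_finsetSum _ fun i _ => ?_
    exact (hc'.comp (by fun_prop)).smul continuous_const
  have hθ1 : ContDiff ℝ 1 θ := by
    rw [contDiff_one_iff_fderiv]
    refine ⟨fun v => (hθ v).differentiableAt, ?_⟩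
    rw [show fderiv ℝ θ = D from funext fun v => (hθ v).fderiv]; exact hDc
  have hdet : ∀ v, (D v).det = ∏ i, h' (L i (v - y)) := by
    intro v
    have : (D v).det = LinearMap.det (D v : E →ₗ[ℝ] E) := rfl
    rw [this, ← LinearMap.det_toMatrix b, ← Matrix.det_diagonal]
    congr 1
    ext i j
    rw [LinearMap.toMatrix_apply, Matrix.diagonal_apply]
    have : (D v) (b j) = h' (L j (v - y)) • b j := by
      simp only [D, _root_.sum_apply, _root_.smul_apply,
        ContinuousLinearMap.smulRight_apply, hLb]
      simp
    rw [ContinuousLinearMap.coe_coe, this]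
    simp [Finsupp.single_apply]
    split_ifs with h1 h2 h2
    · rw [h1]
    · exact absurd h1.symm h2
    · exact absurd h2.symm h1
    · rfl
  let η : E → ℝ := fun v => ∏ i, h' (L i (v - y))
  have hηc : Continuous η := continuous_finsetProd _ fun i _ => hc'.comp (by fun_prop)
  have hη0 : ∀ v, 0 ≤ η v := fun v => Finset.prod_nonneg fun i _ => h0 _
  have hηs : ∀ v, δ ≤ ‖v - y‖ → η v = 0 := by
    intro v hv
    by_contra hne
    have h3 : ∀ i, |L i (v - y)| < δ / S := by
      intro i; by_contra h4; push Not at h4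
      exact hne (Finset.prod_eq_zero (Finset.mem_univ i) (hz _ h4))
    have : ‖v - y‖ ≤ ∑ i, δ / S * ‖b i‖ := by
      conv_lhs => rw [hsum (v - y)]
      refine (norm_sum_le _ _).trans (Finset.sum_le_sum fun i _ => ?_)
      rw [norm_smul]
      exact mul_le_mul_of_nonneg_right (h3 i).le (norm_nonneg _)
    rw [← Finset.mul_sum] at this
    have h5 : δ / S * ∑ i, ‖b i‖ < δ / S * S := mul_lt_mul_of_pos_left hSb (by positivity)
    rw [div_mul_cancel₀ _ hS.ne'] at h5
    linarith
  have hηy : 0 < η y := by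
    refine Finset.prod_pos fun i _ => ?_
    simpa using hpos
  have hηcs : HasCompactSupport η := by
    refine HasCompactSupport.intro (isCompact_closedBall y δ) fun v hv => hηs v ?_
    simp only [mem_closedBall, not_le, dist_eq_norm] at hv
    exact hv.le
  refine ⟨η, hηc, hη0, hηs, ?_, ?_⟩
  · exact hηc.integral_pos_of_hasCompactSupport_nonneg_nonzero hηcs hη0 hηy.ne'
  intro Z R hZ hR
  set R' : ℝ := max (R + 1) (‖y‖ + δ)
  have hR1 : R + 1 ≤ R' := le_max_left _ _
  have hR2 : ‖y‖ + δ ≤ R' := le_max_right _ _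
  obtain ⟨C1, hC1⟩ : ∃ C, LipschitzWith C Z := by
    have hus : HasCompactSupport (fun x => Z x - x) := by
      refine HasCompactSupport.intro (isCompact_closedBall 0 R) (fun x hx => ?_)
      have : R ≤ ‖x‖ := by
        by_contra h; push Not at h; exact hx (by simpa using h.le)
      simp [hR x this]
    obtain ⟨C, hC⟩ := (hZ.sub contDiff_id).lipschitzWith_of_hasCompactSupport hus one_ne_zero
    refine ⟨C + 1, ?_⟩
    have := hC.add LipschitzWith.id
    have hid : Z = fun x => Z x - x + id x := by ext x; simp
    rw [hid]; exact this
  obtain ⟨C2, hC2⟩ : ∃ C, LipschitzWith C θ := by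
    obtain ⟨M, hM⟩ : ∃ M : ℝ, ∀ v, ‖D v‖ ≤ M := by
      refine ⟨∑ i, δ / S * ‖(L i).smulRight (b i)‖, fun v => ?_⟩
      refine (norm_sum_le _ _).trans (Finset.sum_le_sum fun i _ => ?_)
      rw [norm_smul, Real.norm_of_nonneg (h0 _)]
      exact mul_le_mul_of_nonneg_right (hle _) (norm_nonneg _)
    refine ⟨M.toNNReal, ?_⟩
    refine lipschitzWith_of_nnnorm_fderiv_le (𝕜 := ℝ) (fun v => (hθ v).differentiableAt) fun v => ?_
    rw [(hθ v).fderiv]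
    rw [← NNReal.coe_le_coe, coe_nnnorm]
    exact (hM v).trans (Real.le_coe_toNNReal M)
  have hcomp : ∀ x, (fderiv ℝ (θ ∘ Z) x).det = η (Z x) * (fderiv ℝ Z x).det := by
    intro x
    have h1 := ((hθ (Z x)).comp x (hZ.differentiable one_ne_zero x).hasFDerivAt).fderiv
    rw [h1]
    have : ((D (Z x)).comp (fderiv ℝ Z x)).det = (D (Z x)).det * (fderiv ℝ Z x).det :=
      LinearMap.det_comp _ _
    rw [this, hdet]
  have hfar : ∀ x, R' ≤ ‖x‖ → η x = 0 := by
    intro x hx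
    apply hηs
    have := norm_sub_norm_le x y
    linarith
  have key := milnor_rogers μ (θ ∘ Z) θ (hθ1.comp hZ) hθ1 (max (C2 * C1) C2)
    ((hC2.comp hC1).weaken (le_max_left _ _)) (hC2.weaken (le_max_right _ _)) R'
    (fun x hx => by simp [hR x (by linarith)])
  rw [setIntegral_eq_integral_of_forall_compl_eq_zero,
    setIntegral_eq_integral_of_forall_compl_eq_zero] at key
  · simp_rw [hcomp] at key
    rw [key]
    congr 1; ext x; rw [(hθ x).fderiv, hdet]
  · intro x hx
    rw [(hθ x).fderiv, hdet]
    exact hfar x (by simpa using hx)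
  · intro x hx
    have hx' : R' ≤ ‖x‖ := by simpa using hx
    rw [hcomp, hR x (by linarith), hfar x hx', zero_mul]

open MeasureTheory Metric Set Filter Topology

lemma far_bound {E : Type*} [NormedAddCommGroup E] [NormedSpace ℝ E] [FiniteDimensional ℝ E]
    (Z : E → E) (hZ : Continuous Z) (R : ℝ) (hR : ∀ x, R ≤ ‖x‖ → Z x = x) (ρ : ℝ) (hR1 : 0 < R)
    (hne : ∀ x, ρ ≤ ‖x‖ → Z x ≠ 0) : ∃ m > 0, ∀ x, ρ ≤ ‖x‖ → m ≤ ‖Z x‖ := by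
  have : ProperSpace E := FiniteDimensional.proper_real E
  have hK : IsCompact (closedBall (0 : E) R ∩ {x | ρ ≤ ‖x‖}) :=
    (isCompact_closedBall 0 R).inter_right (isClosed_le continuous_const continuous_norm)
  obtain ⟨m, hm, h⟩ := hK.exists_forall_le' (f := fun x => ‖Z x‖) hZ.norm.continuousOn (a := 0)
    (fun x hx => norm_pos_iff.2 (hne x hx.2))
  refine ⟨min m R, lt_min hm hR1, fun x hx => ?_⟩
  by_cases hxR : R ≤ ‖x‖
  · rw [hR x hxR]; exact (min_le_right _ _).trans hxR
  · exact (min_le_left _ _).trans (h x ⟨by simpa using (not_le.1 hxR).le, hx⟩)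

lemma smoothing {E : Type*} [NormedAddCommGroup E] [NormedSpace ℝ E] [FiniteDimensional ℝ E]
    (Z : E → E) (hZ : Continuous Z) (R ρ : ℝ) (hR : ∀ x, R ≤ ‖x‖ → Z x = x)
    (hρ : ContDiffOn ℝ 1 Z (ball 0 (2 * ρ))) (hρ0 : ρ ≠ 0)
    (hne : ∀ x, ρ ≤ ‖x‖ → Z x ≠ 0) :
    ∃ Z' : E → E, ContDiff ℝ 1 Z' ∧ (∀ x, R + 1 ≤ ‖x‖ → Z' x = x) ∧
      (∀ x, ‖x‖ ≤ ρ → Z' x = Z x) ∧ ∀ x, ρ ≤ ‖x‖ → Z' x ≠ 0 := by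
  have hU : ContDiffOn ℝ 1 Z ({x | R < ‖x‖} ∪ ball 0 (2 * ρ)) := by
    refine ContDiffOn.union_of_isOpen ?_ hρ (isOpen_lt continuous_const continuous_norm) isOpen_ball
    exact contDiffOn_id.congr fun x hx => hR x (le_of_lt hx)
  have hS : IsClosed ({x : E | R + 1 ≤ ‖x‖} ∪ closedBall 0 ρ) :=
    (isClosed_le continuous_const continuous_norm).union isClosed_closedBall
  have hSU : ({x : E | R < ‖x‖} ∪ ball 0 (2 * ρ)) ∈ 𝓝ˢ ({x : E | R + 1 ≤ ‖x‖} ∪ closedBall 0 ρ) := by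
    rw [IsOpen.mem_nhdsSet ((isOpen_lt continuous_const continuous_norm).union isOpen_ball)]
    refine union_subset_union (fun x hx => ?_) ?_
    · change R < ‖x‖; change R + 1 ≤ ‖x‖ at hx; linarith
    · rcases lt_or_gt_of_ne hρ0 with h | h
      · rw [closedBall_eq_empty.2 h]; exact empty_subset _
      · exact closedBall_subset_ball (by linarith)
  obtain ⟨Z', h1, h2, h3, -⟩ := hZ.exists_contDiff_approx_and_eqOn (n := 1)
    (ε := fun x => ‖Z x‖ / 2 + max 0 (ρ - ‖x‖)) (by fun_prop) (fun x => by
      rcases lt_or_ge ‖x‖ ρ with h | h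
      · have : 0 < max 0 (ρ - ‖x‖) := lt_max_of_lt_right (by linarith)
        positivity
      · have := norm_pos_iff.2 (hne x h)
        have : 0 ≤ max 0 (ρ - ‖x‖) := le_max_left _ _
        positivity) hS hSU hU
  refine ⟨Z', h1, fun x hx => ?_, fun x hx => h3 (Or.inr (by simpa using hx)), fun x hx h0 => ?_⟩
  · rw [h3 (Or.inl hx), hR x (by linarith)]
  · have := h2 x
    rw [h0, dist_comm, dist_zero_right, max_eq_left (by linarith)] at this
    linarith [norm_nonneg (Z x), norm_pos_iff.2 (hne x hx)]

theorem brouwer {E : Type*} [NormedAddCommGroup E] [NormedSpace ℝ E] [FiniteDimensional ℝ E]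
    (Z : E → E) (hZ : Continuous Z) (R : ℝ) (p : E) (hR : ∀ x, R ≤ ‖x‖ → Z x = x - p) :
    ∃ x, Z x = 0 := by
  by_contra! hne
  let _ : MeasurableSpace E := borel E
  have : BorelSpace E := ⟨rfl⟩
  have hid : ∀ x, max (R + ‖p‖) 1 ≤ ‖x‖ → Z (x + p) = x := by
    intro x hx
    rw [hR _ _, add_sub_cancel_right]
    have := norm_sub_le (x + p) p
    rw [add_sub_cancel_right] at this
    linarith [le_max_left (R + ‖p‖) 1]
  obtain ⟨Z', h1, h2, -, h4⟩ := smoothing (fun x => Z (x + p)) (by fun_prop) _ (-1) hid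
    (by rw [ball_eq_empty.2 (by norm_num)]; exact contDiffOn_empty) (by norm_num) (fun x _ => hne _)
  obtain ⟨m, hm, hm'⟩ := far_bound Z' h1.continuous _ h2 (-1) (by positivity) h4
  obtain ⟨η, -, -, hη, hpos, hdeg⟩ := degree_formula (Measure.addHaar : Measure E) 0 m hm
  have := hdeg Z' _ h1 h2
  rw [← this] at hpos
  simp_rw [hη _ ((hm' _ ((by norm_num : (-1 : ℝ) ≤ 0).trans (norm_nonneg _))).trans_eq (by rw [sub_zero]))] at hpos
  simp at hpos

lemma det_conj {E : Type*} [NormedAddCommGroup E] [NormedSpace ℂ E] [FiniteDimensional ℂ E]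
    (A B : E →L[ℝ] E) (hA : ∀ v, A (Complex.I • v) = -(Complex.I • A v))
    (hB : ∀ v, B (Complex.I • v) = -(Complex.I • B v)) : 0 ≤ A.det * B.det := by
  let C : E →ₗ[ℂ] E :=
    { toFun := fun v => A (B v)
      map_add' := fun x y => by simp
      map_smul' := fun c v => by
        have hc : c • v = c.re • v + c.im • (Complex.I • v) := by
          rw [← Complex.coe_smul, ← Complex.coe_smul, smul_smul, ← add_smul, Complex.re_add_im]
        have hc' : c • A (B v) = c.re • A (B v) + c.im • (Complex.I • A (B v)) := by
          rw [← Complex.coe_smul, ← Complex.coe_smul, smul_smul, ← add_smul, Complex.re_add_im]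
        rw [hc, RingHom.id_apply, hc']
        simp [hA, hB] }
  have h1 : A.det * B.det = LinearMap.det (C.restrictScalars ℝ) := by
    have : C.restrictScalars ℝ = (A : E →ₗ[ℝ] E) ∘ₗ (B : E →ₗ[ℝ] E) := rfl
    rw [this, LinearMap.det_comp]
  rw [h1, LinearMap.det_restrictScalars, Algebra.norm_complex_apply]
  exact Complex.normSq_nonneg _

theorem no_field {E : Type*} [NormedAddCommGroup E] [NormedSpace ℂ E] [FiniteDimensional ℂ E]
    [Nontrivial E] (V : E → E) (hV : ContDiff ℝ 1 V)
    (hVI : ∀ x v, fderiv ℝ V x (Complex.I • v) = -(Complex.I • fderiv ℝ V x v))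
    (ω : ℂ) (hω1 : ‖ω‖ = 1) (hω : ω ≠ 1) (hVω : ∀ x, V (ω • x) = V x)
    (Z : E → E) (hZ : Continuous Z) (R ρ : ℝ) (hρ : 0 < ρ) (hR : ∀ x, R ≤ ‖x‖ → Z x = x)
    (hZV : ∀ x, ‖x‖ < 2 * ρ → Z x = - V x) (hne : ∀ x, x ≠ 0 → Z x ≠ 0) : False := by
  let _ : MeasurableSpace E := borel E
  have : BorelSpace E := ⟨rfl⟩
  have : CompleteSpace E := FiniteDimensional.complete ℂ E
  have hR : ∀ x, max R 1 ≤ ‖x‖ → Z x = x := fun x hx => hR x ((le_max_left _ _).trans hx)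
  obtain ⟨Y, h1, h2, h3, h4⟩ := smoothing Z hZ (max R 1) ρ hR
    (hV.neg.contDiffOn.congr fun x hx => hZV x (by simpa using hx)) hρ.ne'
    (fun x hx => hne x (norm_pos_iff.1 (hρ.trans_le hx)))
  obtain ⟨m, hm, hm'⟩ := far_bound Y h1.continuous _ h2 ρ (by positivity) h4
  have hYV : ∀ x, ‖x‖ ≤ ρ → Y x = - V x := fun x hx => by rw [h3 x hx, hZV x (by linarith)]
  have hYd : ∀ x, ‖x‖ < ρ → fderiv ℝ Y x = - fderiv ℝ V x := by
    intro x hx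
    have : Y =ᶠ[𝓝 x] fun x => - V x := by
      filter_upwards [(isOpen_lt continuous_norm continuous_const).mem_nhds hx] with z hz
      exact hYV z (le_of_lt hz)
    rw [this.fderiv_eq, fderiv_fun_neg]
  have hYI : ∀ x, ‖x‖ < ρ → ∀ v, fderiv ℝ Y x (Complex.I • v) = -(Complex.I • fderiv ℝ Y x v) := by
    intro x hx v; rw [hYd x hx]; simp [hVI]
  have hY0 : fderiv ℝ Y 0 = 0 := by
    rw [hYd 0 (by simpa using hρ)]
    have hlin : ∀ c v, fderiv ℝ V 0 (c • v) = (starRingEnd ℂ c) • fderiv ℝ V 0 v := by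
      intro c v
      have hc : ∀ (c : ℂ) (v : E), c • v = c.re • v + c.im • (Complex.I • v) := by
        intro c v
        rw [← Complex.coe_smul, ← Complex.coe_smul, smul_smul, ← add_smul, Complex.re_add_im]
      rw [hc c v, hc _ (fderiv ℝ V 0 v)]
      simp [hVI]
    have hω' : ∀ v, fderiv ℝ V 0 (ω • v) = fderiv ℝ V 0 v := by
      intro v
      have hd : HasFDerivAt V (fderiv ℝ V 0) 0 := (hV.differentiable one_ne_zero 0).hasFDerivAt
      let W : E →L[ℝ] E := (ω • ContinuousLinearMap.id ℂ E).restrictScalars ℝ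
      have hd2 : HasFDerivAt (V ∘ W) ((fderiv ℝ V 0).comp W) 0 := by
        refine HasFDerivAt.comp 0 ?_ W.hasFDerivAt
        rw [map_zero]; exact hd
      have : V ∘ W = V := funext fun x => hVω x
      rw [this] at hd2
      have h5 := congrArg (fun A => A v) (hd2.unique hd)
      exact h5
    ext v
    have h5 := hlin ω v
    rw [hω' v] at h5
    have h6 : (1 - starRingEnd ℂ ω) • fderiv ℝ V 0 v = 0 := by rw [sub_smul, one_smul, ← h5, sub_self]
    have h7 : (1 - starRingEnd ℂ ω) ≠ 0 := by
      intro h; apply hω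
      have := congrArg (starRingEnd ℂ) h
      simp only [map_sub, map_one, Complex.conj_conj, map_zero] at this
      exact (sub_eq_zero.1 this).symm
    simpa using (smul_eq_zero.1 h6).resolve_left h7
  by_cases hcase : ∀ x, ‖x‖ < ρ → ‖V x‖ < m / 2 → (fderiv ℝ Y x).det = 0
  · obtain ⟨η, -, -, hη, hpos, hdeg⟩ := degree_formula (Measure.addHaar : Measure E) 0 (m / 2)
      (by positivity)
    rw [← hdeg Y _ h1 h2] at hpos
    refine hpos.ne' (integral_eq_zero_of_ae (Eventually.of_forall fun x => ?_))
    by_cases hx : m / 2 ≤ ‖Y x‖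
    · simp [hη (Y x) (by simpa using hx)]
    · push Not at hx
      have hxρ : ‖x‖ < ρ := by
        by_contra h; push Not at h; linarith [hm' x h]
      have := hcase x hxρ (by rw [← norm_neg, ← hYV x hxρ.le]; exact hx)
      simp [this]
  push Not at hcase
  obtain ⟨x0, hx0, hVx0, hdet⟩ := hcase
  have hx0ne : x0 ≠ 0 := by
    rintro rfl
    rw [hY0] at hdet
    exact hdet LinearMap.det_zero''
  have hstr : HasStrictFDerivAt Y
      (((fderiv ℝ Y x0).toContinuousLinearEquivOfDetNeZero hdet : E ≃L[ℝ] E) : E →L[ℝ] E) x0 := by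
    rw [ContinuousLinearMap.coe_toContinuousLinearEquivOfDetNeZero]
    exact h1.hasStrictFDerivAt one_ne_zero
  let e := hstr.toOpenPartialHomeomorph Y
  have he : ∀ x, e x = Y x := fun x => rfl
  set r : ℝ := ‖ω - 1‖ * ‖x0‖ / 2
  have hr : 0 < r := by
    have := norm_pos_iff.2 (sub_ne_zero.2 hω)
    have := norm_pos_iff.2 hx0ne
    positivity
  set O : Set E := e.source ∩ (ball x0 r ∩ ball 0 ρ) with hO
  have hOo : IsOpen O := e.open_source.inter (isOpen_ball.inter isOpen_ball)
  have hx0O : x0 ∈ O := ⟨hstr.mem_toOpenPartialHomeomorph_source, by simpa using hr, by simpa using hx0⟩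
  have hinj : InjOn Y O := e.injOn.mono inter_subset_left
  have himo : IsOpen (Y '' O) := e.isOpen_image_of_subset_source hOo inter_subset_left
  obtain ⟨δ, hδ, hball⟩ := Metric.isOpen_iff.1 himo (Y x0) ⟨x0, hx0O, rfl⟩
  obtain ⟨η, hηc, hη0, hη, hpos, hdeg⟩ := degree_formula (Measure.addHaar : Measure E) (Y x0)
      (min δ (m / 2)) (by positivity)
  have hloc : ∀ x, η (Y x) ≠ 0 → ‖x‖ < ρ := by
    intro x hx
    by_contra h; push Not at h
    refine hx (hη _ ((min_le_right _ _).trans ?_))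
    have h5 := norm_sub_norm_le (Y x) (Y x0)
    have : ‖Y x0‖ < m / 2 := by rw [hYV x0 hx0.le, norm_neg]; exact hVx0
    linarith [hm' x h]
  have hsupp : ∀ v, v ∉ Y '' O → η v = 0 := by
    intro v hv
    by_contra h
    apply hv; apply hball
    by_contra h6
    rw [mem_ball, not_lt, dist_eq_norm] at h6
    exact h (hη v ((min_le_left _ _).trans h6))
  let O2 : Set E := (fun x => ω • x) '' O
  have hω0 : ω ≠ 0 := by intro h; simp [h] at hω1
  have hO2o : IsOpen O2 := (Homeomorph.smulOfNeZero ω hω0).isOpenMap _ hOo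
  have hYω : ∀ x ∈ O, Y (ω • x) = Y x := by
    intro x hx
    have hx' : ‖x‖ ≤ ρ := by simpa using (mem_ball.1 hx.2.2).le
    rw [hYV x hx', hYV _ (by rwa [norm_smul, hω1, one_mul]), hVω]
  have him2 : Y '' O2 = Y '' O := by
    rw [image_image]; exact image_congr hYω
  have hinj2 : InjOn Y O2 := by
    rintro _ ⟨x, hx, rfl⟩ _ ⟨x', hx', rfl⟩ h
    simp only [hYω x hx, hYω x' hx'] at h
    rw [hinj hx hx' h]
  have hdisj : Disjoint O O2 := by
    rw [Set.disjoint_left]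
    rintro _ hx ⟨x', hx', rfl⟩
    have e1 : ‖ω • x' - x0‖ < r := by simpa [dist_eq_norm] using hx.2.1
    have e2 : ‖x' - x0‖ < r := by simpa [dist_eq_norm] using hx'.2.1
    have e3 : (ω - 1) • x0 = (ω • x' - x0) - ω • (x' - x0) := by
      rw [sub_smul, smul_sub, one_smul]; abel
    have e4 : ‖ω - 1‖ * ‖x0‖ ≤ ‖ω • x' - x0‖ + ‖x' - x0‖ := by
      rw [← norm_smul, e3]
      refine (norm_sub_le _ _).trans ?_
      rw [norm_smul ω, hω1, one_mul]
    have : 2 * r = ‖ω - 1‖ * ‖x0‖ := by simp only [r]; ring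
    linarith
  set μ : Measure E := Measure.addHaar
  have hd : ∀ x, HasFDerivAt Y (fderiv ℝ Y x) x := fun x =>
    (h1.differentiable one_ne_zero x).hasFDerivAt
  set G : E → ℝ := fun x => |(fderiv ℝ Y x).det| • η (Y x) with hG
  have hfull : ∫ v in Y '' O, η v ∂μ = ∫ v, η v ∂μ :=
    setIntegral_eq_integral_of_forall_compl_eq_zero hsupp
  have c1 : ∫ x in O, G x ∂μ = ∫ v, η v ∂μ := by
    rw [← hfull]
    exact (integral_image_eq_integral_abs_det_fderiv_smul μ hOo.measurableSet
      (fun x _ => (hd x).hasFDerivWithinAt) hinj η).symm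
  have c2 : ∫ x in O2, G x ∂μ = ∫ v, η v ∂μ := by
    rw [← hfull, ← him2]
    exact (integral_image_eq_integral_abs_det_fderiv_smul μ hO2o.measurableSet
      (fun x _ => (hd x).hasFDerivWithinAt) hinj2 η).symm
  have hGc : Continuous G := (ContinuousLinearMap.continuous_det.comp
    (h1.continuous_fderiv one_ne_zero)).abs.smul (hηc.comp h1.continuous)
  have hGs : HasCompactSupport G := by
    refine HasCompactSupport.intro (isCompact_closedBall 0 ρ) fun x hx => ?_
    have : η (Y x) = 0 := by
      by_contra h; exact hx (by simpa using (hloc x h).le)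
    simp [hG, this]
  have hGi : Integrable G μ := hGc.integrable_of_hasCompactSupport hGs
  have hG0 : ∀ x, 0 ≤ G x := fun x => mul_nonneg (abs_nonneg _) (hη0 _)
  have c3 : 2 * ∫ v, η v ∂μ ≤ ∫ x, G x ∂μ := by
    rw [two_mul]; nth_rewrite 1 [← c1]; rw [← c2, ← setIntegral_union hdisj hO2o.measurableSet
      hGi.integrableOn hGi.integrableOn]
    exact setIntegral_le_integral hGi (Eventually.of_forall hG0)
  have c4 : ∫ x, η (Y x) * (fderiv ℝ Y x).det ∂μ = ∫ v, η v ∂μ := hdeg Y _ h1 h2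
  have c5 : |(fderiv ℝ Y x0).det| * ∫ x, G x ∂μ =
      (fderiv ℝ Y x0).det * ∫ x, η (Y x) * (fderiv ℝ Y x).det ∂μ := by
    rw [← integral_const_mul, ← integral_const_mul]
    congr 1; ext x
    simp only [hG, smul_eq_mul]
    by_cases hx : η (Y x) = 0
    · simp [hx]
    · have := det_conj _ _ (hYI x0 hx0) (hYI x (hloc x hx))
      rw [← mul_assoc, ← abs_mul, abs_of_nonneg this]; ring
  rw [c4] at c5
  have h8 : |(fderiv ℝ Y x0).det| * ∫ x, G x ∂μ ≤ |(fderiv ℝ Y x0).det| * ∫ v, η v ∂μ := by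
    rw [c5]; exact mul_le_mul_of_nonneg_right (le_abs_self _) hpos.le
  have h9 := le_of_mul_le_mul_left h8 (abs_pos.2 hdet)
  linarith

section grad
variable {E : Type*} [NormedAddCommGroup E] [InnerProductSpace ℂ E] [FiniteDimensional ℂ E]

structure HomIso (g : E → ℂ) (b : ℕ) : Prop where
  diff : ContDiff ℂ 2 g
  hom : ∀ (l : ℂ) (x : E), g (l • x) = l ^ b * g x
  iso : ∀ x, x ≠ 0 → fderiv ℂ g x ≠ 0

def gradV (g : E → ℂ) (x : E) : E :=
  haveI : CompleteSpace E := FiniteDimensional.complete ℂ E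
  (InnerProductSpace.toDual ℂ E).symm (fderiv ℂ g x)

lemma grad_inner (g : E → ℂ) (x v : E) : inner ℂ (gradV g x) v = fderiv ℂ g x v := by
  have : CompleteSpace E := FiniteDimensional.complete ℂ E
  exact InnerProductSpace.toDual_symm_apply

lemma grad_ext (g : E → ℂ) (x y : E) (h : ∀ v, inner ℂ y v = fderiv ℂ g x v) : gradV g x = y :=
  ext_inner_right ℂ fun v => by rw [grad_inner, h]

def dualR (E : Type*) [NormedAddCommGroup E] [InnerProductSpace ℂ E] [FiniteDimensional ℂ E] :
    (E →L[ℂ] ℂ) →L[ℝ] E :=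
  haveI : CompleteSpace E := FiniteDimensional.complete ℂ E
  { toFun := fun l => (InnerProductSpace.toDual ℂ E).symm l
    map_add' := fun x y => by simp
    map_smul' := fun c x => by
      rw [← Complex.coe_smul, LinearIsometryEquiv.map_smulₛₗ]; simp
    cont := (InnerProductSpace.toDual ℂ E).symm.continuous }

lemma dualR_smul (c : ℂ) (l : E →L[ℂ] ℂ) : dualR E (c • l) = (starRingEnd ℂ c) • dualR E l := by
  have : CompleteSpace E := FiniteDimensional.complete ℂ E
  exact LinearIsometryEquiv.map_smulₛₗ _ c l

lemma grad_contDiff {g : E → ℂ} (hg : ContDiff ℂ 2 g) : ContDiff ℝ 1 (gradV g) := by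
  have h1 : ContDiff ℂ 1 (fderiv ℂ g) := hg.fderiv_right (by norm_num)
  exact (dualR E).contDiff.comp (h1.restrict_scalars ℝ)

lemma grad_conj {g : E → ℂ} (hg : ContDiff ℂ 2 g) (x v : E) :
    fderiv ℝ (gradV g) x (Complex.I • v) = -(Complex.I • fderiv ℝ (gradV g) x v) := by
  have h1 : ContDiff ℂ 1 (fderiv ℂ g) := hg.fderiv_right (by norm_num)
  have h2 := (h1.differentiable one_ne_zero x).hasFDerivAt.restrictScalars ℝ
  have h3 : HasFDerivAt (gradV g) _ x := (dualR E).hasFDerivAt.comp x h2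
  rw [h3.fderiv]
  simp [dualR_smul]

lemma HomIso.fderiv_smul {g : E → ℂ} {b : ℕ} (h : HomIso g b) (hb : 1 ≤ b) (l : ℂ) (hl : l ≠ 0)
    (x : E) : fderiv ℂ g (l • x) = l ^ (b - 1) • fderiv ℂ g x := by
  have hd : ∀ y, HasFDerivAt g (fderiv ℂ g y) y := fun y =>
    (h.diff.differentiable two_ne_zero y).hasFDerivAt
  have h1 : HasFDerivAt (fun y => g (l • y)) ((fderiv ℂ g (l • x)).comp
      (l • ContinuousLinearMap.id ℂ E)) x :=
    HasFDerivAt.comp x (hd (l • x)) ((hasFDerivAt_id x).const_smul l)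
  have h2 : HasFDerivAt (fun y => g (l • y)) (l ^ b • fderiv ℂ g x) x := by
    have := (hd x).const_smul (l ^ b)
    refine this.congr_of_eventuallyEq (Eventually.of_forall fun y => ?_)
    simp [h.hom]
  ext v
  have h3 := congrArg (fun A => A v) (h1.unique h2)
  simp only [ContinuousLinearMap.comp_apply, _root_.smul_apply, ContinuousLinearMap.id_apply,
    map_smul, smul_eq_mul] at h3
  rw [_root_.smul_apply, smul_eq_mul]
  apply mul_left_cancel₀ hl
  rw [h3, ← mul_assoc, ← pow_succ', Nat.sub_add_cancel hb]

lemma HomIso.euler {g : E → ℂ} {b : ℕ} (h : HomIso g b) (x : E) :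
    fderiv ℂ g x x = b * g x := by
  have h1 : HasDerivAt (fun t : ℂ => t • x) x 1 := by
    simpa using (hasDerivAt_id (1 : ℂ)).smul_const x
  have h2 : HasDerivAt (fun t : ℂ => g (t • x)) (fderiv ℂ g x x) 1 := by
    refine HasFDerivAt.comp_hasDerivAt (1 : ℂ) ?_ h1
    rw [one_smul]; exact (h.diff.differentiable two_ne_zero x).hasFDerivAt
  have h3 : HasDerivAt (fun t : ℂ => g (t • x)) (b * g x) 1 := by
    have := (hasDerivAt_pow b (1 : ℂ)).mul_const (g x)
    simp only [one_pow, mul_one] at this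
    exact this.congr_of_eventuallyEq (Eventually.of_forall fun t => h.hom t x)
  exact h2.unique h3

lemma HomIso.grad_smul {g : E → ℂ} {b : ℕ} (h : HomIso g b) (hb : 1 ≤ b) (l : ℂ) (hl : l ≠ 0)
    (x : E) : gradV g (l • x) = (starRingEnd ℂ l) ^ (b - 1) • gradV g x := by
  refine grad_ext _ _ _ fun v => ?_
  rw [h.fderiv_smul hb l hl, inner_smul_left, grad_inner]
  simp

lemma HomIso.grad_euler {g : E → ℂ} {b : ℕ} (h : HomIso g b) (x : E) :
    inner ℂ (gradV g x) x = b * g x := by rw [grad_inner, h.euler]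

lemma HomIso.grad_ne {g : E → ℂ} {b : ℕ} (h : HomIso g b) {x : E} (hx : x ≠ 0) :
    gradV g x ≠ 0 := by
  intro h0
  apply h.iso x hx
  ext v; rw [← grad_inner, h0]; simp

lemma HomIso.zero {g : E → ℂ} {b : ℕ} (h : HomIso g b) (hb : 1 ≤ b) : g 0 = 0 := by
  have := h.hom 0 0
  rw [zero_smul, zero_pow (by omega), zero_mul] at this
  exact this

lemma norm_scale (x : E) (hx : x ≠ 0) : x = (‖x‖ : ℂ) • ((‖x‖ : ℂ)⁻¹ • x) := by
  rw [smul_smul, mul_inv_cancel₀, one_smul]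
  exact_mod_cast norm_ne_zero_iff.2 hx

lemma norm_scale_mem (x : E) (hx : x ≠ 0) : ((‖x‖ : ℂ)⁻¹ • x) ∈ sphere (0 : E) 1 := by
  rw [mem_sphere_zero_iff_norm, norm_smul, norm_inv, Complex.norm_real, norm_norm,
    inv_mul_cancel₀ (norm_ne_zero_iff.2 hx)]

lemma HomIso.grad_norm {g : E → ℂ} {b : ℕ} (h : HomIso g b) (hb : 1 ≤ b) (x : E) (hx : x ≠ 0) :
    ‖gradV g x‖ = ‖x‖ ^ (b - 1) * ‖gradV g ((‖x‖ : ℂ)⁻¹ • x)‖ := by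
  conv_lhs => rw [norm_scale x hx]
  rw [h.grad_smul hb _ (by exact_mod_cast norm_ne_zero_iff.2 hx), norm_smul]
  simp

lemma HomIso.grad_bounds {g : E → ℂ} {b : ℕ} (h : HomIso g b) (hb : 1 ≤ b) :
    ∃ k0 k1 : ℝ, 0 < k0 ∧ 0 < k1 ∧ ∀ x, x ≠ 0 → k0 * ‖x‖ ^ (b - 1) ≤ ‖gradV g x‖ ∧
      ‖gradV g x‖ ≤ k1 * ‖x‖ ^ (b - 1) := by
  have : ProperSpace E := FiniteDimensional.proper ℂ E
  have hc := (grad_contDiff h.diff).continuous.norm.continuousOn (s := sphere (0 : E) 1)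
  obtain ⟨k0, hk0, h0⟩ := (isCompact_sphere (0 : E) 1).exists_forall_le' hc (a := 0) fun x hx =>
    norm_pos_iff.2 (h.grad_ne (ne_zero_of_mem_unit_sphere ⟨x, hx⟩))
  obtain ⟨k1, h1⟩ := (isCompact_sphere (0 : E) 1).bddAbove_image hc
  refine ⟨k0, max k1 1, hk0, by positivity, fun x hx => ?_⟩
  rw [h.grad_norm hb x hx, mul_comm k0, mul_comm (max k1 1)]
  have hm := norm_scale_mem x hx
  exact ⟨mul_le_mul_of_nonneg_left (h0 _ hm) (by positivity),
    mul_le_mul_of_nonneg_left ((h1 ⟨_, hm, rfl⟩).trans (le_max_left _ _)) (by positivity)⟩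
end grad

lemma gl_lemma {E : Type*} [NormedAddCommGroup E] (N : Set E) (hN : IsCompact N)
    (Y : ℝ → E → E) (hY : ContinuousOn (fun p : ℝ × E => Y p.1 p.2) (Icc 0 1 ×ˢ N))
    (W : E → E) (hW : Continuous W) (h0 : ∀ x ∈ frontier N, Y 0 x = W x)
    (hf : ∀ t ∈ Icc (0 : ℝ) 1, ∀ x ∈ frontier N, Y t x ≠ 0) (h1 : ∀ x ∈ N, Y 1 x ≠ 0) :
    ∃ Z : E → E, Continuous Z ∧ (∀ x, x ∉ N → Z x = W x) ∧ ∀ x ∈ N, Z x ≠ 0 := by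
  classical
  have hcp : IsCompact (Icc (0 : ℝ) 1 ×ˢ N) := isCompact_Icc.prod hN
  have hK1 : IsCompact ((Icc (0 : ℝ) 1 ×ˢ N) ∩ (fun p : ℝ × E => Y p.1 p.2) ⁻¹' {0}) :=
    hcp.of_isClosed_subset (hY.preimage_isClosed_of_isClosed hcp.isClosed isClosed_singleton)
      inter_subset_left
  have hK := (hK1.image continuous_snd).isClosed
  have hdis : Disjoint (closure Nᶜ) (Prod.snd '' ((Icc (0 : ℝ) 1 ×ˢ N) ∩
      (fun p : ℝ × E => Y p.1 p.2) ⁻¹' {0})) := by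
    rw [Set.disjoint_left]
    rintro x hx ⟨⟨t, x'⟩, ⟨⟨ht, hxN⟩, hz⟩, rfl⟩
    refine hf t ht x' ?_ hz
    rw [frontier_eq_closure_inter_closure]
    exact ⟨subset_closure hxN, hx⟩
  obtain ⟨τ, hτ0, hτ1, hτ⟩ := exists_continuous_zero_one_of_isClosed isClosed_closure hK hdis
  refine ⟨N.piecewise (fun x => Y (τ x) x) W, ?_, fun x hx => piecewise_eq_of_notMem _ _ _ hx, ?_⟩
  · refine continuous_piecewise (fun x hx => ?_) ?_ hW.continuousOn
    · have : τ x = 0 := hτ0 (by rw [frontier_eq_closure_inter_closure] at hx; exact hx.2)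
      simp only [this]
      exact h0 x hx
    · rw [hN.isClosed.closure_eq]
      exact hY.comp (f := fun x => (τ x, x)) (by fun_prop) fun x hx => ⟨hτ x, hx⟩
  · intro x hx hz
    rw [piecewise_eq_of_mem _ _ _ hx] at hz
    have : τ x = 1 := hτ1 ⟨(τ x, x), ⟨⟨hτ x, hx⟩, hz⟩, rfl⟩
    rw [this] at hz
    exact h1 x hx hz

def rt (b : ℕ) (z : ℂ) : ℂ := Complex.exp (Complex.log z / b)

lemma rt_ne (b : ℕ) (z : ℂ) : rt b z ≠ 0 := Complex.exp_ne_zero _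

lemma rt_pow {b : ℕ} (hb : 1 ≤ b) {z : ℂ} (hz : z ≠ 0) : rt b z ^ b = z := by
  have : (b : ℂ) ≠ 0 := by exact_mod_cast (by omega : b ≠ 0)
  rw [rt, ← Complex.exp_nat_mul, mul_div_cancel₀ _ this, Complex.exp_log hz]

lemma rt_cont (b : ℕ) {z : ℂ} (hz : 0 < z.re) : ContinuousAt (rt b) z := by
  have h1 : ContinuousAt Complex.log z := continuousAt_clog (Or.inl hz)
  exact Complex.continuous_exp.continuousAt.comp (h1.div_const _)

lemma rt_real {b : ℕ} (hb : 1 ≤ b) {q : ℝ} (hq : 0 < q) : rt b ((q : ℂ) ^ b) = q := by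
  have : (b : ℂ) ≠ 0 := by exact_mod_cast (by omega : b ≠ 0)
  rw [rt, ← Complex.ofReal_pow, ← Complex.ofReal_log (by positivity), Real.log_pow]
  push_cast
  rw [mul_div_cancel_left₀ _ this, ← Complex.ofReal_exp, Real.exp_log hq]

lemma rt_one {b : ℕ} (hb : 1 ≤ b) : rt b 1 = 1 := by
  have := rt_real hb (q := 1) one_pos
  simpa using this

lemma rt_re_pow {b m : ℕ} (hm : m ≤ b) {z : ℂ} (hz : 0 < z.re) : 0 ≤ (rt b z ^ m).re := by
  rcases Nat.eq_zero_or_pos b with h0 | hb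
  · have : m = 0 := by omega
    simp [this]
  have h1 : rt b z ^ m = Complex.exp ((m / b : ℝ) * Complex.log z) := by
    rw [rt, ← Complex.exp_nat_mul]; congr 1; push_cast; ring
  rw [h1, Complex.exp_re]
  refine mul_nonneg (Real.exp_pos _).le (Real.cos_nonneg_of_mem_Icc ?_)
  rw [Complex.im_ofReal_mul, Complex.log_im]
  have h2 : |z.arg| < Real.pi / 2 := Complex.abs_arg_lt_pi_div_two_iff.2 (Or.inl hz)
  have h3 : (m / b : ℝ) ≤ 1 := by
    rw [div_le_one (by exact_mod_cast hb)]; exact_mod_cast hm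
  have h4 : |(m / b : ℝ) * z.arg| ≤ |z.arg| := by
    rw [abs_mul, abs_of_nonneg (by positivity)]
    exact mul_le_of_le_one_left (abs_nonneg _) h3
  have := abs_le.1 (h4.trans h2.le)
  exact ⟨by linarith, this.2⟩

section sigma
variable {E : Type*} [NormedAddCommGroup E] [InnerProductSpace ℂ E] [FiniteDimensional ℂ E]

def ys (g : E → ℂ) (b : ℕ) (s : ℝ) (x : E) : E :=
  x + ((s * ‖x‖ ^ 2 / ‖x‖ ^ b : ℝ) : ℂ) • gradV g x

def rr (g : E → ℂ) (b : ℕ) (x : E) : E := (rt b (g x))⁻¹ • x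

lemma HomIso.rr_mem {g : E → ℂ} {b : ℕ} (h : HomIso g b) (hb : 1 ≤ b) {x : E} (hx : 0 < (g x).re) :
    g (rr g b x) = 1 := by
  have hz : g x ≠ 0 := by intro h0; simp [h0] at hx
  rw [rr, h.hom, inv_pow, rt_pow hb hz, inv_mul_cancel₀ hz]

lemma HomIso.rr_cont {g : E → ℂ} {b : ℕ} (h : HomIso g b) {x : E} (hx : 0 < (g x).re) :
    ContinuousAt (rr g b) x :=
  (((rt_cont b hx).comp h.diff.continuous.continuousAt).inv₀ (rt_ne _ _)).smul continuousAt_id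

lemma HomIso.ne_zero_of_one {g : E → ℂ} {b : ℕ} (h : HomIso g b) (hb : 1 ≤ b) {x : E} (hx : g x = 1) :
    x ≠ 0 := by
  rintro rfl; rw [h.zero hb] at hx; exact zero_ne_one hx

lemma HomIso.sphere_est {g : E → ℂ} {b : ℕ} (h : HomIso g b) :
    ∃ d > 0, ∀ w ∈ sphere (0 : E) 1, ∀ s ∈ Icc (0 : ℝ) d,
      ‖g (w + (s : ℂ) • gradV g w) - g w - s * (‖gradV g w‖ : ℂ) ^ 2‖ ≤ s * ‖gradV g w‖ ^ 2 / 2 := by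
  have : ProperSpace E := FiniteDimensional.proper ℂ E
  have hVc := (grad_contDiff h.diff).continuous
  have hdc : Continuous (fderiv ℂ g) := h.diff.continuous_fderiv two_ne_zero
  have hev : ∀ᶠ s : ℝ in 𝓝 0, ∀ w ∈ sphere (0 : E) 1,
      ‖fderiv ℂ g (w + (s : ℂ) • gradV g w) (gradV g w) - (‖gradV g w‖ : ℂ) ^ 2‖ <
        ‖gradV g w‖ ^ 2 / 2 := by
    refine (isCompact_sphere (0 : E) 1).eventually_forall_of_forall_eventually fun w hw => ?_
    have hne : gradV g w ≠ 0 := h.grad_ne (ne_zero_of_mem_unit_sphere ⟨w, hw⟩)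
    have hc1 : Continuous fun z : ℝ × E =>
        ‖fderiv ℂ g (z.2 + (z.1 : ℂ) • gradV g z.2) (gradV g z.2) - (‖gradV g z.2‖ : ℂ) ^ 2‖ := by
      have : Continuous fun z : ℝ × E => fderiv ℂ g (z.2 + (z.1 : ℂ) • gradV g z.2) :=
        hdc.comp (continuous_snd.add ((Complex.continuous_ofReal.comp continuous_fst).smul
          (hVc.comp continuous_snd)))
      have h2 := this.clm_apply (hVc.comp continuous_snd)
      refine (h2.sub ?_).norm
      exact (Complex.continuous_ofReal.comp (hVc.comp continuous_snd).norm).pow 2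
    have hc2 : Continuous fun z : ℝ × E => ‖gradV g z.2‖ ^ 2 / 2 := by fun_prop
    refine hc1.continuousAt.eventually_lt hc2.continuousAt ?_
    have h3 : fderiv ℂ g w (gradV g w) = (‖gradV g w‖ : ℂ) ^ 2 := by
      rw [← grad_inner]; exact inner_self_eq_norm_sq_to_K _
    have := norm_pos_iff.2 hne
    simp only [Complex.ofReal_zero, zero_smul, add_zero, h3, sub_self, norm_zero]
    positivity
  obtain ⟨d, hd, hball⟩ := Metric.eventually_nhds_iff.1 hev
  refine ⟨d / 2, by positivity, fun w hw s hs => ?_⟩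
  have hder : ∀ t : ℝ, HasDerivAt (fun t : ℝ => g (w + (t : ℂ) • gradV g w) -
      (t : ℂ) * (‖gradV g w‖ : ℂ) ^ 2) (fderiv ℂ g (w + (t : ℂ) • gradV g w) (gradV g w) -
      (‖gradV g w‖ : ℂ) ^ 2) t := by
    intro t
    have e1 : HasDerivAt (fun t : ℂ => w + t • gradV g w) (gradV g w) (t : ℂ) := by
      simpa using ((hasDerivAt_id (t : ℂ)).smul_const (gradV g w)).const_add w
    have e2 := (h.diff.differentiable two_ne_zero (w + (t : ℂ) • gradV g w)).hasFDerivAt.comp_hasDerivAt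
      (t : ℂ) e1
    have e3 := (hasDerivAt_id (t : ℂ)).mul_const ((‖gradV g w‖ : ℂ) ^ 2)
    rw [one_mul] at e3
    exact (e2.sub e3).comp_ofReal
  have := norm_image_sub_le_of_norm_deriv_le_segment' (a := 0) (b := s)
    (C := ‖gradV g w‖ ^ 2 / 2) (fun t _ => (hder t).hasDerivWithinAt) (fun t ht => le_of_lt (hball (by
      rw [dist_zero_right, Real.norm_of_nonneg ht.1]; linarith [ht.2, hs.2]) w hw)) s
      ⟨hs.1, le_rfl⟩
  simp only [Complex.ofReal_zero, zero_smul, add_zero, zero_mul, sub_zero] at this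
  rw [sub_right_comm]
  refine this.trans_eq (by ring)

lemma HomIso.ys_est {g : E → ℂ} {b : ℕ} (h : HomIso g b) (hb : 1 ≤ b) :
    ∃ d > 0, ∃ C : ℝ, ∀ x, g x = 1 → (∀ s ∈ Icc (0 : ℝ) d, 1 ≤ (g (ys g b s x)).re) ∧
      ‖rr g b (ys g b d x)‖ ^ b ≤ C := by
  obtain ⟨d, hd, hest⟩ := h.sphere_est
  obtain ⟨k0, k1, hk0, hk1, hk⟩ := h.grad_bounds hb
  have main : ∀ x, g x = 1 → ∀ s ∈ Icc (0 : ℝ) d, 1 + ‖x‖ ^ b * (s * k0 ^ 2 / 2) ≤ (g (ys g b s x)).re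
      ∧ ‖ys g b s x‖ ≤ ‖x‖ * (1 + s * k1) := by
    intro x hx s hs
    have hx0 := h.ne_zero_of_one hb hx
    have hxn : (0 : ℝ) < ‖x‖ := norm_pos_iff.2 hx0
    have hxc : (‖x‖ : ℂ) ≠ 0 := by exact_mod_cast hxn.ne'
    set w := (‖x‖ : ℂ)⁻¹ • x with hw
    have hwm : w ∈ sphere (0 : E) 1 := norm_scale_mem x hx0
    have hxw : x = (‖x‖ : ℂ) • w := norm_scale x hx0
    have hV : gradV g x = ((‖x‖ : ℂ)) ^ (b - 1) • gradV g w := by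
      conv_lhs => rw [hxw]
      rw [h.grad_smul hb _ hxc, Complex.conj_ofReal]
    have hpw : (‖x‖ : ℂ) ^ b = (‖x‖ : ℂ) ^ (b - 1) * ‖x‖ := by
      rw [← pow_succ, Nat.sub_add_cancel hb]
    have hys : ys g b s x = (‖x‖ : ℂ) • (w + (s : ℂ) • gradV g w) := by
      rw [ys, hV, smul_add, ← hxw, smul_smul, smul_smul]
      congr 2
      push_cast
      rw [hpw]
      field_simp
    have hgw : (‖x‖ : ℂ) ^ b * g w = 1 := by rw [← h.hom, ← hxw, hx]
    have hVw : k0 ≤ ‖gradV g w‖ ∧ ‖gradV g w‖ ≤ k1 := by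
      have := hk w (ne_zero_of_mem_unit_sphere ⟨w, hwm⟩)
      rw [mem_sphere_zero_iff_norm] at hwm
      simpa [hwm] using this
    constructor
    · have e1 : g (ys g b s x) = 1 + (‖x‖ : ℂ) ^ b * (s * (‖gradV g w‖ : ℂ) ^ 2) + (‖x‖ : ℂ) ^ b *
          (g (w + (s : ℂ) • gradV g w) - g w - s * (‖gradV g w‖ : ℂ) ^ 2) := by
        rw [hys, h.hom, ← hgw]; ring
      have e2 := (Complex.abs_re_le_norm _).trans (hest w hwm s hs)
      rw [e1]
      have e3 : (1 + (‖x‖ : ℂ) ^ b * (s * (‖gradV g w‖ : ℂ) ^ 2)) =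
        ((1 + ‖x‖ ^ b * (s * ‖gradV g w‖ ^ 2) : ℝ) : ℂ) := by push_cast; ring
      rw [e3, Complex.add_re, Complex.ofReal_re, ← Complex.ofReal_pow, Complex.re_ofReal_mul]
      have e4 := (abs_le.1 e2).1
      have e5 : s * k0 ^ 2 ≤ s * ‖gradV g w‖ ^ 2 :=
        mul_le_mul_of_nonneg_left (pow_le_pow_left₀ hk0.le hVw.1 2) hs.1
      have e6 : 0 ≤ ‖x‖ ^ b := by positivity
      nlinarith [mul_le_mul_of_nonneg_left e4 e6, mul_le_mul_of_nonneg_left e5 e6]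
    · rw [hys, norm_smul, Complex.norm_real, norm_norm]
      refine mul_le_mul_of_nonneg_left ?_ hxn.le
      refine (norm_add_le _ _).trans ?_
      rw [mem_sphere_zero_iff_norm.1 hwm, norm_smul, Complex.norm_real, Real.norm_of_nonneg hs.1]
      gcongr
      · exact hs.1
      · exact hVw.2
  refine ⟨d, hd, (1 + d * k1) ^ b / (d * k0 ^ 2 / 2), fun x hx => ⟨fun s hs => ?_, ?_⟩⟩
  · have := (main x hx s hs).1
    have h2 : 0 ≤ ‖x‖ ^ b * (s * k0 ^ 2 / 2) := by have := hs.1; positivity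
    linarith
  · obtain ⟨m1, m2⟩ := main x hx d ⟨hd.le, le_rfl⟩
    have hxn : (0 : ℝ) < ‖x‖ := norm_pos_iff.2 (h.ne_zero_of_one hb hx)
    have hpos : 0 < ‖x‖ ^ b * (d * k0 ^ 2 / 2) := by positivity
    have hz : g (ys g b d x) ≠ 0 := by
      intro h0; rw [h0, Complex.zero_re] at m1; linarith
    rw [rr, norm_smul, norm_inv, mul_pow, inv_pow, ← norm_pow, rt_pow hb hz]
    have h3 : ‖x‖ ^ b * (d * k0 ^ 2 / 2) ≤ ‖g (ys g b d x)‖ := by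
      have := (le_abs_self _).trans (Complex.abs_re_le_norm (g (ys g b d x)))
      linarith
    have h4 : ‖ys g b d x‖ ^ b ≤ ‖x‖ ^ b * (1 + d * k1) ^ b := by
      rw [← mul_pow]; exact pow_le_pow_left₀ (norm_nonneg _) m2 b
    calc ‖g (ys g b d x)‖⁻¹ * ‖ys g b d x‖ ^ b
        ≤ (‖x‖ ^ b * (d * k0 ^ 2 / 2))⁻¹ * (‖x‖ ^ b * (1 + d * k1) ^ b) := by gcongr
      _ = _ := by
        have : ‖x‖ ^ b ≠ 0 := by positivity
        have : d * k0 ^ 2 ≠ 0 := by positivity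
        field_simp

lemma HomIso.sigma_exists {g : E → ℂ} {b : ℕ} (h : HomIso g b) (hb : 1 ≤ b) :
    ∃ d > 0, ∃ C : ℝ, ∃ σ : C({x | g x = 1}, {x | g x = 1}),
      (ContinuousMap.id _).Homotopic σ ∧ ∀ x, (σ x : E) = rr g b (ys g b d x) ∧
        1 ≤ (g (ys g b d x)).re ∧ ‖(σ x : E)‖ ^ b ≤ C := by
  obtain ⟨d, hd, C, hC⟩ := h.ys_est hb
  have hmem : ∀ (t : unitInterval) (x : {x | g x = 1}), (t : ℝ) * d ∈ Icc 0 d := fun t x =>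
    ⟨mul_nonneg t.2.1 hd.le, mul_le_of_le_one_left hd.le t.2.2⟩
  have hpos : ∀ (t : unitInterval) (x : {x | g x = 1}), 0 < (g (ys g b (t * d) x)).re := fun t x =>
    one_pos.trans_le ((hC x x.2).1 _ (hmem t x))
  let Φ : C(unitInterval × {x | g x = 1}, {x | g x = 1}) :=
    ⟨fun p => ⟨rr g b (ys g b (p.1 * d) p.2), h.rr_mem hb (hpos p.1 p.2)⟩, by
      refine Continuous.subtype_mk (continuous_iff_continuousAt.2 fun p => ?_) _
      refine ContinuousAt.comp (f := fun p : unitInterval × {x | g x = 1} =>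
        ys g b (p.1 * d) p.2) (h.rr_cont (hpos p.1 p.2)) ?_
      have hne : ‖(p.2 : E)‖ ^ b ≠ 0 :=
        pow_ne_zero _ (norm_ne_zero_iff.2 (h.ne_zero_of_one hb p.2.2))
      have hV : Continuous fun p : unitInterval × {x | g x = 1} => gradV g (p.2 : E) :=
        (grad_contDiff h.diff).continuous.comp (by fun_prop)
      have h1 : ContinuousAt (fun p : unitInterval × {x | g x = 1} =>
          ((p.1 : ℝ) * d * ‖(p.2 : E)‖ ^ 2 / ‖(p.2 : E)‖ ^ b)) p :=
        ContinuousAt.div (by fun_prop) (by fun_prop) hne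
      have h2 : ContinuousAt (fun p : unitInterval × {x | g x = 1} => (p.2 : E)) p := by fun_prop
      exact h2.add ((Complex.continuous_ofReal.continuousAt.comp h1).smul hV.continuousAt)⟩
  let σ : C({x | g x = 1}, {x | g x = 1}) := Φ.comp ⟨fun x => (1, x), by fun_prop⟩
  refine ⟨d, hd, C, σ, ⟨⟨Φ, fun x => ?_, fun x => rfl⟩⟩, fun x => ?_⟩
  · apply Subtype.ext
    change rr g b (ys g b ((0 : ℝ) * d) x) = x
    have hx : g (x : E) = 1 := x.2
    simp [ys, rr, hx, rt_one hb]
  · have hσ : (σ x : E) = rr g b (ys g b ((1 : ℝ) * d) x) := rfl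
    rw [one_mul] at hσ
    refine ⟨hσ, (hC x x.2).1 d ⟨hd.le, le_rfl⟩, ?_⟩
    rw [hσ]; exact (hC x x.2).2
end sigma

section m3
variable {E : Type*} [NormedAddCommGroup E] [InnerProductSpace ℂ E] [FiniteDimensional ℂ E]

def rotF {g : E → ℂ} {b : ℕ} (h : HomIso g b) (ζ : ℂ) (hζ : ζ ^ b = 1) :
    C({x | g x = 1}, {x | g x = 1}) :=
  ⟨fun x => ⟨ζ • (x : E), by change g _ = 1; rw [h.hom, hζ, one_mul]; exact x.2⟩, by fun_prop⟩

def Nset (g : E → ℂ) (R : ℝ) : Set E := {x | ‖x‖ ≤ R ∧ ‖g x - 1‖ ≤ 1 / 2}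

lemma Nset_re {g : E → ℂ} {R : ℝ} {x : E} (hx : x ∈ Nset g R) : 1 / 2 ≤ (g x).re := by
  have := (abs_le.1 ((Complex.abs_re_le_norm _).trans hx.2)).1
  simp at this; linarith

lemma Nset_compact {g : E → ℂ} (hg : Continuous g) (R : ℝ) : IsCompact (Nset g R) := by
  have : ProperSpace E := FiniteDimensional.proper ℂ E
  refine (isCompact_closedBall (0 : E) R).of_isClosed_subset ?_ fun x hx => by simpa using hx.1
  exact (isClosed_le continuous_norm continuous_const).inter
    (isClosed_le (hg.sub continuous_const).norm continuous_const)

lemma Nset_frontier {g : E → ℂ} (hg : Continuous g) (R : ℝ) {x : E} (hx : x ∈ frontier (Nset g R)) :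
    x ∈ Nset g R ∧ (‖x‖ = R ∨ ‖g x - 1‖ = 1 / 2) := by
  have h1 := (Nset_compact hg R).isClosed.frontier_subset hx
  refine ⟨h1, ?_⟩
  by_contra hc
  push Not at hc
  refine hx.2 (mem_interior.2 ⟨{x | ‖x‖ < R ∧ ‖g x - 1‖ < 1 / 2}, fun y hy => ⟨hy.1.le, hy.2.le⟩,
    (isOpen_lt continuous_norm continuous_const).inter
      (isOpen_lt (hg.sub continuous_const).norm continuous_const),
    lt_of_le_of_ne h1.1 hc.1, lt_of_le_of_ne h1.2 hc.2⟩)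

lemma HomIso.rr_of_one {g : E → ℂ} {b : ℕ} (hb : 1 ≤ b) {x : E} (hx : g x = 1) :
    rr g b x = x := by simp [rr, hx, rt_one hb]

open Classical in
/-- The map `rr` into the fibre. -/
def rrF {g : E → ℂ} {b : ℕ} (h : HomIso g b) (hb : 1 ≤ b) (p0 : {x | g x = 1}) (x : E) : {x | g x = 1} :=
  if hx : 0 < (g x).re then ⟨rr g b x, h.rr_mem hb hx⟩ else p0

lemma rrF_val {g : E → ℂ} {b : ℕ} (h : HomIso g b) (hb : 1 ≤ b) (p0 : {x | g x = 1}) {x : E}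
    (hx : 0 < (g x).re) : (rrF h hb p0 x : E) = rr g b x := by rw [rrF, dif_pos hx]

lemma rrF_cont {g : E → ℂ} {b : ℕ} (h : HomIso g b) (hb : 1 ≤ b) (p0 : {x | g x = 1}) (R : ℝ) :
    ContinuousOn (rrF h hb p0) (Nset g R) := by
  rw [IsInducing.subtypeVal.continuousOn_iff]
  have hp : ∀ x ∈ Nset g R, 0 < (g x).re := fun x hx => by linarith [Nset_re hx]
  refine ContinuousOn.congr (f := rr g b) (fun x hx => (h.rr_cont (hp x hx)).continuousWithinAt)
    fun x hx => rrF_val h hb p0 (hp x hx)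

def Eh {g : E → ℂ} {b : ℕ} (h : HomIso g b) (hb : 1 ≤ b) (p0 : {x | g x = 1})
    (σ : C({x | g x = 1}, {x | g x = 1})) (H : C(unitInterval × {x | g x = 1}, {x | g x = 1}))
    (t : ℝ) (x : E) : E := x - σ (H (projIcc 0 1 zero_le_one t, rrF h hb p0 x))

lemma Eh_cont {g : E → ℂ} {b : ℕ} (h : HomIso g b) (hb : 1 ≤ b) (p0 : {x | g x = 1})
    (σ : C({x | g x = 1}, {x | g x = 1})) (H : C(unitInterval × {x | g x = 1}, {x | g x = 1}))
    (R : ℝ) : ContinuousOn (fun p : ℝ × E => Eh h hb p0 σ H p.1 p.2) (univ ×ˢ Nset g R) := by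
  refine continuousOn_snd.sub ?_
  have h1 : Continuous fun q : unitInterval × {x | g x = 1} => ((σ (H q) : {x | g x = 1}) : E) := by
    fun_prop
  refine h1.comp_continuousOn (ContinuousOn.prodMk ?_ ?_)
  · exact ((continuous_projIcc (h := zero_le_one)).comp continuous_fst).continuousOn
  · exact (rrF_cont h hb p0 R).comp continuousOn_snd fun p hp => hp.2

lemma Eh_zero {g : E → ℂ} {b : ℕ} (h : HomIso g b) (hb : 1 ≤ b) (p0 : {x | g x = 1})
    (σ : C({x | g x = 1}, {x | g x = 1})) (H : C(unitInterval × {x | g x = 1}, {x | g x = 1}))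
    {C : ℝ} (hC : ∀ x, ‖(σ x : E)‖ ^ b ≤ C) {t : ℝ} {x : E} (hx : Eh h hb p0 σ H t x = 0) :
    g x = 1 ∧ ‖x‖ ^ b ≤ C ∧ (rrF h hb p0 x : E) = x := by
  have h0 := sub_eq_zero.1 hx
  have h1 : g x = 1 := by
    rw [h0]; exact (σ _).2
  refine ⟨h1, ?_, ?_⟩
  · rw [h0]; exact hC _
  · rw [rrF_val h hb p0 (by rw [h1]; simp), HomIso.rr_of_one hb h1]

lemma Eh_frontier {g : E → ℂ} {b : ℕ} (h : HomIso g b) (hb : 1 ≤ b) (p0 : {x | g x = 1})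
    (σ : C({x | g x = 1}, {x | g x = 1})) (H : C(unitInterval × {x | g x = 1}, {x | g x = 1}))
    {C : ℝ} (hC : ∀ x, ‖(σ x : E)‖ ^ b ≤ C) {R : ℝ} (hR : C < R ^ b) {t : ℝ} {x : E}
    (hx : x ∈ frontier (Nset g R)) : Eh h hb p0 σ H t x ≠ 0 := by
  intro h0
  obtain ⟨h1, h2, -⟩ := Eh_zero h hb p0 σ H hC h0
  rcases (Nset_frontier h.diff.continuous R hx).2 with h3 | h3
  · rw [h3] at h2; linarith
  · rw [h1] at h3; norm_num at h3

lemma sigma_rot {g : E → ℂ} {b : ℕ} (h : HomIso g b) (hb : 1 ≤ b) {ζ : ℂ} (hζ : ζ ^ b = 1)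
    (hζ1 : ζ ≠ 1) {d : ℝ} (hd : 0 < d) {x : E} (hx : g x = 1)
    (hx' : x = rr g b (ys g b d (ζ • x))) (hre : 1 ≤ (g (ys g b d (ζ • x))).re) : False := by
  have hz0 : ζ ≠ 0 := by rintro rfl; rw [zero_pow (by omega)] at hζ; exact zero_ne_one hζ
  set x' := ζ • x with hxx
  have hg' : g x' = 1 := by rw [hxx, h.hom, hζ, hx, one_mul]
  have hx0' := h.ne_zero_of_one hb hg'
  have hn : 0 < ‖x'‖ := norm_pos_iff.2 hx0'
  set s : ℝ := d * ‖x'‖ ^ 2 / ‖x'‖ ^ b with hs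
  have hsp : 0 < s := by positivity
  set k := (rt b (g (ys g b d x')))⁻¹ with hk
  have hgy : g (ys g b d x') ≠ 0 := by intro h0; rw [h0] at hre; norm_num at hre
  have e1 : ζ⁻¹ • x' = k • (x' + (s : ℂ) • gradV g x') := by
    rw [hxx, smul_smul, inv_mul_cancel₀ hz0, one_smul]; exact hx'
  have e2 := congrArg (fun v => inner ℂ (gradV g x') v) e1
  simp only [inner_smul_right, inner_add_right, h.grad_euler, hg', mul_one,
    inner_self_eq_norm_sq_to_K] at e2
  set q : ℝ := (b + s * ‖gradV g x'‖ ^ 2) / b with hq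
  have hb0 : (0 : ℝ) < b := by exact_mod_cast hb
  have hqp : 0 < q := by positivity
  have hbc : (b : ℂ) ≠ 0 := by exact_mod_cast hb0.ne'
  have e3 : ζ⁻¹ = k * q := by
    rw [hq]; push_cast
    rw [mul_div_assoc']
    exact eq_div_of_mul_eq hbc e2
  have e4 : g (ys g b d x') = ((q : ℂ)) ^ b := by
    have hk' : k ^ b = (g (ys g b d x'))⁻¹ := by rw [hk, inv_pow, rt_pow hb hgy]
    have := congrArg (· ^ b) e3
    simp only [inv_pow, hζ, mul_pow, hk', inv_one] at this
    field_simp at this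
    exact this
  rw [hk, e4, rt_real hb hqp, inv_mul_cancel₀ (by exact_mod_cast hqp.ne')] at e3
  exact hζ1 (by rw [← inv_inv ζ, e3, inv_one])

lemma Eh_end {g : E → ℂ} {b : ℕ} (h : HomIso g b) (hb : 1 ≤ b) (p0 : {x | g x = 1})
    {σ : C({x | g x = 1}, {x | g x = 1})} {H : C(unitInterval × {x | g x = 1}, {x | g x = 1})}
    {C d : ℝ} (hd : 0 < d) (hC : ∀ x, (σ x : E) = rr g b (ys g b d x) ∧
        1 ≤ (g (ys g b d x)).re ∧ ‖(σ x : E)‖ ^ b ≤ C) {ζ : ℂ} (hζ : ζ ^ b = 1) (hζ1 : ζ ≠ 1)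
    (hH : ∀ x, H (1, x) = rotF h ζ hζ x) (x : E) : Eh h hb p0 σ H 1 x ≠ 0 := by
  intro h0
  obtain ⟨h1, h2, h3⟩ := Eh_zero h hb p0 σ H (fun x => (hC x).2.2) h0
  have h6 : x = σ (H (1, rrF h hb p0 x)) := by
    have := sub_eq_zero.1 h0
    rwa [projIcc_right] at this
  rw [hH] at h6
  have h4 := hC (rotF h ζ hζ (rrF h hb p0 x))
  have h5 : ((rotF h ζ hζ (rrF h hb p0 x) : {x | g x = 1}) : E) = ζ • x := by
    change ζ • (rrF h hb p0 x : E) = _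
    rw [h3]
  rw [h5] at h4
  exact sigma_rot h hb hζ hζ1 hd h1 (by rw [← h4.1]; exact h6) h4.2.1

theorem HomIso.not_null {g : E → ℂ} {b : ℕ} (h : HomIso g b) (hb : 1 ≤ b) {ζ : ℂ} (hζ : ζ ^ b = 1)
    (hζ1 : ζ ≠ 1) (p0 : {x | g x = 1}) : ¬ (ContinuousMap.const _ p0).Homotopic (rotF h ζ hζ) := by
  rintro ⟨H⟩
  obtain ⟨d, hd, C, σ, -, hσ⟩ := h.sigma_exists hb
  obtain ⟨R, hR0, hR⟩ : ∃ R : ℝ, 0 < R ∧ C < R ^ b :=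
    ((eventually_gt_atTop 0).and ((tendsto_pow_atTop (by omega : b ≠ 0)).eventually_gt_atTop C)).exists
  have hgc := h.diff.continuous
  obtain ⟨Z, hZ, hZ1, hZ2⟩ := gl_lemma (Nset g R) (Nset_compact hgc R)
    (Eh h hb p0 σ H.toContinuousMap) ((Eh_cont h hb p0 σ H.toContinuousMap R).mono
      (prod_mono (subset_univ _) subset_rfl)) (fun x => x - σ p0) (by fun_prop)
    (fun x hx => by simp [Eh]) (fun t ht x hx => Eh_frontier h hb p0 σ _ (fun x => (hσ x).2.2) hR hx)
    (fun x hx => Eh_end h hb p0 hd hσ hζ hζ1 (fun x => by simp) x)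
  obtain ⟨x, hx⟩ := brouwer Z hZ (R + 1) (σ p0 : E) fun x hx => hZ1 x fun hxN => by
    have := hxN.1; linarith
  by_cases hxN : x ∈ Nset g R
  · exact hZ2 x hxN hx
  · rw [hZ1 x hxN] at hx
    have h1 := sub_eq_zero.1 hx
    have h2 : g x = 1 := by rw [h1]; exact (σ p0).2
    refine hxN ⟨le_of_not_gt fun hlt => ?_, by rw [h2]; norm_num⟩
    have h3 := (hσ p0).2.2
    rw [← h1] at h3
    have := pow_le_pow_left₀ hR0.le hlt.le b
    linarith
end m3

section m4
variable {E : Type*} [NormedAddCommGroup E] [InnerProductSpace ℂ E] [FiniteDimensional ℂ E]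

lemma np_scalar {b : ℕ} (hb : 1 ≤ b) {τ c s : ℝ} (hτ : τ ∈ Icc (0 : ℝ) 1) (hc : 0 < c) (hs : 0 < s)
    {γ k G : ℂ} (hG : γ ^ b = G) (hre : 1 / 2 ≤ G.re) (hk : ‖k‖ ≤ 1)
    (h1 : (1 - τ : ℝ) * c * γ + τ * (γ - k) = 0)
    (h2 : (1 - τ : ℝ) * (G - 1) * (starRingEnd ℂ γ) ^ (b - 1) - τ * k * s = 0) : False := by
  have hA0 : 0 < τ + (1 - τ) * c := by
    rcases hτ.1.eq_or_lt with h0 | h0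
    · rw [← h0]; linarith
    · have := mul_nonneg (sub_nonneg.2 hτ.2) hc.le; linarith
  have e1 : (τ : ℂ) * k = γ * ((τ + (1 - τ) * c : ℝ) : ℂ) := by
    push_cast at h1 ⊢; linear_combination -h1
  set A := s * (τ + (1 - τ) * c) with hA
  have hAp : 0 < A := by positivity
  set B := (1 - τ) * (‖γ‖ ^ 2) ^ (b - 1) with hB
  have hBp : 0 ≤ B := mul_nonneg (sub_nonneg.2 hτ.2) (by positivity)
  have e2 : (B : ℂ) * (G - 1) = A * G := by
    have hgg : γ ^ (b - 1) * (starRingEnd ℂ γ) ^ (b - 1) = ((‖γ‖ : ℂ) ^ 2) ^ (b - 1) := by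
      rw [← mul_pow, Complex.mul_conj']
    have hG' : γ ^ (b - 1) * γ = G := by rw [← pow_succ, Nat.sub_add_cancel hb, hG]
    rw [hA, hB]; push_cast at *
    rw [← hgg]
    linear_combination γ ^ (b - 1) * h2 + s * γ ^ (b - 1) * e1 + (τ + (1 - τ) * c) * s * hG'
  have e3 := congrArg Complex.re e2
  rw [Complex.re_ofReal_mul, Complex.re_ofReal_mul, Complex.sub_re, Complex.one_re] at e3
  have e4 : 1 < G.re := by
    by_contra! hle
    nlinarith [mul_nonneg hBp (sub_nonneg.2 hle), mul_pos hAp (by linarith : 0 < G.re)]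
  have e5 : 1 < ‖γ‖ := by
    by_contra! hle
    have : ‖G‖ ≤ 1 := by rw [← hG, norm_pow]; exact pow_le_one₀ (norm_nonneg _) hle
    linarith [(le_abs_self _).trans (Complex.abs_re_le_norm G)]
  have e6 := congrArg norm e1
  rw [norm_mul, norm_mul, Complex.norm_real, Complex.norm_real, Real.norm_of_nonneg hτ.1,
    Real.norm_of_nonneg hA0.le] at e6
  nlinarith [mul_le_mul_of_nonneg_left hk hτ.1, mul_nonneg (sub_nonneg.2 hτ.2) hc.le]

def dlt (b : ℕ) : ℝ := 1 / (2 * (b * (3 / 2) ^ b))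

lemma par_scalar {b : ℕ} (hb : 1 ≤ b) {τ c μ : ℝ} (hτ : τ ∈ Icc (0 : ℝ) 1) (hc : 0 < c) (hμ : 0 < μ)
    (hcμ : c < 2 * dlt b * μ / 27) {G : ℂ} (hG1 : ‖G - 1‖ = 1 / 2)
    (h1 : (1 - τ : ℝ) * ((G - 1) * (starRingEnd ℂ (rt b G)) ^ (b - 1) * μ + c * rt b G) +
      τ * (rt b G - 1) = 0) : False := by
  have hre : 1 / 2 ≤ G.re := by
    have := (abs_le.1 ((Complex.abs_re_le_norm _).trans hG1.le)).1
    simp at this; linarith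
  have hG0 : G ≠ 0 := by intro h0; rw [h0] at hre; norm_num at hre
  set γ := rt b G with hγ
  have hγb : γ ^ b = G := rt_pow hb hG0
  have hn1 : ‖G‖ ≤ 3 / 2 := by
    have := norm_add_le (G - 1) 1; rw [sub_add_cancel, hG1, norm_one] at this; linarith
  have hn2 : 1 / 2 ≤ ‖G‖ := hre.trans ((le_abs_self _).trans (Complex.abs_re_le_norm G))
  have hb0 : (0 : ℝ) < b := by exact_mod_cast hb
  have hgn : ‖γ‖ ≤ 3 / 2 := by
    by_contra! hlt
    have h2 : ‖γ‖ ≤ ‖γ‖ ^ b := le_self_pow₀ (by linarith) (by omega)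
    rw [← norm_pow, hγb] at h2; linarith
  have hg9 : 1 / 9 ≤ (‖γ‖ ^ 2) ^ (b - 1) := by
    have h2 : (‖γ‖ ^ 2) ^ (b - 1) * ‖γ‖ ^ 2 = ‖G‖ ^ 2 := by
      rw [← pow_succ, Nat.sub_add_cancel hb, ← pow_mul, mul_comm, pow_mul, ← norm_pow, hγb]
    have h3 : (0 : ℝ) ≤ (‖γ‖ ^ 2) ^ (b - 1) := by positivity
    have h4 : ‖γ‖ ^ 2 ≤ 9 / 4 := by nlinarith [norm_nonneg γ]
    nlinarith [mul_le_mul_of_nonneg_left h4 h3]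
  have hgs : G - 1 = (γ - 1) * ∑ j ∈ Finset.range b, γ ^ j := by
    rw [← hγb, mul_geom_sum]
  have hsum : ‖∑ j ∈ Finset.range b, γ ^ j‖ ≤ b * (3 / 2) ^ b := by
    refine (norm_sum_le _ _).trans ?_
    rw [← nsmul_eq_mul]
    conv_rhs => rw [← Finset.card_range b]
    refine Finset.sum_le_card_nsmul _ _ _ fun j hj => ?_
    rw [norm_pow, Finset.card_range]
    exact (pow_le_pow_left₀ (norm_nonneg _) hgn j).trans
      (pow_le_pow_right₀ (by norm_num) (Finset.mem_range.1 hj).le)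
  have hδ : dlt b ≤ ‖γ - 1‖ := by
    have h2 : 1 / 2 ≤ ‖γ - 1‖ * (b * (3 / 2) ^ b) := by
      rw [← hG1, hgs, norm_mul]; gcongr
    rw [dlt, div_le_iff₀ (by positivity)]; linarith
  have hδp : 0 < dlt b := by unfold dlt; positivity
  set Q := (∑ j ∈ Finset.range b, γ ^ j) * (starRingEnd ℂ γ) ^ (b - 1) with hQ
  have hQre : 1 / 9 ≤ Q.re := by
    refine hg9.trans ?_
    rw [hQ, Finset.sum_mul, Complex.re_sum]
    have ht : ∀ j ∈ Finset.range b, (γ ^ j * (starRingEnd ℂ γ) ^ (b - 1)).re =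
        (‖γ‖ ^ 2) ^ j * (γ ^ (b - 1 - j)).re := by
      intro j hj
      have hj' : j + (b - 1 - j) = b - 1 := by have := Finset.mem_range.1 hj; omega
      rw [← Complex.re_ofReal_mul, ← Complex.conj_re, map_mul, map_pow, map_pow, Complex.conj_conj,
        ← hj', pow_add, hj', ← mul_assoc, ← mul_pow, mul_comm (starRingEnd ℂ γ), Complex.mul_conj']
      push_cast; rfl
    rw [Finset.sum_congr rfl ht]
    have h3 := Finset.single_le_sum (f := fun j => (‖γ‖ ^ 2) ^ j * (γ ^ (b - 1 - j)).re)
      (s := Finset.range b) (fun j hj => mul_nonneg (by positivity)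
        (rt_re_pow (by omega) (by linarith))) (Finset.mem_range.2 (by omega : b - 1 < b))
    simpa using h3
  have e1 : (γ - 1) * (τ + (1 - τ : ℝ) * μ * Q) = -((1 - τ : ℝ) * c * γ) := by
    rw [hQ]; rw [hgs] at h1; linear_combination h1
  have e2 := congrArg norm e1
  have h1τ := sub_nonneg.2 hτ.2
  rw [norm_mul, norm_neg, norm_mul, norm_mul, Complex.norm_real, Complex.norm_real,
    Real.norm_of_nonneg hc.le, Real.norm_of_nonneg h1τ] at e2
  have e3 : τ + (1 - τ) * μ / 9 ≤ ‖(τ + (1 - τ : ℝ) * μ * Q : ℂ)‖ := by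
    refine le_trans ?_ ((le_abs_self _).trans (Complex.abs_re_le_norm _))
    rw [Complex.add_re, Complex.ofReal_re, ← Complex.ofReal_mul, Complex.re_ofReal_mul]
    nlinarith [mul_le_mul_of_nonneg_left hQre (mul_nonneg h1τ hμ.le)]
  have e4 : dlt b * (τ + (1 - τ) * μ / 9) ≤ (1 - τ) * c * (3 / 2) := by
    refine (mul_le_mul hδ e3 (add_nonneg hτ.1 (by positivity)) (norm_nonneg _)).trans ?_
    rw [e2]; gcongr
  rcases h1τ.eq_or_lt with h0 | h0
  · have : τ = 1 := by linarith
    rw [this] at e4; linarith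
  · nlinarith [mul_lt_mul_of_pos_left hcμ h0, mul_nonneg hδp.le hτ.1]

lemma HomIso.frontier_ne {g : E → ℂ} {b : ℕ} (h : HomIso g b) (hb : 1 ≤ b) {k0 : ℝ} (hk0 : 0 < k0)
    (hk : ∀ x, x ≠ 0 → k0 * ‖x‖ ^ (b - 1) ≤ ‖gradV g x‖) {c d R τ : ℝ} (hc : 0 < c)
    (hc1 : c < 2 * dlt b * (b / (max 1 (b / k0)) ^ 2) / 27) (hd : 0 < d) (hR0 : 0 < R)
    (hR : 3 / 2 * (b / k0) < R ^ b) {x : E} (hx : x ∈ frontier (Nset g R))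
    (hτ : τ ∈ Icc (0 : ℝ) 1) (hre : 1 ≤ (g (ys g b d (rr g b x))).re) :
    ((1 - τ : ℝ) : ℂ) • ((g x - 1) • gradV g x + (c : ℂ) • x) +
      (τ : ℂ) • (x - rr g b (ys g b d (rr g b x))) ≠ 0 := by
  intro h0
  obtain ⟨hxN, hxF⟩ := Nset_frontier h.diff.continuous R hx
  have hGre := Nset_re hxN
  have hGp : 0 < (g x).re := by linarith
  have hb0 : (0 : ℝ) < b := by exact_mod_cast hb
  have hG0 : g x ≠ 0 := by intro h0; rw [h0] at hGre; norm_num at hGre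
  set G := g x with hG
  set x' := rr g b x with hx'
  have hg' : g x' = 1 := h.rr_mem hb hGp
  have hx0' := h.ne_zero_of_one hb hg'
  have hn : 0 < ‖x'‖ := norm_pos_iff.2 hx0'
  set γ := rt b G with hγ
  have hγ0 : γ ≠ 0 := rt_ne _ _
  have hγb : γ ^ b = G := rt_pow hb hG0
  have hxγ : x = γ • x' := by rw [hx', rr, smul_smul, mul_inv_cancel₀ hγ0, one_smul]
  set s : ℝ := d * ‖x'‖ ^ 2 / ‖x'‖ ^ b with hs
  have hsp : 0 < s := by positivity
  have hVx : gradV g x = (starRingEnd ℂ γ) ^ (b - 1) • gradV g x' := by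
    rw [hxγ, h.grad_smul hb _ hγ0]
  set k := (rt b (g (ys g b d x')))⁻¹ with hkd
  have hgy : g (ys g b d x') ≠ 0 := by intro h0; rw [h0] at hre; norm_num at hre
  have hrr : rr g b (ys g b d x') = k • (x' + (s : ℂ) • gradV g x') := rfl
  rw [hrr, hVx] at h0
  by_cases hpar : ∃ μ : ℂ, gradV g x' = μ • x'
  · obtain ⟨μ, hμ⟩ := hpar
    have e1 := h.grad_euler x'
    rw [hμ, inner_smul_left, inner_self_eq_norm_sq_to_K, hg', mul_one] at e1
    have e2 : μ = ((b / ‖x'‖ ^ 2 : ℝ) : ℂ) := by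
      have hnc : ((‖x'‖ : ℝ) : ℂ) ^ 2 ≠ 0 := by exact_mod_cast (pow_pos hn 2).ne'
      have e3 : starRingEnd ℂ μ = ((b / ‖x'‖ ^ 2 : ℝ) : ℂ) := by
        push_cast; exact eq_div_of_mul_eq hnc e1
      rw [← Complex.conj_conj μ, e3, Complex.conj_ofReal]
    set m : ℝ := b / ‖x'‖ ^ 2 with hm
    have hmp : 0 < m := by positivity
    rw [e2] at hμ
    have hyx : ys g b d x' = ((1 + s * m : ℝ) : ℂ) • x' := by
      change x' + (s : ℂ) • gradV g x' = _
      rw [hμ, smul_smul]; push_cast; rw [add_smul, one_smul]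
    have hsm : (0 : ℝ) < 1 + s * m := by positivity
    have hk1 : k = ((1 + s * m : ℝ) : ℂ)⁻¹ := by
      rw [hkd, hyx, h.hom, hg', mul_one, rt_real hb hsm]
    have hkx : k • (x' + (s : ℂ) • gradV g x') = x' := by
      have : x' + (s : ℂ) • gradV g x' = ys g b d x' := rfl
      rw [this, hyx, hk1, smul_smul, inv_mul_cancel₀ (by exact_mod_cast hsm.ne'), one_smul]
    rw [hkx, hμ] at h0
    have hVn := hk x' hx0'
    rw [hμ, norm_smul, Complex.norm_real, Real.norm_of_nonneg hmp.le] at hVn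
    have hxb : ‖x'‖ ^ b ≤ b / k0 := by
      rw [le_div_iff₀ hk0]
      have : ‖x'‖ ^ b = ‖x'‖ ^ (b - 1) * ‖x'‖ := by rw [← pow_succ, Nat.sub_add_cancel hb]
      rw [this]
      have h3 : m * ‖x'‖ * ‖x'‖ = b := by rw [hm]; field_simp
      nlinarith [mul_le_mul_of_nonneg_right hVn hn.le]
    have hD : ‖x'‖ ≤ max 1 (b / k0) := by
      by_cases h1 : ‖x'‖ ≤ 1
      · exact h1.trans (le_max_left _ _)
      · exact ((le_self_pow₀ (not_le.1 h1).le (by omega)).trans hxb).trans (le_max_right _ _)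
    have hGn : ‖G‖ ≤ 3 / 2 := by
      have := norm_add_le (G - 1) 1; rw [sub_add_cancel, norm_one] at this; linarith [hxN.2]
    have hG1 : ‖G - 1‖ = 1 / 2 := by
      refine hxF.resolve_left fun hxR => ?_
      have : ‖x‖ ^ b ≤ 3 / 2 * (b / k0) := by
        rw [hxγ, norm_smul, mul_pow, ← norm_pow, hγb]
        gcongr
      rw [hxR] at this; linarith
    refine par_scalar hb hτ hc hmp (hc1.trans_le ?_) hG1 ?_
    · have : 0 < dlt b := by unfold dlt; positivity
      rw [hm]; gcongr
    · rw [hxγ] at h0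
      have : ((1 - τ : ℝ) * ((G - 1) * (starRingEnd ℂ (rt b G)) ^ (b - 1) * m + c * rt b G) +
        τ * (rt b G - 1) : ℂ) • x' = 0 := by
        rw [← h0]; module
      exact (smul_eq_zero.1 this).resolve_right hx0'
  · rw [hxγ] at h0
    have e1 : ((1 - τ : ℝ) * c * γ + τ * (γ - k) : ℂ) • x' +
      ((1 - τ : ℝ) * (G - 1) * (starRingEnd ℂ γ) ^ (b - 1) - τ * k * s : ℂ) • gradV g x' = 0 := by
      rw [← h0]; module
    set α := ((1 - τ : ℝ) * c * γ + τ * (γ - k) : ℂ) with hα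
    set β := ((1 - τ : ℝ) * (G - 1) * (starRingEnd ℂ γ) ^ (b - 1) - τ * k * s : ℂ) with hβ
    have hβ0 : β = 0 := by
      by_contra hne
      refine hpar ⟨-(α / β), ?_⟩
      have : gradV g x' = β⁻¹ • (β • gradV g x') := by
        rw [smul_smul, inv_mul_cancel₀ hne, one_smul]
      rw [this, eq_neg_of_add_eq_zero_right e1, smul_neg, smul_smul, neg_smul, div_eq_inv_mul]
    rw [hβ0, zero_smul, add_zero] at e1
    have hα0 := (smul_eq_zero.1 e1).resolve_right hx0'
    refine np_scalar hb hτ hc hsp hγb hGre ?_ hα0 hβ0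
    have h3 : ‖k‖ ^ b ≤ 1 := by
      rw [← norm_pow, hkd, inv_pow, rt_pow hb hgy, norm_inv]
      exact inv_le_one_of_one_le₀ (hre.trans ((le_abs_self _).trans (Complex.abs_re_le_norm _)))
    by_contra! hlt
    exact absurd h3 (not_le.2 (one_lt_pow₀ hlt (by omega)))
end m4

section m5
variable {E : Type*} [NormedAddCommGroup E] [InnerProductSpace ℂ E] [FiniteDimensional ℂ E]

def clp (t : ℝ) : ℝ := max 0 (min 1 t)
lemma clp_cont : Continuous clp := by unfold clp; fun_prop
lemma clp_nonneg (t : ℝ) : 0 ≤ clp t := le_max_left _ _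
lemma clp_le (t : ℝ) : clp t ≤ 1 := max_le zero_le_one (min_le_left _ _)
lemma clp_zero {t : ℝ} (h : t ≤ 0) : clp t = 0 := by
  rw [clp, max_eq_left]; exact (min_le_right _ _).trans h
lemma clp_one {t : ℝ} (h : 1 ≤ t) : clp t = 1 := by
  rw [clp, min_eq_left h, max_eq_right zero_le_one]
lemma clp_id {t : ℝ} (h : 0 ≤ t) (h' : t ≤ 1) : clp t = t := by
  rw [clp, min_eq_right h', max_eq_right h]

def wf (g : E → ℂ) (c : ℝ) (x : E) : E := (g x - 1) • gradV g x + (c : ℂ) • x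

def Wf (g : E → ℂ) (c R ρ : ℝ) (x : E) : E :=
  ((1 - clp (‖x‖ - R) - clp (2 - 2 * ‖x‖ / ρ) : ℝ) : ℂ) • wf g c x +
    ((clp (‖x‖ - R) : ℝ) : ℂ) • x - ((clp (2 - 2 * ‖x‖ / ρ) : ℝ) : ℂ) • gradV g x

lemma wf_cont {g : E → ℂ} {b : ℕ} (h : HomIso g b) (c : ℝ) : Continuous (wf g c) := by
  have h1 := (grad_contDiff h.diff).continuous
  have h2 := h.diff.continuous
  unfold wf; fun_prop

lemma Wf_cont {g : E → ℂ} {b : ℕ} (h : HomIso g b) (c R ρ : ℝ) : Continuous (Wf g c R ρ) := by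
  have h1 := (grad_contDiff h.diff).continuous
  have h2 := wf_cont h c
  have h3 := clp_cont
  unfold Wf; fun_prop

lemma HomIso.Wf_ne {g : E → ℂ} {b : ℕ} (h : HomIso g b) (hb : 3 ≤ b) {k0 : ℝ} (hk0 : 0 < k0)
    (hk : ∀ x, x ≠ 0 → k0 * ‖x‖ ^ (b - 1) ≤ ‖gradV g x‖) {c R ρ : ℝ} (hc : 0 < c) (hρ : 0 < ρ)
    (hρg : ∀ x, ‖x‖ < ρ → ‖g x‖ ≤ 1 / 4) (hcρ : c < k0 * (ρ / 2) ^ (b - 2) / 2) (hRρ : ρ < R)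
    (hcR : b / 4 < c * R ^ 2) {x : E} (hx : x ∉ Nset g R) (hx0 : x ≠ 0) : Wf g c R ρ x ≠ 0 := by
  intro h0
  have hn : 0 < ‖x‖ := norm_pos_iff.2 hx0
  by_cases hxR : R ≤ ‖x‖
  · have ha' : clp (2 - 2 * ‖x‖ / ρ) = 0 := by
      refine clp_zero ?_
      have : 2 ≤ 2 * ‖x‖ / ρ := by rw [le_div_iff₀ hρ]; linarith
      linarith
    rw [Wf, ha'] at h0
    simp only [sub_zero, Complex.ofReal_zero, zero_smul] at h0
    set a := clp (‖x‖ - R) with ha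
    have e1 := congrArg (fun v => (inner ℂ x v).re) h0
    have hVx : inner ℂ x (gradV g x) = b * starRingEnd ℂ (g x) := by
      rw [← inner_conj_symm, h.grad_euler]; simp
    simp only [wf, inner_add_right, inner_smul_right, hVx, inner_self_eq_norm_sq_to_K,
      inner_zero_right, Complex.zero_re] at e1
    have e2 : ((g x - 1) * (b * starRingEnd ℂ (g x)) : ℂ).re =
        b * ((g x).re ^ 2 + (g x).im ^ 2 - (g x).re) := by
      simp; ring
    have e3 : (((‖x‖ : ℝ) : ℂ) ^ 2) = ((‖x‖ ^ 2 : ℝ) : ℂ) := by push_cast; rfl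
    change (((1 - a : ℝ) : ℂ) * ((g x - 1) * (b * starRingEnd ℂ (g x)) + c * ((‖x‖ : ℝ) : ℂ) ^ 2) +
      (a : ℂ) * ((‖x‖ : ℝ) : ℂ) ^ 2).re = 0 at e1
    rw [e3, Complex.add_re, Complex.re_ofReal_mul, Complex.re_ofReal_mul, Complex.add_re, e2,
      Complex.re_ofReal_mul, Complex.ofReal_re] at e1
    have h4 : 0 < b * ((g x).re ^ 2 + (g x).im ^ 2 - (g x).re) + c * ‖x‖ ^ 2 := by
      have hR0 : 0 ≤ R := by linarith
      have h5 : c * R ^ 2 ≤ c * ‖x‖ ^ 2 := by gcongr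
      have hb0 : (0 : ℝ) < b := by exact_mod_cast (by omega : 0 < b)
      nlinarith [sq_nonneg ((g x).re - 1 / 2), sq_nonneg (g x).im, mul_nonneg hb0.le
        (add_nonneg (sq_nonneg ((g x).re - 1 / 2)) (sq_nonneg (g x).im))]
    have ha0 := clp_nonneg (‖x‖ - R)
    have ha1 := clp_le (‖x‖ - R)
    rw [← ha] at ha0 ha1
    rcases ha0.eq_or_lt with h6 | h6
    · rw [← h6] at e1; linarith
    · nlinarith [mul_nonneg (sub_nonneg.2 ha1) h4.le, mul_pos h6 (pow_pos hn 2)]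
  · push Not at hxR
    have hg1 : 1 / 2 < ‖g x - 1‖ := by
      by_contra! hle; exact hx ⟨hxR.le, hle⟩
    have ha : clp (‖x‖ - R) = 0 := clp_zero (by linarith)
    rw [Wf, ha] at h0
    simp only [sub_zero, Complex.ofReal_zero, zero_smul, add_zero] at h0
    set a := clp (2 - 2 * ‖x‖ / ρ) with ha'
    have ha0 := clp_nonneg (2 - 2 * ‖x‖ / ρ)
    have ha1 := clp_le (2 - 2 * ‖x‖ / ρ)
    rw [← ha'] at ha0 ha1
    by_cases hxρ : ‖x‖ ≤ ρ / 2
    · have : a = 1 := clp_one (by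
        have : 2 * ‖x‖ / ρ ≤ 1 := by rw [div_le_iff₀ hρ]; linarith
        linarith)
      rw [this] at h0
      simp at h0
      exact h.grad_ne hx0 h0
    · push Not at hxρ
      set q : ℂ := ((1 - a : ℝ) : ℂ) * (g x - 1) - a with hq
      have e1 : q • gradV g x = -(((1 - a) * c : ℝ) : ℂ) • x := by
        rw [← sub_eq_zero, ← h0, wf, hq]
        push_cast; module
      have hq2 : 1 / 2 ≤ ‖q‖ := by
        by_cases hx2 : ‖x‖ < ρ
        · have h3 : (g x).re ≤ 1 / 4 :=
            ((le_abs_self _).trans (Complex.abs_re_le_norm _)).trans (hρg x hx2)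
          have h4 : q.re ≤ -(1 / 2) := by
            rw [hq, Complex.sub_re, Complex.re_ofReal_mul, Complex.sub_re, Complex.one_re,
              Complex.ofReal_re]
            nlinarith
          have := (abs_le.1 (Complex.abs_re_le_norm q)).1
          linarith
        · have : a = 0 := clp_zero (by
            have : 2 ≤ 2 * ‖x‖ / ρ := by rw [le_div_iff₀ hρ]; linarith
            linarith)
          rw [hq, this]; simpa using hg1.le
      have e2 := congrArg norm e1
      rw [norm_smul, norm_smul, norm_neg, Complex.norm_real,
        Real.norm_of_nonneg (mul_nonneg (by linarith) hc.le)] at e2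
      have e3 : c * ‖x‖ < k0 * ‖x‖ ^ (b - 1) / 2 := by
        have : ‖x‖ ^ (b - 1) = ‖x‖ ^ (b - 2) * ‖x‖ := by
          rw [← pow_succ]; congr 1; omega
        rw [this]
        have h5 : (ρ / 2) ^ (b - 2) ≤ ‖x‖ ^ (b - 2) := by gcongr
        have h6 : c < k0 * ‖x‖ ^ (b - 2) / 2 := by nlinarith
        nlinarith
      have e4 := hk x hx0
      have e5 : (1 / 2) * (k0 * ‖x‖ ^ (b - 1)) ≤ ‖q‖ * ‖gradV g x‖ := by gcongr
      have e6 : (1 - a) * c * ‖x‖ ≤ c * ‖x‖ := by nlinarith [mul_pos hc hn]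
      linarith

theorem HomIso.not_id {g : E → ℂ} {b : ℕ} [Nontrivial E] (h : HomIso g b) (hb3 : 3 ≤ b) {ζ : ℂ}
    (hζ : ζ ^ b = 1) (hζ1 : ζ ≠ 1) (p0 : {x | g x = 1}) :
    ¬ (ContinuousMap.id _).Homotopic (rotF h ζ hζ) := by
  rintro ⟨H⟩
  have hb : 1 ≤ b := by omega
  obtain ⟨d, hd, C, σ, -, hσ⟩ := h.sigma_exists hb
  have hgc := h.diff.continuous
  obtain ⟨k0, k1, hk0, -, hk'⟩ := h.grad_bounds hb
  have hk := fun x hx => (hk' x hx).1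
  obtain ⟨ρ, hρ, hρg⟩ : ∃ ρ > 0, ∀ x, ‖x‖ < ρ → ‖g x‖ ≤ 1 / 4 := by
    have h1 := Metric.continuousAt_iff.1 (hgc.continuousAt (x := 0)) (1 / 4) (by norm_num)
    obtain ⟨ρ, hρ, h2⟩ := h1
    refine ⟨ρ, hρ, fun x hx => ?_⟩
    have := h2 (x := x) (by simpa using hx)
    rw [h.zero hb, dist_zero_right] at this; exact this.le
  have hb0 : (0 : ℝ) < b := by exact_mod_cast hb
  have hδ : 0 < dlt b := by unfold dlt; positivity
  have hD : 0 < max 1 (b / k0) := lt_max_of_lt_left one_pos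
  obtain ⟨c, hc, hcm⟩ := exists_between (show 0 < min (k0 * (ρ / 2) ^ (b - 2) / 2)
    (2 * dlt b * (b / (max 1 (b / k0)) ^ 2) / 27) by
      refine lt_min (by positivity) (by positivity))
  have hc1 := hcm.trans_le (min_le_left _ _)
  have hc2 := hcm.trans_le (min_le_right _ _)
  obtain ⟨R, hRρ, hRC, hRk, hRc⟩ : ∃ R : ℝ, ρ < R ∧ C < R ^ b ∧ 3 / 2 * (b / k0) < R ^ b ∧
      b / 4 < c * R ^ 2 := by
    have t1 := tendsto_pow_atTop (α := ℝ) (by omega : b ≠ 0)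
    have t2 := (tendsto_pow_atTop (α := ℝ) two_ne_zero).const_mul_atTop hc
    exact ((eventually_gt_atTop ρ).and ((t1.eventually_gt_atTop C).and
      ((t1.eventually_gt_atTop _).and (t2.eventually_gt_atTop _)))).exists
  have hR0 : 0 < R := hρ.trans hRρ
  let Y : ℝ → E → E := fun t x => ((1 - clp (2 * t) : ℝ) : ℂ) • wf g c x +
    ((clp (2 * t) : ℝ) : ℂ) • Eh h hb p0 σ H.toContinuousMap (clp (2 * t - 1)) x
  have hsmall : ∀ x, ‖x‖ < ρ → x ∉ Nset g R := by
    intro x hx hxN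
    have h1 := Nset_re hxN
    have h2 := ((le_abs_self _).trans (Complex.abs_re_le_norm _)).trans (hρg x hx)
    linarith
  have hYc : ContinuousOn (fun p : ℝ × E => Y p.1 p.2) (Icc 0 1 ×ˢ Nset g R) := by
    have c1 := clp_cont
    have c2 := wf_cont h c
    have c3 : ContinuousOn (fun p : ℝ × E => Eh h hb p0 σ H.toContinuousMap (clp (2 * p.1 - 1)) p.2)
        (Icc 0 1 ×ˢ Nset g R) := by
      refine (Eh_cont h hb p0 σ H.toContinuousMap R).comp
        (f := fun p : ℝ × E => (clp (2 * p.1 - 1), p.2)) (by fun_prop) ?_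
      exact fun p hp => ⟨mem_univ _, hp.2⟩
    refine ContinuousOn.add (by fun_prop) (ContinuousOn.smul (by fun_prop) c3)
  obtain ⟨Z, hZ, hZ1, hZ2⟩ := gl_lemma (Nset g R) (Nset_compact hgc R) Y hYc
    (Wf g c R ρ) (Wf_cont h c R ρ) (by
  intro x hx
  · have hxN := (Nset_frontier hgc R hx).1
    have h1 : clp (‖x‖ - R) = 0 := clp_zero (by linarith [hxN.1])
    have h2 : clp (2 - 2 * ‖x‖ / ρ) = 0 := clp_zero (by
      have : ρ ≤ ‖x‖ := by by_contra! hlt; exact hsmall x hlt hxN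
      have : 2 ≤ 2 * ‖x‖ / ρ := by rw [le_div_iff₀ hρ]; linarith
      linarith)
    have h3 : clp (2 * 0) = 0 := clp_zero (by norm_num)
    simp only [Y, Wf, h1, h2, h3]; simp) (by
  intro t ht x hx
  · by_cases ht2 : t ≤ 1 / 2
    · have h1 : clp (2 * t - 1) = 0 := clp_zero (by linarith)
      have hxN := (Nset_frontier hgc R hx).1
      have hpos : 0 < (g x).re := by linarith [Nset_re hxN]
      have h2 : Eh h hb p0 σ H.toContinuousMap 0 x = x - rr g b (ys g b d (rr g b x)) := by
        simp [Eh, (hσ _).1, rrF_val h hb p0 hpos]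
      have h3 := (hσ (rrF h hb p0 x)).2.1
      rw [rrF_val h hb p0 hpos] at h3
      simp only [Y, h1, h2]
      exact h.frontier_ne hb hk0 hk hc hc2 hd hR0 hRk hx ⟨clp_nonneg _, clp_le _⟩ h3
    · have h1 : clp (2 * t) = 1 := clp_one (by linarith)
      simp only [Y, h1]
      simpa using Eh_frontier h hb p0 σ _ (fun x => (hσ x).2.2) hRC hx) (by
  intro x hx
  · have h1 : clp (2 * 1) = 1 := clp_one (by norm_num)
    have h2 : clp (2 * 1 - 1) = 1 := clp_one (by norm_num)
    simp only [Y, h1, h2]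
    simpa using Eh_end h hb p0 (H := H.toContinuousMap) hd hσ hζ hζ1 (fun x => by simp) x)
  have hb1 : b - 1 ≠ 0 := by omega
  have hω := Complex.isPrimitiveRoot_exp (b - 1) hb1
  set ω := Complex.exp (2 * Real.pi * Complex.I / ((b - 1 : ℕ) : ℂ)) with hωd
  refine no_field (gradV g) (grad_contDiff h.diff) (grad_conj h.diff) ω
    (hω.norm'_eq_one hb1) (hω.ne_one (by omega)) (fun x => ?_) Z hZ (R + 1) (ρ / 4) (by positivity)
    (fun x hx => ?_) (fun x hx => ?_) fun x hx => ?_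
  · rw [h.grad_smul hb _ (hω.ne_zero hb1), ← map_pow, hω.pow_eq_one, map_one, one_smul]
  · rw [hZ1 x fun hxN => by have := hxN.1; linarith]
    have h1 : clp (‖x‖ - R) = 1 := clp_one (by linarith)
    have h2 : clp (2 - 2 * ‖x‖ / ρ) = 0 := clp_zero (by
      have : 2 ≤ 2 * ‖x‖ / ρ := by rw [le_div_iff₀ hρ]; linarith
      linarith)
    simp [Wf, h1, h2]
  · rw [hZ1 x (hsmall x (by linarith))]
    have h1 : clp (‖x‖ - R) = 0 := clp_zero (by linarith)
    have h2 : clp (2 - 2 * ‖x‖ / ρ) = 1 := clp_one (by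
      have : 2 * ‖x‖ / ρ ≤ 1 := by rw [div_le_iff₀ hρ]; linarith
      linarith)
    simp [Wf, h1, h2]
  · by_cases hxN : x ∈ Nset g R
    · exact hZ2 x hxN
    · rw [hZ1 x hxN]
      exact h.Wf_ne hb3 hk0 hk hc hρ hρg hc1 hRρ hRc hxN hx
end m5

lemma log_param {X : Type*} [TopologicalSpace X] (v : unitInterval × X → ℂ) (hv : Continuous v)
    (hne : ∀ p, v p ≠ 0) (f : X → ℂ) (hf : Continuous f) (h0 : ∀ x, v (0, x) = Complex.exp (f x)) :
    ∃ L : unitInterval × X → ℂ, Continuous L ∧ (∀ p, Complex.exp (L p) = v p) ∧ ∀ x, L (0, x) = f x := by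
  let H : C(unitInterval × X, {z : ℂ // z ≠ 0}) := ⟨fun p => ⟨v p, hne p⟩, by fun_prop⟩
  have H0 : ∀ a, H (0, a) = (fun z : ℂ ↦ (⟨_, z.exp_ne_zero⟩ : {z : ℂ // z ≠ 0})) ((⟨f, hf⟩ : C(X, ℂ)) a) :=
    fun a => Subtype.ext (h0 a)
  refine ⟨Complex.isCoveringMap_exp.liftHomotopy H ⟨f, hf⟩ H0, ContinuousMap.continuous _, fun p => ?_,
    fun x => Complex.isCoveringMap_exp.liftHomotopy_zero H ⟨f, hf⟩ H0 x⟩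
  have := congr_fun (Complex.isCoveringMap_exp.liftHomotopy_lifts H ⟨f, hf⟩ H0) p
  exact congrArg Subtype.val this

lemma log_star {E : Type*} [NormedAddCommGroup E] [NormedSpace ℝ E] {K : Set E} {p : E} (hp : p ∈ K)
    (hK : StarConvex ℝ p K) {u : E → ℂ} (hu : ContinuousOn u K) (hne : ∀ x ∈ K, u x ≠ 0) :
    ∃ L : E → ℂ, ContinuousOn L K ∧ ∀ x ∈ K, u x = Complex.exp (L x) := by
  have hm : ∀ q : unitInterval × K, p + (q.1 : ℝ) • ((q.2 : E) - p) ∈ K := fun q =>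
    hK.add_smul_sub_mem q.2.2 q.1.2.1 q.1.2.2
  obtain ⟨L, hL, hL1, -⟩ := log_param (fun q : unitInterval × K => u (p + (q.1 : ℝ) • ((q.2 : E) - p)))
    (hu.comp_continuous (by fun_prop) hm) (fun q => hne _ (hm q)) (fun _ => Complex.log (u p))
    continuous_const (fun x => by simp [Complex.exp_log (hne p hp)])
  classical
  refine ⟨fun x => if hx : x ∈ K then L (1, ⟨x, hx⟩) else 0, ?_, fun x hx => ?_⟩
  · rw [continuousOn_iff_continuous_domRestrict]
    have : Continuous fun x : K => L (1, x) := by fun_prop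
    convert this using 1
    ext x; simp
  · have := hL1 (1, ⟨x, hx⟩)
    simp [hx, this]

lemma two_pi_I_eq (k : ℤ) : k • (2 * Real.pi * Complex.I) = k * (2 * Real.pi * Complex.I) := by simp

lemma const_of_exp {E : Type*} [TopologicalSpace E] {K : Set E} (hK : IsPreconnected K) {h : E → ℂ}
    (hh : ContinuousOn h K) (h1 : ∀ x ∈ K, Complex.exp (h x) = 1) :
    ∃ k : ℤ, ∀ x ∈ K, h x = k * (2 * Real.pi * Complex.I) := by
  rcases K.eq_empty_or_nonempty with rfl | ⟨x0, hx0⟩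
  · exact ⟨0, by simp⟩
  obtain ⟨k, hk⟩ := Complex.exp_eq_one_iff.1 (h1 x0 hx0)
  refine ⟨k, fun x hx => ?_⟩
  rw [← hk]
  have : DiscreteTopology ((AddSubgroup.zmultiples (2 * Real.pi * Complex.I) : AddSubgroup ℂ) : Set ℂ) :=
    NormedSpace.discreteTopology_zmultiples _
  refine hK.constant_of_mapsTo ⟨this⟩ hh (T := ((AddSubgroup.zmultiples (2 * Real.pi * Complex.I) :
    AddSubgroup ℂ) : Set ℂ)) (fun y hy => ?_) hx hx0
  obtain ⟨j, hj⟩ := Complex.exp_eq_one_iff.1 (h1 y hy)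
  exact AddSubgroup.mem_zmultiples_iff.2 ⟨j, by rw [two_pi_I_eq, hj]⟩

lemma two_pi_I_ne : (2 * Real.pi * Complex.I : ℂ) ≠ 0 := by simp [Real.pi_ne_zero]

/-- W2 -/
lemma wind_zero {k : ℤ} {c : ℂ} {μ : ℝ → ℂ} (hμ : Continuous μ)
    (hper : μ (2 * Real.pi) = μ 0) (hc : c ≠ 0)
    (h : ∀ θ : ℝ, c * Complex.exp (k * (θ * Complex.I)) = Complex.exp (μ θ)) : k = 0 := by
  obtain ⟨j, hj⟩ := const_of_exp (K := (univ : Set ℝ)) isPreconnected_univ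
    (h := fun θ => μ θ - Complex.log c - k * (θ * Complex.I)) (by fun_prop) (fun θ _ => by
      rw [Complex.exp_sub, Complex.exp_sub, ← h θ, Complex.exp_log hc]
      have := Complex.exp_ne_zero (k * (θ * Complex.I))
      field_simp)
  have h1 := hj 0 trivial
  have h2 := hj (2 * Real.pi) trivial
  rw [← h2, hper] at h1
  have h3 : (k : ℂ) * (2 * Real.pi * Complex.I) = 0 := by
    push_cast at h1; linear_combination h1
  exact_mod_cast (mul_eq_zero.1 h3).resolve_right two_pi_I_ne

/-- W3 -/
lemma wind_exists {u : ℝ → ℂ} (hu : Continuous u) (hne : ∀ θ, u θ ≠ 0)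
    (hper : ∀ θ, u (θ + 2 * Real.pi) = u θ) :
    ∃ j : ℤ, ∃ μ : ℝ → ℂ, Continuous μ ∧ (∀ θ, μ (θ + 2 * Real.pi) = μ θ) ∧
      ∀ θ, u θ = Complex.exp (j * (θ * Complex.I) + μ θ) := by
  obtain ⟨L, hL, hL1⟩ := log_star (K := (univ : Set ℝ)) (mem_univ 0) (starConvex_univ 0)
    hu.continuousOn (fun x _ => hne x)
  rw [continuousOn_univ] at hL
  obtain ⟨j, hj⟩ := const_of_exp (K := (univ : Set ℝ)) isPreconnected_univ
    (h := fun θ => L (θ + 2 * Real.pi) - L θ) (by fun_prop) (fun θ _ => by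
      rw [Complex.exp_sub, ← hL1 _ trivial, ← hL1 _ trivial, hper, div_self (hne θ)])
  refine ⟨j, fun θ => L θ - j * (θ * Complex.I), by fun_prop, fun θ => ?_, fun θ => ?_⟩
  · have := hj θ trivial
    push_cast; linear_combination this
  · rw [hL1 θ trivial]; congr 1; ring

section haslog
variable {E : Type*} [NormedAddCommGroup E] [NormedSpace ℂ E]

/-- `u = f ^ e * exp L` near `p` off the zero set of `f`. -/
def HasLog (f u : E → ℂ) (e : ℤ) (p : E) : Prop :=
  ∃ L : E → ℂ, ∃ r > 0, ContinuousOn L (ball p r ∩ {x | f x ≠ 0}) ∧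
    ∀ x ∈ ball p r, f x ≠ 0 → u x = f x ^ e * Complex.exp (L x)

/-- W1 -/
lemma hasLog_linear (l : E →L[ℂ] ℂ) (hl : l ≠ 0) {u : E → ℂ} {r : ℝ} (hr : 0 < r)
    (hu : ContinuousOn u (ball 0 r ∩ {x | l x ≠ 0})) (hne : ∀ x ∈ ball (0 : E) r, l x ≠ 0 → u x ≠ 0) :
    ∃ e, HasLog l u e 0 := by
  obtain ⟨v0, hv0⟩ : ∃ v, l v = 1 := by
    obtain ⟨v, hv⟩ := DFunLike.ne_iff.1 hl
    exact ⟨(l v)⁻¹ • v, by rw [map_smul, smul_eq_mul, inv_mul_cancel₀ hv]⟩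
  have hv0' : 0 < 1 + ‖v0‖ := by positivity
  set ρ := r / (2 * (1 + ‖v0‖)) with hρ
  have hρp : 0 < ρ := by positivity
  have hρ2 : ρ * (1 + ‖v0‖) = r / 2 := by rw [hρ]; field_simp
  let c : ℂ × E → E := fun q => Complex.exp q.1 • v0 + q.2
  have hc : Continuous c := by unfold c; fun_prop
  let K : Set (ℂ × E) := {q | q.1.re < Real.log ρ ∧ l q.2 = 0 ∧ ‖q.2‖ < ρ}
  have hKc : Convex ℝ K := by
    intro x hx y hy a b ha hb hab
    refine ⟨?_, ?_, ?_⟩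
    · have := (convex_Iio (𝕜 := ℝ) (Real.log ρ)) hx.1 hy.1 ha hb hab
      simpa using this
    · change l (a • x.2 + b • y.2) = 0
      rw [map_add, ← Complex.coe_smul, ← Complex.coe_smul, map_smul, map_smul, hx.2.1, hy.2.1]; simp
    · have := (convex_ball (0 : E) ρ) (mem_ball_zero_iff.2 hx.2.2) (mem_ball_zero_iff.2 hy.2.2) ha hb hab
      exact mem_ball_zero_iff.1 this
  have hlc : ∀ q ∈ K, l (c q) = Complex.exp q.1 := fun q hq => by simp [c, hv0, hq.2.1]
  have hcK : ∀ q ∈ K, c q ∈ ball 0 r ∩ {x | l x ≠ 0} := by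
    intro q hq
    refine ⟨?_, by change l (c q) ≠ 0; rw [hlc q hq]; exact Complex.exp_ne_zero _⟩
    rw [mem_ball_zero_iff]
    refine (norm_add_le _ _).trans_lt ?_
    rw [norm_smul, Complex.norm_exp]
    have h1 : Real.exp q.1.re < ρ := by rw [← Real.lt_log_iff_exp_lt hρp]; exact hq.1
    nlinarith [hq.2.2, norm_nonneg v0]
  have hqz : ∀ (z : E) (w : ℂ), ‖z‖ * (1 + ‖l‖) * (1 + ‖v0‖) < ρ → Complex.exp w = l z →
      (w, z - l z • v0) ∈ K := by
    intro z w hz hw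
    have h1 : ‖l z‖ ≤ ‖l‖ * ‖z‖ := l.le_opNorm z
    have h2 := norm_nonneg z
    have h3 := norm_nonneg l
    have h4 := norm_nonneg v0
    refine ⟨?_, by simp [hv0], ?_⟩
    · rw [Real.lt_log_iff_exp_lt hρp, ← Complex.norm_exp, hw]
      nlinarith [mul_nonneg h2 h3, mul_nonneg h2 h4, mul_nonneg (mul_nonneg h2 h3) h4]
    · refine (norm_sub_le _ _).trans_lt ?_
      rw [norm_smul]
      nlinarith [mul_nonneg h2 h3, mul_nonneg h2 h4, mul_le_mul_of_nonneg_right h1 h4]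
  rcases K.eq_empty_or_nonempty with hKe | ⟨p, hp⟩
  · exfalso
    have : ((((Real.log ρ - 1 : ℝ) : ℂ), (0 : E))) ∈ K := ⟨by simp, by simp, by simpa using hρp⟩
    rw [hKe] at this; exact this
  obtain ⟨L, hL, hL1⟩ := log_star hp (hKc.starConvex hp) (u := u ∘ c)
    (hu.comp hc.continuousOn hcK) (fun q hq => hne _ (hcK q hq).1 (hcK q hq).2)
  let sh : ℂ × E → ℂ × E := fun q => (q.1 + 2 * Real.pi * Complex.I, q.2)
  have hsh : ∀ q ∈ K, sh q ∈ K := fun q hq => ⟨by simpa [sh] using hq.1, hq.2.1, hq.2.2⟩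
  have hcsh : ∀ q, c (sh q) = c q := fun q => by simp [c, sh, Complex.exp_add]
  obtain ⟨e, he⟩ := const_of_exp hKc.isPreconnected (h := fun q => L (sh q) - L q)
    ((hL.comp (by unfold sh; fun_prop) hsh).sub hL) (fun q hq => by
      rw [Complex.exp_sub, ← hL1 q hq, ← hL1 _ (hsh q hq), Function.comp, Function.comp, hcsh,
        div_self (hne _ (hcK q hq).1 (hcK q hq).2)])
  have hpos : 0 < (1 + ‖l‖) * (1 + ‖v0‖) := by positivity
  -- all lifts agree
  have hper : ∀ (n : ℕ), ∀ q ∈ K, (q.1 + n * (2 * Real.pi * Complex.I), q.2) ∈ K ∧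
      L (q.1 + n * (2 * Real.pi * Complex.I), q.2) = L q + n * (e * (2 * Real.pi * Complex.I)) := by
    intro n q hq
    induction n with
    | zero => simpa using hq
    | succ n ih =>
      have h1 := hsh _ ih.1
      have h2 := he _ ih.1
      have h3 : sh (q.1 + n * (2 * Real.pi * Complex.I), q.2) =
        (q.1 + (n + 1 : ℕ) * (2 * Real.pi * Complex.I), q.2) := by
        simp only [sh]; congr 1; push_cast; ring
      rw [h3] at h1 h2
      exact ⟨h1, by rw [sub_eq_iff_eq_add.1 h2, ih.2]; push_cast; ring⟩
  have hagree : ∀ y w w', (w, y) ∈ K → (w', y) ∈ K → Complex.exp w = Complex.exp w' →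
      L (w, y) - e * w = L (w', y) - e * w' := by
    intro y w w' h1 h2 h3
    obtain ⟨n, hn⟩ := Complex.exp_eq_exp_iff_exists_int.1 h3
    rcases Int.eq_nat_or_neg n with ⟨m, rfl | rfl⟩
    · have := (hper m (w', y) h2).2
      simp only at this
      push_cast at hn
      rw [hn, this]; ring
    · have := (hper m (w, y) h1).2
      simp only at this
      push_cast at hn
      have h4 : w' = w + m * (2 * Real.pi * Complex.I) := by rw [hn]; ring
      rw [h4, this]; ring
  let lam : E → ℂ := fun z => L (Complex.log (l z), z - l z • v0) - e * Complex.log (l z)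
  set r' := ρ / ((1 + ‖l‖) * (1 + ‖v0‖)) with hr'
  have hsm : ∀ z ∈ ball (0 : E) r', ‖z‖ * (1 + ‖l‖) * (1 + ‖v0‖) < ρ := by
    intro z hz
    rw [mem_ball_zero_iff, hr', lt_div_iff₀ hpos] at hz
    linarith
  refine ⟨e, lam, r', by positivity, fun z0 hz0 => ?_, fun z hz hlz => ?_⟩
  · have hl0 : l z0 ≠ 0 := hz0.2
    let w : E → ℂ := fun z => Complex.log (l z / l z0) + Complex.log (l z0)
    have hw : ∀ z, l z ≠ 0 → Complex.exp (w z) = l z := fun z hz => by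
      simp only [w]
      rw [Complex.exp_add, Complex.exp_log hl0, Complex.exp_log (div_ne_zero hz hl0),
        div_mul_cancel₀ _ hl0]
    have hwc : ContinuousAt w z0 := by
      refine ContinuousAt.add ?_ continuousAt_const
      refine ContinuousAt.clog (by fun_prop) ?_
      rw [div_self hl0]; exact Or.inl (by simp)
    have hcong : ∀ z ∈ ball (0 : E) r' ∩ {x | l x ≠ 0}, lam z = L (w z, z - l z • v0) - e * w z := by
      intro z hz
      refine hagree _ _ _ (hqz z _ (hsm z hz.1) (Complex.exp_log hz.2)) (hqz z _ (hsm z hz.1) (hw z hz.2)) ?_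
      rw [hw z hz.2, Complex.exp_log hz.2]
    refine ContinuousWithinAt.congr ?_ hcong (hcong z0 hz0)
    have hmem : ∀ z ∈ ball (0 : E) r' ∩ {x | l x ≠ 0}, (w z, z - l z • v0) ∈ K := fun z hz =>
      hqz z _ (hsm z hz.1) (hw z hz.2)
    refine ContinuousWithinAt.sub ?_ (hwc.continuousWithinAt.const_mul _ )
    refine ContinuousWithinAt.comp (f := fun z => (w z, z - l z • v0)) (hL _ (hmem z0 hz0)) ?_ hmem
    exact (hwc.prodMk (by fun_prop)).continuousWithinAt
  · have hm := hqz z _ (hsm z hz) (Complex.exp_log hlz)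
    have h1 := hL1 _ hm
    have h2 : c (Complex.log (l z), z - l z • v0) = z := by simp [c, Complex.exp_log hlz]
    rw [Function.comp, h2] at h1
    simp only [lam]
    rw [Complex.exp_sub, ← h1, Complex.exp_int_mul, Complex.exp_log hlz]
    have := zpow_ne_zero e hlz
    field_simp
end haslog

structure Straight {E : Type*} [NormedAddCommGroup E] [NormedSpace ℂ E] (f : E → ℂ) (p : E)
    (S T : E → E) (r s : ℝ) : Prop where
  rpos : 0 < r
  spos : 0 < s
  S0 : S 0 = p
  fS : ∀ z ∈ ball (0 : E) r, f (S z) = fderiv ℂ f p z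
  dS : ∀ z ∈ ball (0 : E) r, DifferentiableAt ℂ S z
  dS0 : HasFDerivAt S (ContinuousLinearMap.id ℂ E) 0
  up : ∀ z ∈ ball (0 : E) r, ∀ w ∈ ball (0 : E) r, ‖S z - S w‖ ≤ 2 * ‖z - w‖
  lo : ∀ z ∈ ball (0 : E) r, ∀ w ∈ ball (0 : E) r, ‖z - w‖ ≤ 2 * ‖S z - S w‖
  T0 : T p = 0
  Tc : Continuous T
  fT : ∀ x, f x = fderiv ℂ f p (T x)
  Tm : ∀ x ∈ ball p s, T x ∈ ball (0 : E) r
  ST : ∀ x ∈ ball p s, S (T x) = x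

lemma straighten {E : Type*} [NormedAddCommGroup E] [NormedSpace ℂ E] [CompleteSpace E] {f : E → ℂ}
    (hf : ContDiff ℂ 2 f) {p : E} (hp : f p = 0) (hd : fderiv ℂ f p ≠ 0) :
    ∃ S T r s, Straight f p S T r s := by
  set l := fderiv ℂ f p with hl
  obtain ⟨v, hv⟩ : ∃ v, l v = 1 := by
    obtain ⟨v, hv⟩ := DFunLike.ne_iff.1 hd
    exact ⟨(l v)⁻¹ • v, by rw [map_smul, smul_eq_mul, inv_mul_cancel₀ hv]⟩
  let T : E → E := fun x => (x - p) + (f x - l (x - p)) • v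
  have hTc : ContDiff ℂ 2 T := by
    unfold T; fun_prop
  have hT' : HasFDerivAt T ((ContinuousLinearEquiv.refl ℂ E : E ≃L[ℂ] E) : E →L[ℂ] E) p := by
    have h1 : HasFDerivAt f l p := (hf.differentiable two_ne_zero p).hasFDerivAt
    have h2 : HasFDerivAt (fun x => x - p) (ContinuousLinearMap.id ℂ E) p :=
      (hasFDerivAt_id p).sub_const p
    have h3 := h2.add ((h1.sub (l.hasFDerivAt.comp p h2)).smul_const v)
    convert h3 using 1
    · ext x; simp [T]
    · ext x; simp
  have hTs := hTc.contDiffAt.hasStrictFDerivAt' hT' two_ne_zero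
  let S := hTc.contDiffAt.localInverse hT' two_ne_zero
  have hT0 : T p = 0 := by simp [T, hp]
  have hSc : ContDiffAt ℂ 2 S 0 := by
    have := hTc.contDiffAt.to_localInverse hT' two_ne_zero
    rwa [hT0] at this
  have hS0 : S 0 = p := by
    have := hTs.localInverse_apply_image
    rwa [hT0] at this
  have hSd : HasStrictFDerivAt S (ContinuousLinearMap.id ℂ E) 0 := by
    have := hTs.to_localInverse
    rw [hT0] at this
    exact this
  have e1 : ∀ᶠ z in 𝓝 (0 : E), T (S z) = z := by
    have := hTs.eventually_right_inverse
    rwa [hT0] at this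
  have e2 : ∀ᶠ x in 𝓝 p, S (T x) = x := hTs.eventually_left_inverse
  have e3 : ∀ᶠ z in 𝓝 (0 : E), DifferentiableAt ℂ S z := by
    filter_upwards [hSc.eventually (by simp)] with z hz using hz.differentiableAt two_ne_zero
  obtain ⟨u, hu, hau⟩ := hSd.approximates_deriv_on_nhds (c := 1 / 2) (Or.inr (by norm_num))
  obtain ⟨r, hr, hball⟩ := Metric.eventually_nhds_iff_ball.1 (e1.and (e3.and hu))
  have hlT : ∀ x, f x = l (T x) := fun x => by simp [T, hv]
  have e4 : ∀ᶠ x in 𝓝 p, T x ∈ ball (0 : E) r := by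
    have := hTc.continuous.continuousAt (x := p)
    rw [ContinuousAt, hT0] at this
    exact this (ball_mem_nhds 0 hr)
  obtain ⟨s, hs, hsb⟩ := Metric.eventually_nhds_iff_ball.1 (e2.and e4)
  have hap : ∀ z ∈ ball (0 : E) r, ∀ w ∈ ball (0 : E) r, ‖S z - S w - (z - w)‖ ≤ 1 / 2 * ‖z - w‖ :=
    fun z hz w hw => by simpa using hau z (hball z hz).2.2 w (hball w hw).2.2
  refine ⟨S, T, r, s, hr, hs, hS0, fun z hz => ?_, fun z hz => (hball z hz).2.1, hSd.hasFDerivAt,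
    fun z hz w hw => ?_, fun z hz w hw => ?_, hT0, hTc.continuous, hlT,
    fun x hx => (hsb x hx).2, fun x hx => (hsb x hx).1⟩
  · rw [hlT, (hball z hz).1]
  · have := norm_sub_norm_le (S z - S w) (z - w)
    linarith [hap z hz w hw, norm_nonneg (z - w)]
  · have := norm_sub_norm_le (z - w) (S z - S w)
    rw [norm_sub_rev (z - w) (S z - S w)] at this
    linarith [hap z hz w hw]

section
variable {E : Type*} [NormedAddCommGroup E] [NormedSpace ℂ E] {f : E → ℂ} {p : E} {S T : E → E} {r s : ℝ}

lemma Straight.contS (h : Straight f p S T r s) : ContinuousOn S (ball 0 r) := fun z hz =>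
  (h.dS z hz).continuousAt.continuousWithinAt

/-- a disc transverse to `f = 0` -/
lemma Straight.disc (h : Straight f p S T r s) (hd : fderiv ℂ f p ≠ 0) {ε : ℝ} (hε : 0 < ε) :
    ∃ δ : ℝ, 0 < δ ∧ ∃ γ : ℝ → E, Continuous γ ∧ (∀ θ, γ (θ + 2 * Real.pi) = γ θ) ∧ (∀ θ, γ θ ∈ ball p ε) ∧
      ∀ θ, f (γ θ) = (δ : ℂ) * Complex.exp (θ * Complex.I) := by
  obtain ⟨v, hv⟩ : ∃ v, fderiv ℂ f p v = 1 := by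
    obtain ⟨v, hv⟩ := DFunLike.ne_iff.1 hd
    exact ⟨(fderiv ℂ f p v)⁻¹ • v, by rw [map_smul, smul_eq_mul, inv_mul_cancel₀ hv]⟩
  have h1 : ∀ᶠ z in 𝓝 (0 : E), z ∈ ball 0 r ∧ S z ∈ ball p ε := by
    refine Filter.Eventually.and (ball_mem_nhds 0 h.rpos) ?_
    have := (h.dS0.continuousAt)
    rw [ContinuousAt, h.S0] at this
    exact this (ball_mem_nhds p hε)
  obtain ⟨t, ht, htb⟩ := Metric.eventually_nhds_iff_ball.1 h1
  have hvp : 0 < 1 + ‖v‖ := by positivity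
  set δ := t / (2 * (1 + ‖v‖)) with hδ
  have hδp : 0 < δ := by positivity
  have hm : ∀ θ : ℝ, ((δ : ℂ) * Complex.exp (θ * Complex.I)) • v ∈ ball (0 : E) t := fun θ => by
    rw [mem_ball_zero_iff, norm_smul, norm_mul, Complex.norm_exp_ofReal_mul_I, Complex.norm_real,
      Real.norm_of_nonneg hδp.le, mul_one]
    have : δ * (1 + ‖v‖) = t / 2 := by rw [hδ]; field_simp
    nlinarith
  refine ⟨δ, hδp, fun θ => S (((δ : ℂ) * Complex.exp (θ * Complex.I)) • v), ?_, fun θ => ?_,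
    fun θ => (htb _ (hm θ)).2, fun θ => ?_⟩
  · exact h.contS.comp_continuous (by fun_prop) fun θ => (htb _ (hm θ)).1
  · change S _ = S _
    rw [Complex.ofReal_add, add_mul, Complex.exp_add]
    push_cast
    rw [Complex.exp_two_pi_mul_I, mul_one]
  · rw [h.fS _ (htb _ (hm θ)).1, map_smul, hv, smul_eq_mul, mul_one]

lemma exp_int_theta (e : ℤ) (θ : ℝ) :
    Complex.exp (θ * Complex.I) ^ e = Complex.exp (e * (θ * Complex.I)) := (Complex.exp_int_mul _ _).symm

lemma hasLog_unique (h : Straight f p S T r s) (hd : fderiv ℂ f p ≠ 0) {u : E → ℂ} {e e' : ℤ}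
    (h1 : HasLog f u e p) (h2 : HasLog f u e' p) : e = e' := by
  obtain ⟨L, r1, hr1, hL, hLe⟩ := h1
  obtain ⟨L', r2, hr2, hL', hLe'⟩ := h2
  obtain ⟨δ, hδ, γ, hγ, hper, hm, hfγ⟩ := h.disc hd (lt_min hr1 hr2)
  have hfne : ∀ θ, f (γ θ) ≠ 0 := fun θ => by
    rw [hfγ]; exact mul_ne_zero (by exact_mod_cast hδ.ne') (Complex.exp_ne_zero _)
  have m1 : ∀ θ, γ θ ∈ ball p r1 ∩ {x | f x ≠ 0} := fun θ =>
    ⟨ball_subset_ball (min_le_left _ _) (hm θ), hfne θ⟩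
  have m2 : ∀ θ, γ θ ∈ ball p r2 ∩ {x | f x ≠ 0} := fun θ =>
    ⟨ball_subset_ball (min_le_right _ _) (hm θ), hfne θ⟩
  have hδc : (δ : ℂ) ≠ 0 := by exact_mod_cast hδ.ne'
  have := wind_zero (k := e - e') (c := (δ : ℂ) ^ (e - e')) (μ := fun θ => L' (γ θ) - L (γ θ))
    ((hL'.comp_continuous hγ m2).sub (hL.comp_continuous hγ m1)) (by
      have := hper 0; rw [zero_add] at this; simp only [this]) (zpow_ne_zero _ hδc) (fun θ => by
      have h3 := (hLe _ (m1 θ).1 (hfne θ)).symm.trans (hLe' _ (m2 θ).1 (hfne θ))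
      rw [← exp_int_theta, ← mul_zpow, ← hfγ, zpow_sub₀ (hfne θ), Complex.exp_sub]
      have a1 := zpow_ne_zero e' (hfne θ)
      have a2 := Complex.exp_ne_zero (L (γ θ))
      field_simp
      rw [h3])
  omega

lemma hasLog_exists (h : Straight f p S T r s) (hd : fderiv ℂ f p ≠ 0) {u : E → ℂ} {ε : ℝ} (hε : 0 < ε)
    (hu : ContinuousOn u (ball p ε)) (hne : ∀ x ∈ ball p ε, f x ≠ 0 → u x ≠ 0) :
    ∃ e, HasLog f u e p := by
  have h1 : ∀ᶠ z in 𝓝 (0 : E), z ∈ ball 0 r ∧ S z ∈ ball p ε := by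
    refine Filter.Eventually.and (ball_mem_nhds 0 h.rpos) ?_
    have := (h.dS0.continuousAt)
    rw [ContinuousAt, h.S0] at this
    exact this (ball_mem_nhds p hε)
  obtain ⟨t, ht, htb⟩ := Metric.eventually_nhds_iff_ball.1 h1
  obtain ⟨e, L, t', ht', hL, hLe⟩ := hasLog_linear (fderiv ℂ f p) hd ht (u := u ∘ S)
    (hu.comp (h.contS.mono fun z hz => (htb z hz.1).1) fun z hz => (htb z hz.1).2)
    (fun z hz hlz => hne _ (htb z hz).2 (by rwa [h.fS z (htb z hz).1]))
  have h2 : ∀ᶠ x in 𝓝 p, x ∈ ball p s ∧ T x ∈ ball 0 t' := by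
    refine Filter.Eventually.and (ball_mem_nhds p h.spos) ?_
    have := h.Tc.continuousAt (x := p)
    rw [ContinuousAt, h.T0] at this
    exact this (ball_mem_nhds 0 ht')
  obtain ⟨s', hs', hsb⟩ := Metric.eventually_nhds_iff_ball.1 h2
  refine ⟨e, L ∘ T, s', hs', hL.comp h.Tc.continuousOn fun x hx => ⟨(hsb x hx.1).2, ?_⟩,
    fun x hx hfx => ?_⟩
  · change fderiv ℂ f p (T x) ≠ 0
    rw [← h.fT]; exact hx.2
  · have := hLe (T x) (hsb x hx).2 (by rw [← h.fT]; exact hfx)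
    rw [Function.comp, h.ST x (hsb x hx).1, ← h.fT] at this
    exact this
end

lemma second_order {E : Type*} [NormedAddCommGroup E] [NormedSpace ℂ E] [CompleteSpace E] {F : ℂ → E} {ρ : ℝ}
    (hρ : 0 < ρ) (hF : DifferentiableOn ℂ F (ball 0 ρ)) {ξ : E} (hd : HasDerivAt F ξ 0) :
    ∃ η : ℂ → E, ContinuousAt η 0 ∧ ∀ t, F t = F 0 + t • ξ + t ^ 2 • η t := by
  have hm := ball_mem_nhds (0 : ℂ) hρ
  have h1 : DifferentiableAt ℂ (dslope F 0) 0 :=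
    ((Complex.differentiableOn_dslope hm).2 hF).differentiableAt hm
  refine ⟨dslope (dslope F 0) 0, continuousAt_dslope_same.2 h1, fun t => ?_⟩
  have a1 := sub_smul_dslope F 0 t
  have a2 := sub_smul_dslope (dslope F 0) 0 t
  rw [dslope_same, hd.deriv, sub_zero] at a2
  rw [sub_zero] at a1
  rw [pow_two, mul_smul, a2, smul_sub, a1]
  abel

section
variable {E : Type*} [NormedAddCommGroup E] [InnerProductSpace ℂ E] [FiniteDimensional ℂ E]

lemma rI_cont {X : Type*} [TopologicalSpace X] {u v : X → E} {p : X} (hu : ContinuousAt u p)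
    (hv : ContinuousAt v p) : ContinuousAt (fun t => (inner ℂ (u t) (v t)).re) p :=
  Complex.continuous_re.continuousAt.comp (ContinuousAt.inner (𝕜 := ℂ) hu hv)

def rI (x y : E) : ℝ := (inner ℂ x y).re

lemma rI_expand (c ε : ℝ) (x y a b d : E) :
    c * (‖x + (ε : ℂ) • a + ((ε : ℂ) ^ 2) • b‖ ^ 2 + ‖y + (ε : ℂ) • a + ((ε : ℂ) ^ 2) • d‖ ^ 2) / 2 -
      rI (y + (ε : ℂ) • a + ((ε : ℂ) ^ 2) • d) (x + (ε : ℂ) • a + ((ε : ℂ) ^ 2) • b) =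
    (c * (rI x x + rI y y) / 2 - rI y x) + ε * (c * (rI x a + rI y a) - rI y a - rI x a) +
     ε ^ 2 * ((c - 1) * rI a a + c * (rI x b + rI y d) - rI y b - rI x d
        + ε * (c * (rI a b + rI a d) - rI a b - rI a d)
        + ε ^ 2 * (c * (rI b b + rI d d) / 2 - rI d b)) := by
  have hs : ∀ x y : E, (inner ℂ x y).re = (inner ℂ y x).re := fun x y => inner_re_symm (𝕜 := ℂ) x y
  have hn : ∀ x : E, ‖x‖ ^ 2 = (inner ℂ x x).re := fun x => (inner_self_eq_norm_sq (𝕜 := ℂ) x).symm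
  have h2 : (ε : ℂ) ^ 2 = ((ε ^ 2 : ℝ) : ℂ) := by push_cast; rfl
  have hl : ∀ (t : ℝ) (x y : E), (inner ℂ ((t : ℂ) • x) y).re = t * (inner ℂ x y).re := fun t x y => by
    rw [inner_smul_left, Complex.conj_ofReal, Complex.re_ofReal_mul]
  have hr : ∀ (t : ℝ) (x y : E), (inner ℂ x ((t : ℂ) • y)).re = t * (inner ℂ x y).re := fun t x y => by
    rw [inner_smul_right, Complex.re_ofReal_mul]
  rw [hn, hn]
  simp only [rI, h2, inner_add_left, inner_add_right, Complex.add_re, hl, hr]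
  rw [hs a x, hs a y, hs b x, hs b a, hs d y, hs d a, hs d x]
  ring

lemma conn_key {c : ℝ} (hc1 : c < 1) {x y ξ : E} (hξ : ξ ≠ 0) (hx : ‖x‖ = 1) (hy : ‖y‖ = 1)
    (hc : inner ℂ y x = (c : ℂ)) {η ζ : ℂ → E} (hη : ContinuousAt η 0) (hζ : ContinuousAt ζ 0)
    (H : ∀ᶠ t in 𝓝 (0 : ℂ), rI (y + t • ξ + t ^ 2 • ζ t) (x + t • ξ + t ^ 2 • η t) ≤
      c * (‖x + t • ξ + t ^ 2 • η t‖ ^ 2 + ‖y + t • ξ + t ^ 2 • ζ t‖ ^ 2) / 2) : False := by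
  let D : ℂ → ℝ → ℝ := fun i ε =>
    (c - 1) * rI (i • ξ) (i • ξ) + c * (rI x (i ^ 2 • η (ε * i)) + rI y (i ^ 2 • ζ (ε * i)))
      - rI y (i ^ 2 • η (ε * i)) - rI x (i ^ 2 • ζ (ε * i))
      + ε * (c * (rI (i • ξ) (i ^ 2 • η (ε * i)) + rI (i • ξ) (i ^ 2 • ζ (ε * i)))
        - rI (i • ξ) (i ^ 2 • η (ε * i)) - rI (i • ξ) (i ^ 2 • ζ (ε * i)))
      + ε ^ 2 * (c * (rI (i ^ 2 • η (ε * i)) (i ^ 2 • η (ε * i)) + rI (i ^ 2 • ζ (ε * i)) (i ^ 2 • ζ (ε * i))) / 2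
        - rI (i ^ 2 • ζ (ε * i)) (i ^ 2 • η (ε * i)))
  have hlim : ∀ i : ℂ, Tendsto (fun ε : ℝ => (ε : ℂ) * i) (𝓝[>] 0) (𝓝 0) := fun i => by
    have : Continuous (fun ε : ℝ => (ε : ℂ) * i) := by fun_prop
    have h := this.tendsto 0
    simp only [Complex.ofReal_zero, zero_mul] at h
    exact h.mono_left nhdsWithin_le_nhds
  have hDc : ∀ i : ℂ, Tendsto (D i) (𝓝[>] 0) (𝓝 (D i 0)) := fun i => by
    have h1 : ContinuousAt (fun ε : ℝ => η (ε * i)) 0 :=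
      ContinuousAt.comp (f := fun ε : ℝ => (ε : ℂ) * i) (g := η) (by simpa using hη) (by fun_prop)
    have h2 : ContinuousAt (fun ε : ℝ => ζ (ε * i)) 0 :=
      ContinuousAt.comp (f := fun ε : ℝ => (ε : ℂ) * i) (g := ζ) (by simpa using hζ) (by fun_prop)
    have : ContinuousAt (D i) 0 := by
      have g1 : ContinuousAt (fun ε : ℝ => i ^ 2 • η (ε * i)) 0 := h1.const_smul _
      have g2 : ContinuousAt (fun ε : ℝ => i ^ 2 • ζ (ε * i)) 0 := h2.const_smul _
      have k : ∀ z : E, ContinuousAt (fun _ : ℝ => z) 0 := fun z => continuousAt_const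
      have a1 := fun z => rI_cont (k z) g1
      have a2 := fun z => rI_cont (k z) g2
      have a3 := rI_cont g1 g1
      have a4 := rI_cont g2 g2
      have a5 := rI_cont g2 g1
      unfold D rI
      fun_prop
    exact this.tendsto.mono_left nhdsWithin_le_nhds
  have hQ : ∀ i : ℂ, ∀ᶠ ε in 𝓝[>] (0 : ℝ),
      0 ≤ ε * (c * (rI x (i • ξ) + rI y (i • ξ)) - rI y (i • ξ) - rI x (i • ξ)) + ε ^ 2 * D i ε := fun i => by
    filter_upwards [(hlim i).eventually H] with ε hε
    have h := rI_expand c ε x y (i • ξ) (i ^ 2 • η (ε * i)) (i ^ 2 • ζ (ε * i))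
    simp only [← mul_smul] at h
    rw [← mul_pow] at h
    have h0 : c * (rI x x + rI y y) / 2 - rI y x = 0 := by
      have hn : ∀ x : E, rI x x = ‖x‖ ^ 2 := fun x => (inner_self_eq_norm_sq (𝕜 := ℂ) x)
      rw [hn, hn, hx, hy, rI, hc, Complex.ofReal_re]; ring
    rw [h0, zero_add] at h
    change _ = _ + ε ^ 2 * D i ε at h
    rw [← h]
    linarith
  have hneg : ∀ (z : E), ∀ i : ℂ, rI z (-i • ξ) = - rI z (i • ξ) := fun z i => by
    rw [neg_smul, rI, inner_neg_right, Complex.neg_re, rI]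
  have hfin : ∀ᶠ ε in 𝓝[>] (0 : ℝ), 0 ≤ D 1 ε + D (-1) ε + D Complex.I ε + D (-Complex.I) ε := by
    filter_upwards [hQ 1, hQ (-1), hQ Complex.I, hQ (-Complex.I), self_mem_nhdsWithin] with ε h1 h2 h3 h4 hε
    rw [hneg, hneg] at h2 h4
    have hε' : 0 < ε ^ 2 := pow_pos hε 2
    have : 0 ≤ ε ^ 2 * (D 1 ε + D (-1) ε + D Complex.I ε + D (-Complex.I) ε) := by linarith
    exact nonneg_of_mul_nonneg_right this hε'
  have h0 := ge_of_tendsto ((((hDc 1).add (hDc (-1))).add (hDc Complex.I)).add (hDc (-Complex.I))) hfin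
  have hr : ∀ z w : E, rI z (-w) = - rI z w := fun z w => by rw [rI, inner_neg_right, Complex.neg_re, rI]
  have hi : ∀ i : ℂ, ‖i‖ = 1 → rI (i • ξ) (i • ξ) = ‖ξ‖ ^ 2 := fun i hi => by
    have := (inner_self_eq_norm_sq (𝕜 := ℂ) (i • ξ))
    rw [norm_smul, hi, one_mul] at this
    exact this
  simp only [D] at h0
  rw [hi 1 (by simp), hi (-1) (by simp), hi Complex.I (by simp), hi (-Complex.I) (by simp)] at h0
  simp only [neg_sq,
    Complex.I_sq, one_pow, one_smul, neg_smul, hr, Complex.ofReal_zero, zero_mul, ne_eq, OfNat.ofNat_ne_zero, not_false_eq_true, zero_pow] at h0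
  have hp : 0 < ‖ξ‖ := norm_pos_iff.2 hξ
  have : 0 < (1 - c) * ‖ξ‖ ^ 2 := mul_pos (by linarith) (by positivity)
  linarith

lemma HomIso.curve {f : E → ℂ} {a : ℕ} (h : HomIso f a) {x ξ : E} (hx0 : x ≠ 0) (hx : f x = 0)
    (hξ : fderiv ℂ f x ξ = 0) : ∃ η : ℂ → E, ContinuousAt η 0 ∧
      Tendsto (fun t : ℂ => x + t • ξ + t ^ 2 • η t) (𝓝 0) (𝓝 x) ∧
      ∀ᶠ t in 𝓝 (0 : ℂ), f (x + t • ξ + t ^ 2 • η t) = 0 := by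
  have : CompleteSpace E := FiniteDimensional.complete ℂ E
  obtain ⟨S, T, r, s, H⟩ := straighten h.diff hx (h.iso x hx0)
  have hρ : 0 < r / (1 + ‖ξ‖) := div_pos H.rpos (by positivity)
  have hm : ∀ t ∈ ball (0 : ℂ) (r / (1 + ‖ξ‖)), t • ξ ∈ ball (0 : E) r := fun t ht => by
    rw [mem_ball_zero_iff, lt_div_iff₀ (by positivity)] at ht
    rw [mem_ball_zero_iff, norm_smul]
    nlinarith [norm_nonneg t]
  have hd : HasDerivAt (fun t : ℂ => S (t • ξ)) ξ 0 := by
    have h1 : HasDerivAt (fun t : ℂ => t • ξ) ((1 : ℂ) • ξ) 0 := (hasDerivAt_id (0 : ℂ)).smul_const ξ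
    have h2 : HasFDerivAt S (ContinuousLinearMap.id ℂ E) ((0 : ℂ) • ξ) := by rw [zero_smul]; exact H.dS0
    have := h2.comp_hasDerivAt (0 : ℂ) h1
    rw [one_smul] at this
    exact this
  obtain ⟨η, hη, he⟩ := second_order hρ (F := fun t : ℂ => S (t • ξ)) (fun t ht =>
    ((H.dS _ (hm t ht)).comp t (by fun_prop)).differentiableWithinAt) hd
  simp only [zero_smul, H.S0] at he
  refine ⟨η, hη, ?_, ?_⟩
  · have h3 := hd.continuousAt.tendsto
    simp only [zero_smul, H.S0] at h3
    exact h3.congr he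
  · filter_upwards [ball_mem_nhds (0 : ℂ) hρ] with t ht
    rw [← he, H.fS _ (hm t ht), map_smul, hξ, smul_zero]

lemma HomIso.cone_preconnected {f : E → ℂ} {a : ℕ} (h : HomIso f a) (hE : 3 ≤ Module.finrank ℂ E) (ha : 1 ≤ a):
    IsPreconnected {x : E | f x = 0 ∧ x ≠ 0} := by
  intro u v hu hv huv ⟨x1, hx1, hx1u⟩ ⟨y1, hy1, hy1v⟩
  by_contra hcon
  set V := {x : E | f x = 0 ∧ x ≠ 0} with hV
  have hcone : ∀ x ∈ V, ∀ c : ℂ, c ≠ 0 → c • x ∈ V := fun x hx c hc =>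
    ⟨by rw [h.hom, hx.1, mul_zero], smul_ne_zero hc hx.2⟩
  have hemp : ∀ x ∈ V, x ∈ u → x ∈ v → False := fun x h1 h2 h3 => hcon ⟨x, h1, h2, h3⟩
  have horb : ∀ x ∈ V, IsPreconnected ((fun c : ℂ => c • x) '' {0}ᶜ) := fun x hx =>
    (isConnected_compl_singleton_of_one_lt_rank (E := ℂ) (by simp) 0).isPreconnected.image _ (by fun_prop)
  have hsub : ∀ x ∈ V, ((fun c : ℂ => c • x) '' {0}ᶜ) ⊆ V := fun x hx => by
    rintro _ ⟨c, hc, rfl⟩; exact hcone x hx c hc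
  have hcu : ∀ x ∈ V, x ∈ u → ∀ c : ℂ, c ≠ 0 → c • x ∈ u := fun x hx hxu c hc => by
    by_contra hcc
    have h1 : c • x ∈ v := (huv (hcone x hx c hc)).resolve_left hcc
    obtain ⟨z, hz, hz1, hz2⟩ := horb x hx u v hu hv ((hsub x hx).trans huv) ⟨x, ⟨1, by simp, by simp⟩, hxu⟩
      ⟨c • x, ⟨c, hc, rfl⟩, h1⟩
    exact hemp z (hsub x hx hz) hz1 hz2
  have hcv : ∀ x ∈ V, x ∈ v → ∀ c : ℂ, c ≠ 0 → c • x ∈ v := fun x hx hxu c hc => by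
    by_contra hcc
    have h1 : c • x ∈ u := (huv (hcone x hx c hc)).resolve_right hcc
    obtain ⟨z, hz, hz1, hz2⟩ := horb x hx u v hu hv ((hsub x hx).trans huv) ⟨c • x, ⟨c, hc, rfl⟩, h1⟩
      ⟨x, ⟨1, by simp, by simp⟩, hxu⟩
    exact hemp z (hsub x hx hz) hz1 hz2
  have : ProperSpace E := FiniteDimensional.proper ℂ E
  have hcl : IsClosed {x : E | f x = 0} := isClosed_eq h.diff.continuous continuous_const
  have hcA : IsCompact (sphere (0 : E) 1 ∩ ({x : E | f x = 0} ∩ vᶜ)) :=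
    (isCompact_sphere _ _).inter_right (hcl.inter hv.isClosed_compl)
  have hcB : IsCompact (sphere (0 : E) 1 ∩ ({x : E | f x = 0} ∩ uᶜ)) :=
    (isCompact_sphere _ _).inter_right (hcl.inter hu.isClosed_compl)
  have nz : ∀ x ∈ V, ((‖x‖⁻¹ : ℝ) : ℂ) ≠ 0 := fun x hx => by
    have := norm_ne_zero_iff.2 hx.2
    exact_mod_cast inv_ne_zero this
  have nn : ∀ x ∈ V, ‖((‖x‖⁻¹ : ℝ) : ℂ) • x‖ = 1 := fun x hx => by
    rw [norm_smul, Complex.norm_real, norm_inv, norm_norm, inv_mul_cancel₀ (norm_ne_zero_iff.2 hx.2)]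
  have mA : ∀ x ∈ V, x ∈ u → ((‖x‖⁻¹ : ℝ) : ℂ) • x ∈ sphere (0 : E) 1 ∩ ({x : E | f x = 0} ∩ vᶜ) := fun x hx hxu =>
    ⟨by rw [mem_sphere_zero_iff_norm, nn x hx], (hcone x hx _ (nz x hx)).1, fun hxv =>
      hemp _ (hcone x hx _ (nz x hx)) (hcu x hx hxu _ (nz x hx)) hxv⟩
  have mB : ∀ x ∈ V, x ∈ v → ((‖x‖⁻¹ : ℝ) : ℂ) • x ∈ sphere (0 : E) 1 ∩ ({x : E | f x = 0} ∩ uᶜ) := fun x hx hxu =>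
    ⟨by rw [mem_sphere_zero_iff_norm, nn x hx], (hcone x hx _ (nz x hx)).1, fun hxv =>
      hemp _ (hcone x hx _ (nz x hx)) hxv (hcv x hx hxu _ (nz x hx))⟩
  obtain ⟨⟨x0, y0⟩, ⟨hx0, hy0⟩, hmax⟩ := (hcA.prod hcB).exists_isMaxOn ⟨(_, _), mA x1 hx1 hx1u, mB y1 hy1 hy1v⟩
    (f := fun q : E × E => ‖inner ℂ q.2 q.1‖) (by fun_prop)
  set c := ‖inner ℂ y0 x0‖ with hcdef
  have hx0n : ‖x0‖ = 1 := by simpa using hx0.1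
  have hy0n : ‖y0‖ = 1 := by simpa using hy0.1
  have hx0V : x0 ∈ V := ⟨hx0.2.1, by rintro rfl; simp at hx0n⟩
  have hy0V : y0 ∈ V := ⟨hy0.2.1, by rintro rfl; simp at hy0n⟩
  have hx0u : x0 ∈ u := (huv hx0V).resolve_right hx0.2.2
  have hy0v : y0 ∈ v := (huv hy0V).resolve_left hy0.2.2
  have hbd : ∀ X ∈ V, X ∈ u → ∀ Y ∈ V, Y ∈ v → rI Y X ≤ c * (‖X‖ ^ 2 + ‖Y‖ ^ 2) / 2 := fun X hX hXu Y hY hYv => by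
    have h1 := hmax (a := (((‖X‖⁻¹ : ℝ) : ℂ) • X, ((‖Y‖⁻¹ : ℝ) : ℂ) • Y)) ⟨mA X hX hXu, mB Y hY hYv⟩
    change ‖inner ℂ (((‖Y‖⁻¹ : ℝ) : ℂ) • Y) (((‖X‖⁻¹ : ℝ) : ℂ) • X)‖ ≤ c at h1
    have pX : 0 < ‖X‖ := norm_pos_iff.2 hX.2
    have pY : 0 < ‖Y‖ := norm_pos_iff.2 hY.2
    rw [inner_smul_left, inner_smul_right, Complex.conj_ofReal, norm_mul, norm_mul, Complex.norm_real,
      Complex.norm_real, norm_inv, norm_inv, norm_norm, norm_norm] at h1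
    have h2 : ‖inner ℂ Y X‖ ≤ c * (‖X‖ * ‖Y‖) := by
      have : ‖inner ℂ Y X‖ = (‖X‖ * ‖Y‖) * (‖Y‖⁻¹ * (‖X‖⁻¹ * ‖inner ℂ Y X‖)) := by field_simp
      rw [this, mul_comm c]
      exact mul_le_mul_of_nonneg_left h1 (by positivity)
    have h3 : rI Y X ≤ ‖inner ℂ Y X‖ := Complex.re_le_norm _
    have h4 : 0 ≤ c := norm_nonneg _
    nlinarith [sq_nonneg (‖X‖ - ‖Y‖)]
  obtain ⟨i, hi, hic⟩ : ∃ i : ℂ, ‖i‖ = 1 ∧ i * inner ℂ y0 x0 = (c : ℂ) := by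
    obtain ⟨i, hi, he⟩ := RCLike.exists_norm_mul_eq_self (inner ℂ y0 x0)
    by_cases hz : inner ℂ y0 x0 = 0
    · exact ⟨1, by simp, by simp [hcdef, hz]⟩
    · have hcz : c ≠ 0 := norm_ne_zero_iff.2 hz
      have hcz' : (c : ℂ) ≠ 0 := by exact_mod_cast hcz
      refine ⟨(c : ℂ) / inner ℂ y0 x0, ?_, div_mul_cancel₀ _ hz⟩
      rw [norm_div, Complex.norm_real, Real.norm_of_nonneg (norm_nonneg _), ← hcdef, div_self hcz]
  have hi0 : i ≠ 0 := by rintro rfl; simp at hi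
  set x := i • x0 with hx
  have hxV : x ∈ V := hcone x0 hx0V i hi0
  have hxu : x ∈ u := hcu x0 hx0V hx0u i hi0
  have hxn : ‖x‖ = 1 := by rw [hx, norm_smul, hi, hx0n, one_mul]
  have hcc : inner ℂ y0 x = (c : ℂ) := by rw [hx, inner_smul_right, hic]
  have hc1 : c < 1 := by
    have : c ≤ 1 := by
      have := norm_inner_le_norm (𝕜 := ℂ) y0 x0
      rwa [hx0n, hy0n, one_mul] at this
    refine lt_of_le_of_ne this fun h1 => ?_
    rw [h1, Complex.ofReal_one] at hcc
    have := (inner_eq_one_iff_of_norm_eq_one hy0n hxn).1 hcc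
    exact hemp y0 hy0V (this ▸ hxu) hy0v
  obtain ⟨ξ, hξ, hξ0⟩ : ∃ ξ : E, (fderiv ℂ f x ξ = 0 ∧ fderiv ℂ f y0 ξ = 0) ∧ ξ ≠ 0 := by
    have := LinearMap.ker_ne_bot_of_finrank_lt
      (f := ((fderiv ℂ f x).toLinearMap.prod (fderiv ℂ f y0).toLinearMap)) (by
        rw [Module.finrank_prod, Module.finrank_self]; omega)
    obtain ⟨ξ, h1, h2⟩ := (Submodule.ne_bot_iff _).1 this
    rw [LinearMap.mem_ker, LinearMap.prod_apply, Function.prod_apply, Prod.mk_eq_zero] at h1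
    exact ⟨ξ, h1, h2⟩
  obtain ⟨η, hη, hηt, hηf⟩ := h.curve hxV.2 hxV.1 hξ.1
  obtain ⟨ζ, hζ, hζt, hζf⟩ := h.curve hy0V.2 hy0V.1 hξ.2
  refine conn_key hc1 hξ0 hxn hy0n hcc hη hζ ?_
  filter_upwards [hηf, hζf, hηt.eventually (hu.mem_nhds hxu), hζt.eventually (hv.mem_nhds hy0v),
    hηt.eventually_ne hxV.2, hζt.eventually_ne hy0V.2] with t h1 h2 h3 h4 h5 h6
  exact hbd _ ⟨h1, h5⟩ h3 _ ⟨h2, h6⟩ h4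
end

section
variable {E : Type*} [NormedAddCommGroup E] [NormedSpace ℂ E] [FiniteDimensional ℂ E]

structure PP (G : E → ℂ) (l : E →L[ℂ] ℂ) (e : ℤ) (φ : E → E) (K r r' : ℝ) : Prop where
  rpos : 0 < r
  rpos' : 0 < r'
  Kpos : 0 < K
  zero : φ 0 = 0
  up : ∀ x ∈ ball (0 : E) r, ∀ y ∈ ball (0 : E) r, ‖φ x - φ y‖ ≤ K * ‖x - y‖
  lo : ∀ x ∈ ball (0 : E) r, ∀ y ∈ ball (0 : E) r, ‖x - y‖ ≤ K * ‖φ x - φ y‖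
  sur : ∀ y ∈ ball (0 : E) r', ∃ x ∈ ball (0 : E) r, φ x = y
  van : ∀ x ∈ ball (0 : E) r, G (φ x) = 0 ↔ l x = 0
  log : HasLog l (G ∘ φ) e 0

lemma PP.translate {G : E → ℂ} {l : E →L[ℂ] ℂ} {e : ℤ} {φ : E → E} {K r r' : ℝ} (h : PP G l e φ K r r') :
    ∃ ε : ℝ, 0 < ε ∧ ∀ q : E, ‖q‖ < ε → G q = 0 → ∃ φ' r₁ r₁', PP (fun y => G (q + y)) l e φ' K r₁ r₁' := by
  obtain ⟨L, R, hR, hL, hLe⟩ := h.log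
  have hK := h.Kpos
  refine ⟨min r' (R / K), lt_min h.rpos' (div_pos hR hK), fun q hq hGq => ?_⟩
  obtain ⟨xq, hxq, hφq⟩ := h.sur q (by rw [mem_ball_zero_iff]; exact hq.trans_le (min_le_left _ _))
  have h0 : (0 : E) ∈ ball (0 : E) r := mem_ball_self h.rpos
  have hlq : l xq = 0 := (h.van xq hxq).1 (by rw [hφq, hGq])
  have hxn : ‖xq‖ < R := by
    have := h.lo xq hxq 0 h0
    rw [h.zero, sub_zero, sub_zero, hφq] at this
    have h2 := hq.trans_le (min_le_right _ _)
    rw [lt_div_iff₀ hK] at h2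
    linarith [mul_comm K ‖q‖]
  rw [mem_ball_zero_iff] at hxq
  have hq' := hq.trans_le (min_le_left _ _)
  have hm : ∀ x ∈ ball (0 : E) (r - ‖xq‖), x + xq ∈ ball (0 : E) r := fun x hx => by
    rw [mem_ball_zero_iff] at *
    linarith [norm_add_le x xq]
  refine ⟨fun x => φ (x + xq) - q, r - ‖xq‖, min (r' - ‖q‖) ((r - ‖xq‖) / K), by linarith,
    lt_min (by linarith) (div_pos (by linarith) hK), hK, by simp [hφq], fun x hx y hy => ?_,
    fun x hx y hy => ?_, fun y hy => ?_, fun x hx => ?_, ?_⟩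
  · have := h.up _ (hm x hx) _ (hm y hy)
    rwa [add_sub_add_right_eq_sub, ← sub_sub_sub_cancel_right _ _ q] at this
  · have := h.lo _ (hm x hx) _ (hm y hy)
    rwa [add_sub_add_right_eq_sub, ← sub_sub_sub_cancel_right (φ _) _ q] at this
  · rw [mem_ball_zero_iff] at hy
    obtain ⟨x, hx, hxe⟩ := h.sur (y + q) (by
      rw [mem_ball_zero_iff]
      linarith [norm_add_le y q, hy.trans_le (min_le_left _ _)])
    refine ⟨x - xq, ?_, by simp [hxe]⟩
    have h1 := h.lo x hx xq (by rwa [mem_ball_zero_iff])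
    rw [hxe, hφq, add_sub_cancel_right] at h1
    have h2 := hy.trans_le (min_le_right _ _)
    rw [lt_div_iff₀ hK] at h2
    rw [mem_ball_zero_iff]
    linarith [mul_comm K ‖y‖]
  · have := h.van _ (hm x hx)
    rw [map_add, hlq, add_zero] at this
    simpa using this
  · have hm' : ∀ x ∈ ball (0 : E) (R - ‖xq‖), x + xq ∈ ball (0 : E) R := fun x hx => by
      rw [mem_ball_zero_iff] at *
      linarith [norm_add_le x xq]
    refine ⟨fun x => L (x + xq), R - ‖xq‖, by linarith, hL.comp (by fun_prop) fun x hx =>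
      ⟨hm' x hx.1, ?_⟩, fun x hx hlx => ?_⟩
    · change l (x + xq) ≠ 0
      rw [map_add, hlq, add_zero]; exact hx.2
    · have := hLe (x + xq) (hm' x hx) (by rwa [map_add, hlq, add_zero])
      rw [map_add, hlq, add_zero] at this
      simpa using this

lemma ulim (U : Ultrafilter ℝ) {u : ℝ → E} {C : Set E} (hC : IsCompact C) (h : ∀ᶠ t : ℝ in (U : Filter ℝ), u t ∈ C) :
    ∃ x ∈ C, Tendsto u U (𝓝 x) := by
  obtain ⟨x, hx, hle⟩ := hC.ultrafilter_le_nhds (U.map u) (by rw [le_principal_iff]; exact h)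
  exact ⟨x, hx, by simpa [Tendsto] using hle⟩

lemma unif_close {F : Filter ℝ} {K : ℝ} (hK : 0 < K) {C : Set E} (hC : IsCompact C) {u : ℝ → E → E} {v : E → E}
    (h1 : ∀ᶠ t in F, ∀ x ∈ C, ∀ y ∈ C, ‖u t x - u t y‖ ≤ K * ‖x - y‖)
    (h2 : ∀ x ∈ C, ∀ y ∈ C, ‖v x - v y‖ ≤ K * ‖x - y‖)
    (h3 : ∀ x ∈ C, Tendsto (fun t => u t x) F (𝓝 (v x))) {η : ℝ} (hη : 0 < η) :
    ∀ᶠ t in F, ∀ x ∈ C, ‖u t x - v x‖ < η := by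
  obtain ⟨s, hs, hsf, hcov⟩ := hC.finite_cover_balls (e := η / (4 * K)) (by positivity)
  have h4 : ∀ᶠ t in F, ∀ x ∈ s, ‖u t x - v x‖ < η / 4 := by
    rw [eventually_all_finite hsf]
    intro x hx
    have := (h3 x (hs hx)).eventually (ball_mem_nhds (v x) (by positivity : 0 < η / 4))
    filter_upwards [this] with t ht
    rwa [← dist_eq_norm]
  filter_upwards [h1, h4] with t ht1 ht4 x hx
  obtain ⟨y, hy, hxy⟩ : ∃ y ∈ s, x ∈ ball y (η / (4 * K)) := by simpa using hcov hx
  rw [mem_ball, dist_eq_norm, lt_div_iff₀ (by positivity)] at hxy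
  have a1 := ht1 x hx y (hs hy)
  have a2 := h2 y (hs hy) x hx
  rw [norm_sub_rev y x] at a2
  have a3 := ht4 y hy
  have : u t x - v x = (u t x - u t y) + (u t y - v y) + (v y - v x) := by abel
  rw [this]
  have := norm_add₃_le (a := u t x - u t y) (b := u t y - v y) (c := v y - v x)
  nlinarith

lemma PP.limit {G : E → ℂ} {l : E →L[ℂ] ℂ} {e : ℤ} {φ : E → E} {K r r' : ℝ} (h : PP G l e φ K r r') :
    ∃ (U : Ultrafilter ℝ) (φ₀ : E → E), (U : Filter ℝ) ≤ 𝓝[>] 0 ∧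
      (∀ x, Tendsto (fun t : ℝ => (t : ℂ)⁻¹ • φ ((t : ℂ) • x)) U (𝓝 (φ₀ x))) ∧
      (∀ x y, ‖φ₀ x - φ₀ y‖ ≤ K * ‖x - y‖) ∧ (∀ x y, ‖x - y‖ ≤ K * ‖φ₀ x - φ₀ y‖) ∧
      (∀ y, ∃ x, φ₀ x = y) ∧
      (∀ R : ℝ, ∀ᶠ t : ℝ in (U : Filter ℝ), ∀ x ∈ closedBall (0 : E) R, (t : ℂ) • x ∈ ball (0 : E) r) ∧
      (∀ R : ℝ, ∀ᶠ t : ℝ in (U : Filter ℝ), ∀ x ∈ closedBall (0 : E) R, ∀ y ∈ closedBall (0 : E) R,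
        ‖(t : ℂ)⁻¹ • φ ((t : ℂ) • x) - (t : ℂ)⁻¹ • φ ((t : ℂ) • y)‖ ≤ K * ‖x - y‖) ∧
      (∀ R : ℝ, ∀ᶠ t : ℝ in (U : Filter ℝ), ∀ y ∈ closedBall (0 : E) R,
        ∃ x ∈ closedBall (0 : E) (K * ‖y‖), (t : ℂ)⁻¹ • φ ((t : ℂ) • x) = y) := by
  have : ProperSpace E := FiniteDimensional.proper ℂ E
  have hK := h.Kpos
  let U : Ultrafilter ℝ := Ultrafilter.of (𝓝[>] 0)
  have hU : (U : Filter ℝ) ≤ 𝓝[>] 0 := Ultrafilter.of_le _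
  have hpos : ∀ᶠ t : ℝ in (U : Filter ℝ), 0 < t := hU self_mem_nhdsWithin
  have hn : ∀ t : ℝ, 0 < t → ∀ x : E, ‖(t : ℂ) • x‖ = t * ‖x‖ := fun t ht x => by
    rw [norm_smul, Complex.norm_real, Real.norm_of_nonneg ht.le]
  have hni : ∀ t : ℝ, 0 < t → ∀ x : E, ‖(t : ℂ)⁻¹ • x‖ = t⁻¹ * ‖x‖ := fun t ht x => by
    rw [norm_smul, norm_inv, Complex.norm_real, Real.norm_of_nonneg ht.le]
  have hsmall : ∀ R ρ : ℝ, 0 < ρ → ∀ᶠ t : ℝ in (U : Filter ℝ), ∀ x ∈ closedBall (0 : E) R, (t : ℂ) • x ∈ ball (0 : E) ρ := by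
    intro R ρ hρ
    have : ∀ᶠ t in 𝓝[>] (0 : ℝ), t < ρ / (1 + |R|) := by
      refine nhdsWithin_le_nhds (Iio_mem_nhds (by positivity))
    filter_upwards [hU this, hpos] with t ht htp x hx
    rw [mem_closedBall_zero_iff] at hx
    rw [mem_ball_zero_iff, hn t htp]
    change t < _ at ht
    rw [lt_div_iff₀ (by positivity)] at ht
    nlinarith [le_abs_self R]
  have hLip : ∀ R : ℝ, ∀ᶠ t : ℝ in (U : Filter ℝ), ∀ x ∈ closedBall (0 : E) R, ∀ y ∈ closedBall (0 : E) R,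
        ‖(t : ℂ)⁻¹ • φ ((t : ℂ) • x) - (t : ℂ)⁻¹ • φ ((t : ℂ) • y)‖ ≤ K * ‖x - y‖ ∧
        ‖x - y‖ ≤ K * ‖(t : ℂ)⁻¹ • φ ((t : ℂ) • x) - (t : ℂ)⁻¹ • φ ((t : ℂ) • y)‖ := by
    intro R
    filter_upwards [hsmall R r h.rpos, hpos] with t ht htp x hx y hy
    have h1 := h.up _ (ht x hx) _ (ht y hy)
    have h2 := h.lo _ (ht x hx) _ (ht y hy)
    rw [← smul_sub, hn t htp] at h1 h2
    rw [← smul_sub, hni t htp]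
    constructor
    · rw [inv_mul_le_iff₀ htp]; linarith
    · rw [mul_left_comm, le_inv_mul_iff₀ htp]; exact h2
  have hz : ∀ t : ℝ, (t : ℂ)⁻¹ • φ ((t : ℂ) • (0 : E)) = 0 := fun t => by rw [smul_zero, h.zero, smul_zero]
  have hex : ∀ x, ∃ y, Tendsto (fun t : ℝ => (t : ℂ)⁻¹ • φ ((t : ℂ) • x)) U (𝓝 y) := fun x => by
    obtain ⟨y, -, hy⟩ := ulim U (isCompact_closedBall (0 : E) (K * ‖x‖)) (by
      filter_upwards [hLip ‖x‖] with t ht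
      have := (ht x (by simp) 0 (by simp)).1
      rw [hz, sub_zero, sub_zero] at this
      rw [mem_closedBall_zero_iff]; exact this)
    exact ⟨y, hy⟩
  choose φ₀ hφ₀ using hex
  have hR : ∀ x y : E, x ∈ closedBall (0 : E) (max ‖x‖ ‖y‖) ∧ y ∈ closedBall (0 : E) (max ‖x‖ ‖y‖) := fun x y => by simp
  have hsur : ∀ R : ℝ, ∀ᶠ t : ℝ in (U : Filter ℝ), ∀ y ∈ closedBall (0 : E) R,
        ∃ x ∈ closedBall (0 : E) (K * ‖y‖), (t : ℂ)⁻¹ • φ ((t : ℂ) • x) = y := by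
    intro R
    filter_upwards [hsmall R r' h.rpos', hpos] with t ht htp y hy
    obtain ⟨x, hx, hxe⟩ := h.sur _ (ht y hy)
    have htc : (t : ℂ) ≠ 0 := by exact_mod_cast htp.ne'
    refine ⟨(t : ℂ)⁻¹ • x, ?_, by rw [smul_inv_smul₀ htc, hxe, inv_smul_smul₀ htc]⟩
    have := h.lo x hx 0 (mem_ball_self h.rpos)
    rw [h.zero, sub_zero, sub_zero, hxe, hn t htp] at this
    rw [mem_closedBall_zero_iff, hni t htp, inv_mul_le_iff₀ htp]
    linarith
  refine ⟨U, φ₀, hU, hφ₀, fun x y => ?_, fun x y => ?_, fun y => ?_, fun R => hsmall R r h.rpos,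
    fun R => (hLip R).mono fun t ht x hx y hy => (ht x hx y hy).1, hsur⟩
  · exact le_of_tendsto ((hφ₀ x).sub (hφ₀ y)).norm ((hLip _).mono fun t ht => (ht x (hR x y).1 y (hR x y).2).1)
  · exact ge_of_tendsto (((hφ₀ x).sub (hφ₀ y)).norm.const_mul K)
      ((hLip _).mono fun t ht => (ht x (hR x y).1 y (hR x y).2).2)
  · have h1 : ∀ᶠ t : ℝ in (U : Filter ℝ), ∃ x ∈ closedBall (0 : E) (K * ‖y‖), (t : ℂ)⁻¹ • φ ((t : ℂ) • x) = y :=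
      (hsur ‖y‖).mono fun t ht => ht y (by simp)
    have h1' : ∀ t : ℝ, ∃ x : E, (∃ x ∈ closedBall (0 : E) (K * ‖y‖), (t : ℂ)⁻¹ • φ ((t : ℂ) • x) = y) →
      x ∈ closedBall (0 : E) (K * ‖y‖) ∧ (t : ℂ)⁻¹ • φ ((t : ℂ) • x) = y := fun t => by
      by_cases hc : ∃ x ∈ closedBall (0 : E) (K * ‖y‖), (t : ℂ)⁻¹ • φ ((t : ℂ) • x) = y
      · obtain ⟨x, hx⟩ := hc; exact ⟨x, fun _ => hx⟩
      · exact ⟨0, fun h => absurd h hc⟩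
    choose X hX using h1'
    have hXe : ∀ᶠ t : ℝ in (U : Filter ℝ), X t ∈ closedBall (0 : E) (K * ‖y‖) ∧ (t : ℂ)⁻¹ • φ ((t : ℂ) • X t) = y :=
      h1.mono fun t ht => hX t ht
    obtain ⟨x, hx, hxt⟩ := ulim U (isCompact_closedBall (0 : E) (K * ‖y‖)) (hXe.mono fun t ht => ht.1)
    refine ⟨x, tendsto_nhds_unique (hφ₀ x) ?_⟩
    rw [tendsto_iff_norm_sub_tendsto_zero]
    have h5 : Tendsto (fun t => K * ‖x - X t‖) U (𝓝 0) := by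
      have := ((tendsto_const_nhds (x := x)).sub hxt).norm.const_mul K
      simpa using this
    refine squeeze_zero' (Eventually.of_forall fun t => norm_nonneg _) ?_ h5
    filter_upwards [hXe, hLip (K * ‖y‖)] with t h6 h7
    have := (h7 x hx _ h6.1).1
    rwa [h6.2] at this
end

section
variable {E : Type*} [NormedAddCommGroup E] [NormedSpace ℂ E] [FiniteDimensional ℂ E]

lemma hurwitz {F : ℂ → ℂ → ℂ} (hF : Continuous (Function.uncurry F)) (hd : ∀ t, Differentiable ℂ (F t))
    {d : ℝ} (hd0 : 0 < d) (h0 : F 0 0 = 0) (hne : ∃ z, F 0 z ≠ 0) {U : Filter ℝ} [U.NeBot] (hU : U ≤ 𝓝[>] 0)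
    (H : ∀ ρ : ℝ, 0 < ρ → ρ < d → ∀ᶠ t : ℝ in U, ∀ z ∈ closedBall (0 : ℂ) ρ, F t z ≠ 0) : False := by
  have h1 : ∀ᶠ z in 𝓝[≠] (0 : ℂ), F 0 z ≠ 0 := by
    refine ((hd 0).analyticAt 0).eventually_eq_zero_or_eventually_ne_zero.resolve_left fun h => ?_
    obtain ⟨z, hz⟩ := hne
    refine hz ?_
    have := AnalyticOnNhd.eq_of_eventuallyEq (f := F 0) (g := fun _ => (0 : ℂ)) (fun z _ => (hd 0).analyticAt z)
      (fun z _ => analyticAt_const) (z₀ := 0) h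
    exact congrFun this z
  rw [eventually_nhdsWithin_iff, Metric.eventually_nhds_iff_ball] at h1
  obtain ⟨ρ0, hρ0, hb⟩ := h1
  have hm : 0 < min ρ0 d := lt_min hρ0 hd0
  set ρ := min ρ0 d / 2 with hρ
  have hρp : 0 < ρ := by positivity
  have hρ1 : ρ < ρ0 := by linarith [min_le_left ρ0 d]
  have hρ2 : ρ < d := by linarith [min_le_right ρ0 d]
  obtain ⟨z0, hz0, hmin⟩ := (isCompact_sphere (0 : ℂ) ρ).exists_isMinOn (NormedSpace.sphere_nonempty.2 hρp.le)
    (f := fun z => ‖F 0 z‖) ((hd 0).continuous.norm.continuousOn)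
  have hc : 0 < ‖F 0 z0‖ := by
    rw [mem_sphere_zero_iff_norm] at hz0
    refine norm_pos_iff.2 (hb z0 (by rw [mem_ball_zero_iff]; linarith) ?_)
    rintro h; rw [mem_singleton_iff] at h; rw [h, norm_zero] at hz0; linarith
  set c := ‖F 0 z0‖ with hcd
  have h2 : ∀ᶠ t in 𝓝 (0 : ℂ), ∀ z ∈ sphere (0 : ℂ) ρ, c / 2 < ‖F t z‖ := by
    refine (isCompact_sphere (0 : ℂ) ρ).eventually_forall_of_forall_eventually fun z hz => ?_
    have : c / 2 < ‖Function.uncurry F (0, z)‖ := by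
      have := hmin hz
      change c ≤ ‖F 0 z‖ at this
      change c / 2 < ‖F 0 z‖
      linarith
    exact hF.norm.continuousAt.eventually (lt_mem_nhds this)
  have hUt : Tendsto (fun t : ℝ => (t : ℂ)) U (𝓝 0) := by
    have := Complex.continuous_ofReal.tendsto 0
    rw [Complex.ofReal_zero] at this
    exact this.mono_left (hU.trans nhdsWithin_le_nhds)
  have h3 : ∀ᶠ t in 𝓝 (0 : ℂ), ‖F t 0‖ < c / 2 := by
    have : Continuous fun t => ‖F t 0‖ := (hF.comp (by fun_prop : Continuous fun t : ℂ => (t, (0 : ℂ)))).norm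
    have h := this.tendsto 0
    rw [h0, norm_zero] at h
    exact h.eventually (gt_mem_nhds (by positivity))
  obtain ⟨t, ht1, ht2, ht3⟩ := ((hUt.eventually h2).and ((hUt.eventually h3).and (H ρ hρp hρ2))).exists
  have hcl := closure_ball (0 : ℂ) hρp.ne'
  have := Complex.norm_le_of_forall_mem_frontier_norm_le (f := fun z => (F t z)⁻¹) (U := ball (0 : ℂ) ρ)
    isBounded_ball (DifferentiableOn.diffContOnCl (by
      rw [hcl]
      exact fun z hz => ((hd t z).inv (ht3 z hz)).differentiableWithinAt)) (C := (c / 2)⁻¹) (fun z hz => by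
      rw [frontier_ball _ hρp.ne'] at hz
      rw [norm_inv]
      exact inv_anti₀ (by positivity) (ht1 z hz).le) (z := 0) (by rw [hcl]; simp [hρp.le])
  rw [norm_inv] at this
  have h5 := (inv_le_inv₀ (norm_pos_iff.2 (ht3 0 (by simp [hρp.le]))) (by positivity)).1 this
  linarith

lemma PP.blow {G : E → ℂ} {l : E →L[ℂ] ℂ} {e : ℤ} {φ : E → E} {K r r' : ℝ} (h : PP G l e φ K r r')
    (hl : l ≠ 0) {Γ : ℂ → E → ℂ} (hΓ : Continuous (Function.uncurry Γ)) (hd : ∀ t, Differentiable ℂ (Γ t))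
    {m : ℕ} (hG : ∀ t x, G (t • x) = t ^ m * Γ t x) (hne : ∃ x, Γ 0 x ≠ 0) :
    ∃ φ₀, PP (Γ 0) l e φ₀ K 1 K⁻¹ := by
  have : ProperSpace E := FiniteDimensional.proper ℂ E
  obtain ⟨U, φ₀, hU, hlim, hup, hlo, hsur, hin, hLip, hsur'⟩ := h.limit
  have hK := h.Kpos
  have hφ0 : φ₀ 0 = 0 := tendsto_nhds_unique (hlim 0) (by
    simp only [smul_zero, h.zero]; exact tendsto_const_nhds)
  have hpos : ∀ᶠ t : ℝ in (U : Filter ℝ), 0 < t := hU self_mem_nhdsWithin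
  have hUt : Tendsto (fun t : ℝ => (t : ℂ)) U (𝓝 0) := by
    have := Complex.continuous_ofReal.tendsto 0
    rw [Complex.ofReal_zero] at this
    exact this.mono_left (hU.trans nhdsWithin_le_nhds)
  have hGt : ∀ t : ℝ, 0 < t → ∀ x, G (φ ((t : ℂ) • x)) = (t : ℂ) ^ m * Γ t ((t : ℂ)⁻¹ • φ ((t : ℂ) • x)) := by
    intro t ht x
    have htc : (t : ℂ) ≠ 0 := by exact_mod_cast ht.ne'
    rw [← hG, smul_inv_smul₀ htc]
  have hφc : Continuous φ₀ := (LipschitzWith.of_dist_le_mul (K := ⟨K, hK.le⟩) fun x y => by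
    rw [dist_eq_norm, dist_eq_norm]; exact hup x y).continuous
  have hvan0 : ∀ t : ℝ, 0 < t → ∀ x, (t : ℂ) • x ∈ ball (0 : E) r →
      (Γ t ((t : ℂ)⁻¹ • φ ((t : ℂ) • x)) = 0 ↔ l x = 0) := by
    intro t ht x hx
    have htc : (t : ℂ) ≠ 0 := by exact_mod_cast ht.ne'
    have := h.van _ hx
    rw [hGt t ht, map_smul, smul_eq_mul, mul_eq_zero, mul_eq_zero] at this
    simpa [htc] using this
  have hvan : ∀ x, Γ 0 (φ₀ x) = 0 ↔ l x = 0 := by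
    intro x
    constructor
    · intro h0
      by_contra hlx
      obtain ⟨y1, hy1⟩ := hne
      set w := y1 - φ₀ x with hw
      set d := ‖l x‖ / ((‖l‖ + 1) * K * (‖w‖ + 1)) with hdd
      have hdp : 0 < d := div_pos (norm_pos_iff.2 hlx) (by positivity)
      refine hurwitz (F := fun t z => Γ t (φ₀ x + z • w)) (hΓ.comp (by fun_prop :
        Continuous fun q : ℂ × ℂ => (q.1, φ₀ x + q.2 • w))) (fun t => (hd t).comp (by fun_prop)) hdp
        (by simpa using h0) ⟨1, by simpa [hw] using hy1⟩ hU (fun ρ hρ hρd => ?_)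
      by_contra hcon
      rw [Filter.not_eventually, Ultrafilter.frequently_iff_eventually] at hcon
      set R := ‖φ₀ x‖ + ρ * ‖w‖ with hR
      have h1 : ∀ᶠ t : ℝ in (U : Filter ℝ), ∃ q : E × ℂ, q ∈ closedBall (0 : E) (K * R) ×ˢ closedBall (0 : ℂ) ρ ∧
          l q.1 = 0 ∧ (t : ℂ)⁻¹ • φ ((t : ℂ) • q.1) = φ₀ x + q.2 • w := by
        filter_upwards [hcon, hpos, hin (K * R), hsur' R] with t h1 h2 h3 h4
        push Not at h1
        obtain ⟨z, hz, hz0⟩ := h1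
        have hz' := hz
        rw [mem_closedBall_zero_iff] at hz'
        have hyR : ‖φ₀ x + z • w‖ ≤ R := by
          refine (norm_add_le _ _).trans ?_
          rw [norm_smul, hR]
          gcongr
        obtain ⟨x', hx', hxe⟩ := h4 (φ₀ x + z • w) (by rw [mem_closedBall_zero_iff]; exact hyR)
        have hx'' : x' ∈ closedBall (0 : E) (K * R) := closedBall_subset_closedBall (by gcongr) hx'
        exact ⟨(x', z), ⟨hx'', hz⟩, (hvan0 t h2 x' (h3 x' hx'')).1 (by rw [hxe, hz0]), hxe⟩
      obtain ⟨Q, hQ⟩ : ∃ Q : ℝ → E × ℂ, ∀ᶠ t : ℝ in (U : Filter ℝ),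
          Q t ∈ closedBall (0 : E) (K * R) ×ˢ closedBall (0 : ℂ) ρ ∧
          l (Q t).1 = 0 ∧ (t : ℂ)⁻¹ • φ ((t : ℂ) • (Q t).1) = φ₀ x + (Q t).2 • w := h1.choice
      obtain ⟨x', hx', hxt⟩ := ulim U (isCompact_closedBall (0 : E) (K * R)) (hQ.mono fun t ht => ht.1.1)
      obtain ⟨z, hz, hzt⟩ := ulim U (isCompact_closedBall (0 : ℂ) ρ) (hQ.mono fun t ht => ht.1.2)
      have hlx' : l x' = 0 := tendsto_nhds_unique ((l.continuous.tendsto x').comp hxt)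
        (tendsto_const_nhds.congr' (hQ.mono fun t ht => ht.2.1.symm))
      have h5 : Tendsto (fun t : ℝ => (t : ℂ)⁻¹ • φ ((t : ℂ) • x') - (φ₀ x + (Q t).2 • w)) U (𝓝 0) := by
        rw [tendsto_zero_iff_norm_tendsto_zero]
        have h5 : Tendsto (fun t => K * ‖x' - (Q t).1‖) U (𝓝 0) := by
          have := ((tendsto_const_nhds (x := x')).sub hxt).norm.const_mul K
          simpa using this
        refine squeeze_zero' (Eventually.of_forall fun t => norm_nonneg _) ?_ h5
        filter_upwards [hQ, hLip (K * R)] with t h6 h7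
        have := h7 x' hx' _ h6.1.1
        rwa [h6.2.2] at this
      have h6 : φ₀ x' - (φ₀ x + z • w) = 0 := tendsto_nhds_unique
        ((hlim x').sub (tendsto_const_nhds.add (hzt.smul_const w))) h5
      have h7 := hlo x' x
      rw [sub_eq_zero.1 h6, add_sub_cancel_left, norm_smul] at h7
      have h8 : ‖l x‖ ≤ ‖l‖ * ‖x' - x‖ := by
        have := l.le_opNorm (x' - x)
        rwa [map_sub, hlx', zero_sub, norm_neg] at this
      rw [mem_closedBall_zero_iff] at hz
      have h9 : ‖z‖ < d := hz.trans_lt hρd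
      rw [hdd, lt_div_iff₀ (by positivity)] at h9
      have h10 : ‖l‖ * ‖x' - x‖ ≤ (‖l‖ + 1) * (K * (‖z‖ * (‖w‖ + 1))) := by
        gcongr
        · linarith
        · refine h7.trans ?_
          gcongr; linarith
      have h11 : (‖l‖ + 1) * (K * (‖z‖ * (‖w‖ + 1))) = ‖z‖ * ((‖l‖ + 1) * K * (‖w‖ + 1)) := by ring
      linarith
    · intro hlx
      have h1 : Tendsto (fun t : ℝ => Γ t ((t : ℂ)⁻¹ • φ ((t : ℂ) • x))) U (𝓝 (Γ 0 (φ₀ x))) :=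
        (hΓ.tendsto (0, φ₀ x)).comp (hUt.prodMk_nhds (hlim x))
      refine tendsto_nhds_unique h1 (tendsto_const_nhds.congr' ?_)
      filter_upwards [hpos, hin ‖x‖] with t ht h2
      exact ((hvan0 t ht x (h2 x (by simp))).2 hlx).symm
  refine ⟨φ₀, one_pos, inv_pos.2 hK, hK, hφ0, fun x _ y _ => hup x y, fun x _ y _ => hlo x y, fun y hy => ?_,
    fun x _ => hvan x, ?_⟩
  · obtain ⟨x, hx⟩ := hsur y
    refine ⟨x, ?_, hx⟩
    have := hlo x 0
    rw [hφ0, sub_zero, sub_zero, hx] at this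
    rw [mem_ball_zero_iff] at hy ⊢
    have h2 := mul_lt_mul_of_pos_left hy hK
    rw [mul_inv_cancel₀ hK.ne'] at h2
    linarith
  · have hΓ0 : Continuous (Γ 0) := (hd 0).continuous
    obtain ⟨e', he'⟩ := hasLog_linear l hl one_pos (u := Γ 0 ∘ φ₀) ((hΓ0.comp hφc).continuousOn)
      (fun x _ hlx h0 => hlx ((hvan x).1 h0))
    suffices e - e' = 0 by rw [show e = e' by omega]; exact he'
    obtain ⟨L', R', hR', hL', hLe'⟩ := he'
    obtain ⟨L, R, hR, hL, hLe⟩ := h.log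
    obtain ⟨v, hv⟩ : ∃ v, l v = 1 := by
      obtain ⟨v, hv⟩ := DFunLike.ne_iff.1 hl
      exact ⟨(l v)⁻¹ • v, by rw [map_smul, smul_eq_mul, inv_mul_cancel₀ hv]⟩
    set δ := R' / (2 * (1 + ‖v‖)) with hδ
    have hδp : 0 < δ := by positivity
    have hδc : (δ : ℂ) ≠ 0 := by exact_mod_cast hδp.ne'
    have hδv : δ * ‖v‖ < R' := by
      have : δ * (1 + ‖v‖) = R' / 2 := by rw [hδ]; field_simp
      nlinarith
    let γ : ℝ → E := fun θ => ((δ : ℂ) * Complex.exp (θ * Complex.I)) • v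
    have hγc : Continuous γ := by unfold γ; fun_prop
    have hγn : ∀ θ, ‖γ θ‖ = δ * ‖v‖ := fun θ => by
      simp only [γ]
      rw [norm_smul, norm_mul, Complex.norm_exp_ofReal_mul_I, Complex.norm_real,
        Real.norm_of_nonneg hδp.le, mul_one]
    have hγl : ∀ θ, l (γ θ) = δ * Complex.exp (θ * Complex.I) := fun θ => by
      simp only [γ]; rw [map_smul, hv, smul_eq_mul, mul_one]
    have hγ2 : γ (2 * Real.pi) = γ 0 := by
      simp only [γ]; push_cast
      rw [Complex.exp_two_pi_mul_I]; simp
    have hγl0 : ∀ θ, l (γ θ) ≠ 0 := fun θ => by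
      rw [hγl]; exact mul_ne_zero hδc (Complex.exp_ne_zero _)
    have hC : IsCompact (closedBall (0 : E) (δ * ‖v‖) ∩ {x | ‖l x‖ = δ}) :=
      (isCompact_closedBall _ _).inter_right (isClosed_eq (by fun_prop) continuous_const)
    set C := closedBall (0 : E) (δ * ‖v‖) ∩ {x | ‖l x‖ = δ} with hCd
    have hγC : ∀ θ, γ θ ∈ C := fun θ => ⟨by rw [mem_closedBall_zero_iff, hγn], by
      change ‖l (γ θ)‖ = δ
      rw [hγl, norm_mul, Complex.norm_exp_ofReal_mul_I, Complex.norm_real,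
        Real.norm_of_nonneg hδp.le, mul_one]⟩
    obtain ⟨x0, hx0, hmin⟩ := hC.exists_isMinOn ⟨_, hγC 0⟩ (f := fun x => ‖Γ 0 (φ₀ x)‖)
      ((hΓ0.comp hφc).norm.continuousOn)
    have hc : 0 < ‖Γ 0 (φ₀ x0)‖ := norm_pos_iff.2 fun h0 => by
      have := (hvan x0).1 h0
      have h2 : ‖l x0‖ = δ := hx0.2
      rw [this, norm_zero] at h2; linarith
    set c := ‖Γ 0 (φ₀ x0)‖ with hcd
    have ht1 : ∀ᶠ q in 𝓝 ((0, 0) : ℂ × E), ∀ y ∈ φ₀ '' C, ‖Γ q.1 (y + q.2) - Γ 0 y‖ < c := by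
      refine (hC.image hφc).eventually_forall_of_forall_eventually fun y hy => ?_
      have hcont : Continuous fun z : (ℂ × E) × E => ‖Γ z.1.1 (z.2 + z.1.2) - Γ 0 z.2‖ :=
        ((hΓ.comp (by fun_prop : Continuous fun z : (ℂ × E) × E => (z.1.1, z.2 + z.1.2))).sub
          (hΓ0.comp continuous_snd)).norm
      have := hcont.tendsto (((0, 0), y) : (ℂ × E) × E)
      simp only [add_zero, sub_self, norm_zero] at this
      exact this.eventually (gt_mem_nhds hc)
    obtain ⟨η, hη, hηb⟩ := Metric.eventually_nhds_iff_ball.1 ht1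
    have hcl := unif_close hK hC (F := (U : Filter ℝ)) (u := fun t x => (t : ℂ)⁻¹ • φ ((t : ℂ) • x)) (v := φ₀)
      ((hLip _).mono fun t ht x hx y hy => ht x hx.1 y hy.1) (fun x _ y _ => hup x y) (fun x _ => hlim x) hη
    have htη : ∀ᶠ t : ℝ in (U : Filter ℝ), ‖(t : ℂ)‖ < η := by
      have := hUt.eventually (ball_mem_nhds 0 hη)
      exact this.mono fun t ht => by rwa [dist_zero_right] at ht
    have htR : ∀ᶠ t : ℝ in (U : Filter ℝ), ‖(t : ℂ)‖ * (δ * ‖v‖) < R := by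
      have := hUt.norm.mul_const (δ * ‖v‖)
      rw [norm_zero, zero_mul] at this
      exact this.eventually (gt_mem_nhds hR)
    obtain ⟨t, h1, h2, h3, htp⟩ := (hcl.and (htη.and (htR.and hpos))).exists
    have htc : (t : ℂ) ≠ 0 := by exact_mod_cast htp.ne'
    have hclose : ∀ θ, ‖Γ t ((t : ℂ)⁻¹ • φ ((t : ℂ) • γ θ)) - Γ 0 (φ₀ (γ θ))‖ < ‖Γ 0 (φ₀ (γ θ))‖ := fun θ => by
      have h4 := hηb (t, (t : ℂ)⁻¹ • φ ((t : ℂ) • γ θ) - φ₀ (γ θ)) (by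
        rw [mem_ball, dist_eq_norm, Prod.norm_def, max_lt_iff]
        simp only [Prod.fst_sub, Prod.snd_sub, sub_zero]
        exact ⟨h2, h1 _ (hγC θ)⟩) _ ⟨γ θ, hγC θ, rfl⟩
      simp only [add_sub_cancel] at h4
      exact h4.trans_le (hmin (hγC θ))
    have hA0 : ∀ θ, Γ 0 (φ₀ (γ θ)) ≠ 0 := fun θ h0 => hγl0 θ ((hvan _).1 h0)
    have m1 : ∀ θ, (t : ℂ) • γ θ ∈ ball (0 : E) R ∩ {x | l x ≠ 0} := fun θ =>
      ⟨by rw [mem_ball_zero_iff, norm_smul, hγn]; exact h3, by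
        change l _ ≠ 0
        rw [map_smul]; exact mul_ne_zero htc (hγl0 θ)⟩
    have m2 : ∀ θ, γ θ ∈ ball (0 : E) R' ∩ {x | l x ≠ 0} := fun θ =>
      ⟨by rw [mem_ball_zero_iff, hγn]; exact hδv, hγl0 θ⟩
    have hB : ∀ θ, Γ t ((t : ℂ)⁻¹ • φ ((t : ℂ) • γ θ)) =
        ((t : ℂ) ^ m)⁻¹ * ((t * l (γ θ)) ^ e * Complex.exp (L ((t : ℂ) • γ θ))) := fun θ => by
      have := hLe _ (m1 θ).1 (m1 θ).2
      rw [Function.comp, hGt t htp, map_smul, smul_eq_mul] at this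
      rw [← this]
      field_simp
    have hLc : Continuous fun θ => L ((t : ℂ) • γ θ) := hL.comp_continuous (by fun_prop) m1
    have hBc : Continuous fun θ => Γ t ((t : ℂ)⁻¹ • φ ((t : ℂ) • γ θ)) := by
      simp only [hB]
      refine continuous_const.mul (Continuous.mul ?_ (Complex.continuous_exp.comp hLc))
      exact Continuous.zpow₀ (by fun_prop) e fun θ => Or.inl (mul_ne_zero htc (hγl0 θ))
    have hsl : ∀ θ, Γ t ((t : ℂ)⁻¹ • φ ((t : ℂ) • γ θ)) / Γ 0 (φ₀ (γ θ)) ∈ Complex.slitPlane := fun θ => by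
      refine Complex.mem_slitPlane_of_norm_lt_one (z := _ - 1) ?_ |> fun h => by simpa using h
      rw [div_sub_one (hA0 θ), norm_div, div_lt_one (norm_pos_iff.2 (hA0 θ))]
      exact hclose θ
    refine wind_zero (k := e - e') (c := ((t : ℂ) ^ m)⁻¹ * (t * δ) ^ e * ((δ : ℂ) ^ e')⁻¹)
      (μ := fun θ => L' (γ θ) + Complex.log (Γ t ((t : ℂ)⁻¹ • φ ((t : ℂ) • γ θ)) / Γ 0 (φ₀ (γ θ)))
        - L ((t : ℂ) • γ θ)) ?_ (by simp only [hγ2]) (by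
          have a1 : (t : ℂ) * δ ≠ 0 := mul_ne_zero htc hδc
          have a2 := zpow_ne_zero e a1
          have a3 := zpow_ne_zero e' hδc
          positivity) fun θ => ?_
    · refine ((hL'.comp_continuous hγc m2).add (Continuous.clog ?_ hsl)).sub hLc
      exact hBc.div ((hΓ0.comp hφc).comp hγc) hA0
    · have hB0 : Γ t ((t : ℂ)⁻¹ • φ ((t : ℂ) • γ θ)) / Γ 0 (φ₀ (γ θ)) ≠ 0 := Complex.slitPlane_ne_zero (hsl θ)
      have hA := hLe' _ (m2 θ).1 (m2 θ).2
      rw [Function.comp] at hA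
      rw [Complex.exp_sub, Complex.exp_add, Complex.exp_log hB0, hB, hA, hγl]
      have a2 := zpow_ne_zero e' hδc
      have a3 := Complex.exp_ne_zero (L ((t : ℂ) • γ θ))
      have a4 := Complex.exp_ne_zero (L' (γ θ))
      have a5 := zpow_ne_zero e' (Complex.exp_ne_zero (θ * Complex.I))
      rw [← exp_int_theta, zpow_sub₀ (Complex.exp_ne_zero _)]
      simp only [mul_zpow]
      field_simp
end

section
variable {n : ℕ}

def ev (p : MvPolynomial (Fin n) ℂ) (x : En n) : ℂ := MvPolynomial.eval (x : Fin n → ℂ) p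

lemma ev_add (p q : MvPolynomial (Fin n) ℂ) : ev (p + q) = fun x => ev p x + ev q x := by
  ext x; simp [ev]

lemma ev_contDiff (p : MvPolynomial (Fin n) ℂ) {k : WithTop ℕ∞} : ContDiff ℂ k (ev p) := by
  induction p using MvPolynomial.induction_on with
  | C a =>
    have : ev (MvPolynomial.C a) = fun x : En n => a := by ext x; simp [ev]
    rw [this]; exact contDiff_const
  | add p q hp hq => rw [ev_add]; exact hp.add hq
  | mul_X p i hp =>
    have : ev (p * MvPolynomial.X i) = fun x : En n => ev p x * x i := by ext x; simp [ev]
    rw [this]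
    refine hp.mul ?_
    exact (EuclideanSpace.proj (𝕜 := ℂ) i).contDiff

lemma ev_diff (p : MvPolynomial (Fin n) ℂ) : Differentiable ℂ (ev p) :=
  (ev_contDiff p (k := 1)).differentiable one_ne_zero

lemma ev_fderiv (p : MvPolynomial (Fin n) ℂ) (x v : En n) :
    fderiv ℂ (ev p) x v = ∑ i, v i * MvPolynomial.eval (x : Fin n → ℂ) (MvPolynomial.pderiv i p) := by
  induction p using MvPolynomial.induction_on with
  | C a =>
    have : ev (MvPolynomial.C a) = fun x : En n => a := by ext x; simp [ev]
    rw [this]; simp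
  | add p q hp hq =>
    rw [ev_add, fderiv_fun_add (ev_diff p x) (ev_diff q x), _root_.add_apply, hp, hq,
      ← Finset.sum_add_distrib]
    exact Finset.sum_congr rfl fun i _ => by rw [map_add, map_add]; ring
  | mul_X p j hp =>
    have : ev (p * MvPolynomial.X j) = fun x : En n => ev p x * EuclideanSpace.proj (𝕜 := ℂ) j x := by
      ext x; simp [ev]
    rw [this, fderiv_fun_mul (ev_diff p x) (ContinuousLinearMap.differentiableAt _)]
    simp only [ContinuousLinearMap.fderiv, _root_.add_apply, _root_.smul_apply, hp,
      MvPolynomial.pderiv_mul, map_add, map_mul, mul_add, Finset.sum_add_distrib, MvPolynomial.pderiv_X,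
      smul_eq_mul]
    have h2 : ∑ i, v i * (MvPolynomial.eval (x : Fin n → ℂ) p *
        MvPolynomial.eval (x : Fin n → ℂ) (Pi.single (M := fun _ => MvPolynomial (Fin n) ℂ) i 1 j)) =
        v j * MvPolynomial.eval (x : Fin n → ℂ) p := by
      rw [Finset.sum_eq_single_of_mem j (Finset.mem_univ j)]
      · simp
      · intro i _ hij
        simp [Pi.single_apply, hij.symm]
    rw [h2]
    simp [ev, Finset.mul_sum]
    rw [add_comm, mul_comm]
    congr 1
    exact Finset.sum_congr rfl fun i _ => by ring

lemma ev_fderiv_eq_zero (p : MvPolynomial (Fin n) ℂ) (x : En n) :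
    fderiv ℂ (ev p) x = 0 ↔ ∀ i, MvPolynomial.eval (x : Fin n → ℂ) (MvPolynomial.pderiv i p) = 0 := by
  constructor
  · intro h i
    have := ev_fderiv p x (EuclideanSpace.single i 1)
    rw [h] at this
    simpa using this.symm
  · intro h
    ext v
    rw [ev_fderiv]
    simp [h]

lemma mem_SingV (p : MvPolynomial (Fin n) ℂ) (x : En n) : x ∈ SingV p ↔ ev p x = 0 ∧ fderiv ℂ (ev p) x = 0 := by
  rw [ev_fderiv_eq_zero]; rfl

lemma ev_hom {p : MvPolynomial (Fin n) ℂ} {m : ℕ} (h : p.IsHomogeneous m) (c : ℂ) (x : En n) :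
    ev p (c • x) = c ^ m * ev p x := by
  simp only [ev, MvPolynomial.eval_eq, Finset.mul_sum]
  refine Finset.sum_congr rfl fun d hd => ?_
  have h1 : ∑ i ∈ d.support, d i = m := by
    have := h (MvPolynomial.mem_support_iff.1 hd)
    rw [Finsupp.weight_apply, Finsupp.sum] at this
    simpa using this
  have : ∏ i ∈ d.support, (c • x) i ^ d i = c ^ m * ∏ i ∈ d.support, x i ^ d i := by
    rw [← h1, ← Finset.prod_pow_eq_pow_sum, ← Finset.prod_mul_distrib]
    exact Finset.prod_congr rfl fun i _ => by simp [mul_pow]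
  rw [this]; ring

lemma ev_ext {p : MvPolynomial (Fin n) ℂ} (h : ∀ x, ev p x = 0) : p = 0 :=
  MvPolynomial.funext fun x => by
    have := h (WithLp.toLp 2 x)
    simpa [ev] using this

lemma ev_trans (p : MvPolynomial (Fin n) ℂ) (q : En n) : ∃ p', ∀ x, ev p' x = ev p (q + x) := by
  refine ⟨MvPolynomial.bind₁ (fun i => MvPolynomial.C (q i) + MvPolynomial.X i) p, fun x => ?_⟩
  simp only [ev]
  induction p using MvPolynomial.induction_on with
  | C a => simp
  | add p q hp hq => rw [map_add, map_add, map_add, hp, hq]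
  | mul_X p j hp => rw [map_mul, map_mul, map_mul, hp]; simp

lemma ev_initial {G : MvPolynomial (Fin n) ℂ} (hG : G ≠ 0) :
    ∃ (m : ℕ) (h : MvPolynomial (Fin n) ℂ) (Γ : ℂ → En n → ℂ), h.IsHomogeneous m ∧ h ≠ 0 ∧ Γ 0 = ev h ∧
      Continuous (Function.uncurry Γ) ∧ (∀ t, Differentiable ℂ (Γ t)) ∧ (∀ t x, ev G (t • x) = t ^ m * Γ t x) ∧
      (ev G 0 = 0 → fderiv ℂ (ev G) 0 = 0 → 2 ≤ m) := by
  classical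
  have hsum := MvPolynomial.sum_homogeneousComponent G
  have hex : ∃ k, MvPolynomial.homogeneousComponent k G ≠ 0 := by
    by_contra hcon
    push Not at hcon
    refine hG ?_
    rw [← hsum]; exact Finset.sum_eq_zero fun i _ => hcon i
  set m := Nat.find hex with hm
  have hm0 : MvPolynomial.homogeneousComponent m G ≠ 0 := Nat.find_spec hex
  have hmin : ∀ k, k < m → MvPolynomial.homogeneousComponent k G = 0 := fun k hk => by
    by_contra h; exact Nat.find_min hex hk h
  set h := MvPolynomial.homogeneousComponent m G with hh
  set N := G.totalDegree + 1
  have hmN : m ∈ Finset.range N := by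
    rw [Finset.mem_range]
    by_contra hc
    exact hm0 (MvPolynomial.homogeneousComponent_eq_zero _ _ (by omega))
  let Γ : ℂ → En n → ℂ := fun t x => ∑ k ∈ Finset.range N, t ^ (k - m) * ev (MvPolynomial.homogeneousComponent k G) x
  have hev : ∀ x, ev G x = ∑ k ∈ Finset.range N, ev (MvPolynomial.homogeneousComponent k G) x := fun x => by
    conv_lhs => rw [← hsum]
    simp [ev, N]
  have hΓ0 : Γ 0 = ev h := by
    ext x
    simp only [Γ]
    rw [Finset.sum_eq_single_of_mem m hmN]
    · simp [hh]
    · intro k _ hkm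
      rcases lt_or_gt_of_ne hkm with h1 | h1
      · rw [hmin k h1]; simp [ev]
      · rw [zero_pow (by omega), zero_mul]
  have hΓd : ∀ t, Differentiable ℂ (Γ t) := fun t => by
    simp only [Γ]
    exact Differentiable.fun_sum fun k _ => (ev_diff _).const_mul _
  have hΓG : ∀ t x, ev G (t • x) = t ^ m * Γ t x := fun t x => by
    rw [hev]
    simp only [Γ, Finset.mul_sum]
    refine Finset.sum_congr rfl fun k _ => ?_
    rcases lt_or_ge k m with h1 | h1
    · rw [hmin k h1]; simp [ev]
    · rw [ev_hom (MvPolynomial.homogeneousComponent_isHomogeneous k G), ← mul_assoc, ← pow_add]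
      congr 2; omega
  have hΓc : Continuous (Function.uncurry Γ) := by
    refine continuous_finsetSum _ fun k _ => ?_
    exact (continuous_fst.pow _).mul ((ev_diff _).continuous.comp continuous_snd)
  refine ⟨m, h, Γ, MvPolynomial.homogeneousComponent_isHomogeneous m G, hm0, hΓ0, hΓc, hΓd, hΓG, fun g0 g1 => ?_⟩
  by_contra hcon
  refine hm0 (ev_ext fun x => ?_)
  rw [← hΓ0]
  have hcases : m = 0 ∨ m = 1 := by omega
  rcases hcases with h0 | h0
  · have := hΓG 0 x
    rw [h0, zero_smul, g0, pow_zero, one_mul] at this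
    exact this.symm
  · have h1 : HasDerivAt (fun t : ℂ => ev G (t • x)) 0 0 := by
      have h2 : HasFDerivAt (ev G) (fderiv ℂ (ev G) 0) ((0 : ℂ) • x) := by
        rw [zero_smul]; exact (ev_diff G 0).hasFDerivAt
      have := h2.comp_hasDerivAt (0 : ℂ) ((hasDerivAt_id (0 : ℂ)).smul_const x)
      rw [g1] at this
      exact this
    have h3 := hasDerivAt_iff_tendsto_slope.1 h1
    have h4 : Tendsto (fun t => Γ t x) (𝓝[≠] 0) (𝓝 (Γ 0 x)) :=
      ((hΓc.comp (by fun_prop : Continuous fun t : ℂ => (t, x))).tendsto 0).mono_left nhdsWithin_le_nhds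
    refine tendsto_nhds_unique h4 (h3.congr' ?_)
    filter_upwards [self_mem_nhdsWithin] with t ht
    have ht' : t ≠ 0 := ht
    rw [slope_def_field, hΓG, h0, zero_smul, g0]
    simp only [sub_zero, pow_one]
    field_simp
end

section
variable {E : Type*} [NormedAddCommGroup E] [NormedSpace ℂ E] [FiniteDimensional ℂ E]
variable {F : Type*} [NormedAddCommGroup F] [InnerProductSpace ℂ F] [FiniteDimensional ℂ F]

lemma PP.inv {G : E → ℂ} {l : E →L[ℂ] ℂ} {e : ℤ} {φ : E → E} {K r r' : ℝ} (h : PP G l e φ K r r') :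
    ∃ ψ : E → E, ContinuousOn ψ (ball 0 r') ∧ ∀ y ∈ ball (0 : E) r', ψ y ∈ ball (0 : E) r ∧ φ (ψ y) = y ∧ ‖ψ y‖ ≤ K * ‖y‖ := by
  classical
  choose! ψ hψ using h.sur
  refine ⟨ψ, ?_, fun y hy => ⟨(hψ y hy).1, (hψ y hy).2, ?_⟩⟩
  · have : LipschitzOnWith (Real.toNNReal K) ψ (ball 0 r') := by
      refine LipschitzOnWith.of_dist_le_mul fun x hx y hy => ?_
      have := h.lo _ (hψ x hx).1 _ (hψ y hy).1
      rw [(hψ x hx).2, (hψ y hy).2] at this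
      rw [dist_eq_norm, dist_eq_norm, Real.coe_toNNReal _ h.Kpos.le]; exact this
    exact this.continuousOn
  · have := h.lo _ (hψ y hy).1 0 (mem_ball_self h.rpos)
    rw [(hψ y hy).2, h.zero, sub_zero, sub_zero] at this; exact this

lemma PP.contOn {G : E → ℂ} {l : E →L[ℂ] ℂ} {e : ℤ} {φ : E → E} {K r r' : ℝ} (h : PP G l e φ K r r') :
    ContinuousOn φ (ball 0 r) := by
  have : LipschitzOnWith (Real.toNNReal K) φ (ball 0 r) := by
    refine LipschitzOnWith.of_dist_le_mul fun x hx y hy => ?_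
    rw [dist_eq_norm, dist_eq_norm, Real.coe_toNNReal _ h.Kpos.le]; exact h.up x hx y hy
  exact this.continuousOn

lemma sigma_bound {g : F → ℂ} {m : ℕ} (h : HomIso g m) (hm : 1 ≤ m) :
    ∃ C : ℝ, 0 < C ∧ ∃ σ : C({x | g x = 1}, {x | g x = 1}), (ContinuousMap.id _).Homotopic σ ∧ ∀ x, ‖(σ x : F)‖ ≤ C := by
  obtain ⟨d, hd, C, σ, hσ, hσ2⟩ := h.sigma_exists hm
  refine ⟨max 1 C, lt_max_of_lt_left one_pos, σ, hσ, fun x => ?_⟩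
  rcases le_total ‖(σ x : F)‖ 1 with h1 | h1
  · exact h1.trans (le_max_left _ _)
  · exact ((le_self_pow₀ h1 (by omega)).trans (hσ2 x).2.2).trans (le_max_right _ _)

theorem PP.terminal {G : E → ℂ} {l : E →L[ℂ] ℂ} {e : ℤ} {φ : E → E} {K r r' : ℝ} (h : PP G l e φ K r r')
    (hl : l ≠ 0) (he : e * e = 1) {g : F → ℂ} {m : ℕ} (hg : HomIso g m) (hm : 2 ≤ m) (pr : E →L[ℂ] F) (ι : F →L[ℂ] E)
    (hpi : ∀ y, pr (ι y) = y) (hG : ∀ x, G x = g (pr x)) (p0 : {x | g x = 1}) : False := by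
  obtain ⟨C, hC, σ, hσ, hσC⟩ := sigma_bound hg (by omega)
  obtain ⟨ψ, hψc, hψ⟩ := h.inv
  obtain ⟨L, R, hR, hL, hLe⟩ := h.log
  obtain ⟨v0, hv0⟩ : ∃ v, l v = 1 := by
    obtain ⟨v, hv⟩ : ∃ v, l v ≠ 0 := by
      by_contra hcon; push Not at hcon; exact hl (by ext v; simpa using hcon v)
    exact ⟨(l v)⁻¹ • v, by simp [hv]⟩
  have hv0n : 0 < ‖v0‖ := norm_pos_iff.2 (by rintro rfl; simp at hv0)
  set ρ := min r R with hρ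
  have hρp : 0 < ρ := lt_min h.rpos hR
  set A := 1 + ‖l‖ * ‖v0‖ with hA
  have hA1 : 0 < A := by positivity
  have hm0 : (m : ℂ) ≠ 0 := by exact_mod_cast (by omega : m ≠ 0)
  set η := ρ / (2 * A) with hη
  have hηp : 0 < η := by positivity
  set B := (‖ι‖ + 1) * C with hB
  have hBp : 0 < B := by positivity
  obtain ⟨ε, hε, hε1, hε2⟩ : ∃ ε : ℝ, 0 < ε ∧ ε * B < r' ∧ K * (ε * B) < η := by
    have h1 : Tendsto (fun ε : ℝ => ε * B) (𝓝[>] 0) (𝓝 0) :=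
      ((by fun_prop : Continuous fun ε : ℝ => ε * B).tendsto' 0 0 (by simp)).mono_left nhdsWithin_le_nhds
    have h2 : Tendsto (fun ε : ℝ => K * (ε * B)) (𝓝[>] 0) (𝓝 0) :=
      ((by fun_prop : Continuous fun ε : ℝ => K * (ε * B)).tendsto' 0 0 (by simp)).mono_left nhdsWithin_le_nhds
    have h0 : ∀ᶠ ε : ℝ in 𝓝[>] (0 : ℝ), 0 < ε := self_mem_nhdsWithin
    exact (h0.and ((h1.eventually (gt_mem_nhds h.rpos')).and (h2.eventually (gt_mem_nhds hηp)))).exists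
  have hεc : (ε : ℂ) ≠ 0 := by exact_mod_cast hε.ne'
  set s : {x | g x = 1} → E := fun x => (ε : ℂ) • ι (σ x : F) with hs
  have hsc : Continuous s := by fun_prop
  have hsn : ∀ x, ‖s x‖ ≤ ε * B := fun x => by
    rw [hs]; simp only [norm_smul, Complex.norm_real, Real.norm_of_nonneg hε.le]
    gcongr
    refine (ι.le_opNorm _).trans ?_
    rw [hB]; gcongr
    · linarith
    · exact hσC x
  have hsb : ∀ x, s x ∈ ball (0 : E) r' := fun x => mem_ball_zero_iff.2 ((hsn x).trans_lt hε1)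
  set z : {x | g x = 1} → E := fun x => ψ (s x) with hz
  have hzc : Continuous z := hψc.comp_continuous hsc hsb
  have hzn : ∀ x, ‖z x‖ < η := fun x => ((hψ _ (hsb x)).2.2.trans (by have := hsn x; have := h.Kpos; gcongr)).trans_lt hε2
  have hzφ : ∀ x, φ (z x) = s x := fun x => (hψ _ (hsb x)).2.1
  have hηρ : η ≤ ρ := by
    rw [hη, div_le_iff₀ (by positivity)]
    have : 1 ≤ A := by rw [hA]; have : 0 ≤ ‖l‖ * ‖v0‖ := by positivity
                       linarith
    nlinarith
  have hball : ∀ y, ‖y‖ < ρ → y ∈ ball (0 : E) r ∧ y ∈ ball (0 : E) R := fun y hy =>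
    ⟨mem_ball_zero_iff.2 (hy.trans_le (min_le_left _ _)), mem_ball_zero_iff.2 (hy.trans_le (min_le_right _ _))⟩
  have hGz : ∀ x, G (φ (z x)) = (ε : ℂ) ^ m := fun x => by
    rw [hzφ, hG, hs]; simp only [map_smul, hpi]; rw [hg.hom, (σ x).2, mul_one]
  have hlz : ∀ x, l (z x) ≠ 0 := fun x h0 => by
    have := (h.van _ (hball _ ((hzn x).trans_le hηρ)).1).2 h0
    rw [hGz] at this; exact pow_ne_zero _ hεc this
  have hLz : Continuous fun x => L (z x) := hL.comp_continuous hzc fun x => ⟨(hball _ ((hzn x).trans_le hηρ)).2, hlz x⟩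
  set w : {x | g x = 1} → ℂ := fun x => e * (m * (Real.log ε : ℂ) - L (z x)) with hw
  have hwc : Continuous w := continuous_const.mul (continuous_const.sub hLz)
  have hec : (e : ℂ) * e = 1 := by exact_mod_cast he
  have hexpε : Complex.exp (Real.log ε : ℂ) = ε := by rw [← Complex.ofReal_exp, Real.exp_log hε]
  have hwz : ∀ x, Complex.exp (w x) = l (z x) := fun x => by
    have h1 := hLe (z x) (hball _ ((hzn x).trans_le hηρ)).2 (hlz x)
    change G (φ (z x)) = _ at h1
    rw [hGz] at h1
    have h2 : Complex.exp (m * (Real.log ε : ℂ) - L (z x)) = l (z x) ^ e := by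
      rw [Complex.exp_sub, Complex.exp_nat_mul, hexpε, h1]
      field_simp [Complex.exp_ne_zero]
    rw [hw]; simp only
    rw [Complex.exp_int_mul, h2, ← zpow_mul, he, zpow_one]
  set c := Real.log (ρ / (2 * ‖v0‖)) with hc
  have hce : Real.exp c = ρ / (2 * ‖v0‖) := Real.exp_log (by positivity)
  have hwre : ∀ x, (w x).re < c := fun x => by
    rw [← Real.exp_lt_exp, ← Complex.norm_exp, hwz, hce, lt_div_iff₀ (by positivity)]
    have h1 := l.le_opNorm (z x)
    have h2 := hzn x
    rw [hη, lt_div_iff₀ (by positivity)] at h2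
    have : 0 ≤ ‖z x‖ := norm_nonneg _
    nlinarith
  set Y : {x | g x = 1} → E := fun x => z x - l (z x) • v0 with hY
  have hYn : ∀ x, ‖Y x‖ < ρ / 2 := fun x => by
    have h2 := hzn x
    rw [hη, lt_div_iff₀ (by positivity)] at h2
    have h3 : ‖Y x‖ ≤ ‖z x‖ * A := by
      rw [hY]; refine (norm_sub_le _ _).trans ?_
      rw [norm_smul, hA]
      have := l.le_opNorm (z x)
      nlinarith
    linarith
  have hYl : ∀ x, l (Y x) = 0 := fun x => by rw [hY]; simp [hv0]
  set W : unitInterval × {x | g x = 1} → ℂ := fun p => ((1 - (p.1 : ℝ) : ℝ) : ℂ) * w p.2 + ((p.1 : ℝ) : ℂ) * ((c - 1 : ℝ) : ℂ) with hW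
  set Z : unitInterval × {x | g x = 1} → E := fun p => Complex.exp (W p) • v0 + ((1 - (p.1 : ℝ) : ℝ) : ℂ) • Y p.2 with hZ
  have hYc : Continuous Y := by fun_prop
  have hWc : Continuous W := by fun_prop
  have hZc : Continuous Z := by fun_prop
  have hWre : ∀ p, (W p).re < c := fun p => by
    have h1 : (W p).re = (1 - (p.1 : ℝ)) * (w p.2).re + (p.1 : ℝ) * (c - 1) := by
      rw [hW]; simp only [Complex.add_re, Complex.re_ofReal_mul, Complex.ofReal_re]
    have h2 := p.1.2.1
    have h3 := p.1.2.2
    have h4 := hwre p.2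
    rw [h1]
    rcases h2.eq_or_lt with h5 | h5
    · rw [← h5]; simpa using h4
    · nlinarith
  have hZn : ∀ p, ‖Z p‖ < ρ := fun p => by
    have h1 : ‖Complex.exp (W p) • v0‖ < ρ / 2 := by
      rw [norm_smul, Complex.norm_exp]
      have := Real.exp_lt_exp.2 (hWre p)
      rw [hce, lt_div_iff₀ (by positivity)] at this
      linarith
    have h2 : ‖((1 - (p.1 : ℝ) : ℝ) : ℂ) • Y p.2‖ ≤ ‖Y p.2‖ := by
      rw [norm_smul, Complex.norm_real, Real.norm_of_nonneg (by linarith [p.1.2.2])]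
      exact mul_le_of_le_one_left (norm_nonneg _) (by linarith [p.1.2.1])
    linarith [norm_add_le (Complex.exp (W p) • v0) (((1 - (p.1 : ℝ) : ℝ) : ℂ) • Y p.2), hYn p.2]
  have hZl : ∀ p, l (Z p) = Complex.exp (W p) := fun p => by
    rw [hZ]; simp [hv0, hYl]
  have hZl0 : ∀ p, l (Z p) ≠ 0 := fun p => by rw [hZl]; exact Complex.exp_ne_zero _
  have hLZ : Continuous fun p => L (Z p) := hL.comp_continuous hZc fun p => ⟨(hball _ (hZn p)).2, hZl0 p⟩
  have hφZ : Continuous fun p => φ (Z p) := h.contOn.comp_continuous hZc fun p => (hball _ (hZn p)).1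
  set P : unitInterval × {x | g x = 1} → F := fun p => Complex.exp (-(e * W p + L (Z p)) / m) • pr (φ (Z p)) with hP
  have hPc : Continuous P := (Complex.continuous_exp.comp (((continuous_const.mul hWc).add hLZ).neg.div_const _)).smul (pr.continuous.comp hφZ)
  have hPg : ∀ p, g (P p) = 1 := fun p => by
    rw [hP]; simp only
    rw [hg.hom, ← hG, ← Complex.exp_nat_mul, mul_div_cancel₀ _ hm0]
    have h1 := hLe (Z p) (hball _ (hZn p)).2 (hZl0 p)
    change G (φ (Z p)) = _ at h1
    rw [h1, hZl, ← Complex.exp_int_mul, ← Complex.exp_add, ← Complex.exp_add, ← Complex.exp_zero]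
    congr 1; ring
  have hP0 : ∀ x, P (0, x) = σ x := fun x => by
    have hw0 : W (0, x) = w x := by rw [hW]; simp
    have hz0 : Z (0, x) = z x := by rw [hZ]; simp [hw0, hwz, hY]
    rw [hP]; simp only
    rw [hw0, hz0, hzφ, hw, hs]
    simp only
    rw [← mul_assoc, hec, map_smul, hpi, smul_smul]
    have : -(1 * (m * (Real.log ε : ℂ) - L (z x)) + L (z x)) / m = -(Real.log ε : ℂ) := by field_simp; ring
    rw [this, Complex.exp_neg, hexpε, inv_mul_cancel₀ hεc, one_smul]
  have hP1 : ∀ x, P (1, x) = P (1, p0) := fun x => by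
    have hw0 : ∀ x, W (1, x) = ((c - 1 : ℝ) : ℂ) := fun x => by rw [hW]; simp
    have hz0 : ∀ x, Z (1, x) = Complex.exp ((c - 1 : ℝ) : ℂ) • v0 := fun x => by rw [hZ]; simp [hw0]
    rw [hP]; simp only [hw0, hz0]
  have H1 : σ.Homotopic (ContinuousMap.const _ ⟨P (1, p0), hPg _⟩) :=
    ⟨{ toFun := fun p => ⟨P p, hPg p⟩
       continuous_toFun := by fun_prop
       map_zero_left := fun x => Subtype.ext (hP0 x)
       map_one_left := fun x => Subtype.ext (hP1 x) }⟩
  obtain ⟨ζ, hζ, hζ1⟩ : ∃ ζ : ℂ, ζ ^ m = 1 ∧ ζ ≠ 1 :=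
    ⟨_, (Complex.isPrimitiveRoot_exp m (by omega)).pow_eq_one, (Complex.isPrimitiveRoot_exp m (by omega)).ne_one (by omega)⟩
  have H2 := (hσ.trans H1).comp (ContinuousMap.Homotopic.refl (rotF hg ζ hζ))
  exact hg.not_null (by omega) hζ hζ1 _ H2.symm
end

section
variable {n : ℕ}

lemma ev_fderiv_smul {p : MvPolynomial (Fin n) ℂ} {m : ℕ} (h : p.IsHomogeneous m) (c : ℂ) (x : En n) :
    c • fderiv ℂ (ev p) (c • x) = c ^ m • fderiv ℂ (ev p) x := by
  have hd : ∀ y, HasFDerivAt (ev p) (fderiv ℂ (ev p) y) y := fun y => (ev_diff p y).hasFDerivAt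
  have h1 : HasFDerivAt (fun y => ev p (c • y)) ((fderiv ℂ (ev p) (c • x)).comp
      (c • ContinuousLinearMap.id ℂ (En n))) x :=
    HasFDerivAt.comp x (hd (c • x)) ((hasFDerivAt_id x).const_smul c)
  have h2 : HasFDerivAt (fun y => ev p (c • y)) (c ^ m • fderiv ℂ (ev p) x) x := by
    have := (hd x).const_smul (c ^ m)
    refine this.congr_of_eventuallyEq (Eventually.of_forall fun y => ?_)
    simp [ev_hom h]
  rw [← h1.unique h2]
  ext v; simp

lemma ev_fderiv_scale {p : MvPolynomial (Fin n) ℂ} {m : ℕ} (h : p.IsHomogeneous m) {c : ℂ} (hc : c ≠ 0) {x : En n}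
    (hx : fderiv ℂ (ev p) x = 0) : fderiv ℂ (ev p) (c • x) = 0 := by
  ext v
  have := congrArg (fun A => A v) (ev_fderiv_smul h c x)
  rw [hx] at this
  simpa [hc] using this

lemma ev_euler {p : MvPolynomial (Fin n) ℂ} {m : ℕ} (h : p.IsHomogeneous m) (x : En n) :
    fderiv ℂ (ev p) x x = m * ev p x := by
  have h1 : HasDerivAt (fun t : ℂ => t • x) x 1 := by
    simpa using (hasDerivAt_id (1 : ℂ)).smul_const x
  have h2 : HasDerivAt (fun t : ℂ => ev p (t • x)) (fderiv ℂ (ev p) x x) 1 := by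
    have h0 : HasFDerivAt (ev p) (fderiv ℂ (ev p) x) ((fun t : ℂ => t • x) 1) := by
      simp only [one_smul]; exact (ev_diff p x).hasFDerivAt
    exact h0.comp_hasDerivAt (1 : ℂ) h1
  have h3 : HasDerivAt (fun t : ℂ => ev p (t • x)) (m * ev p x) 1 := by
    have := (hasDerivAt_pow m (1 : ℂ)).mul_const (ev p x)
    simp only [one_pow, mul_one] at this
    exact this.congr_of_eventuallyEq (Eventually.of_forall fun t => ev_hom h t x)
  exact h2.unique h3

def Linv (h : MvPolynomial (Fin n) ℂ) : Submodule ℂ (En n) where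
  carrier := {v | ∀ (x : En n) (c : ℂ), ev h (x + c • v) = ev h x}
  add_mem' := fun {v w} hv hw x c => by
    rw [smul_add, ← add_assoc, hw, hv]
  zero_mem' := fun x c => by simp
  smul_mem' := fun a v hv x c => by rw [smul_smul, hv]

lemma small_scale (q : En n) {ε : ℝ} (hε : 0 < ε) : ∃ t : ℂ, t ≠ 0 ∧ ‖t • q‖ < ε := by
  refine ⟨((ε / (2 * (‖q‖ + 1)) : ℝ) : ℂ), ?_, ?_⟩
  · have : 0 < ε / (2 * (‖q‖ + 1)) := by positivity
    exact_mod_cast this.ne'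
  · rw [norm_smul, Complex.norm_real, Real.norm_of_nonneg (by positivity), div_mul_eq_mul_div, div_lt_iff₀ (by positivity)]
    nlinarith [norm_nonneg q]

lemma ev_exists_ne {h : MvPolynomial (Fin n) ℂ} (h0 : h ≠ 0) : ∃ x, ev h x ≠ 0 := by
  by_contra hcon; push Not at hcon; exact h0 (ev_ext hcon)

lemma A_grow {h h' : MvPolynomial (Fin n) ℂ} {m m' : ℕ} (hh : h.IsHomogeneous m) {Γ : ℂ → En n → ℂ} (q : En n)
    (hΓ0 : Γ 0 = ev h') (hΓ : Continuous (Function.uncurry Γ)) (hG : ∀ t x, ev h (q + t • x) = t ^ m' * Γ t x) :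
    Linv h ≤ Linv h' ∧ q ∈ Linv h' := by
  have hc : ∀ x, Continuous fun t => Γ t x := fun x => hΓ.comp (by fun_prop : Continuous fun t : ℂ => (t, x))
  constructor
  · intro v hv x c
    rw [← hΓ0]
    have : (fun t => Γ t (x + c • v)) = fun t => Γ t x := by
      refine Continuous.ext_on (dense_compl_singleton (0 : ℂ)) (hc _) (hc _) fun t ht => ?_
      have h1 := hG t (x + c • v)
      rw [smul_add, smul_smul, ← add_assoc, hv, hG] at h1
      exact (mul_left_cancel₀ (pow_ne_zero _ ht) h1).symm
    exact congrFun this 0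
  · intro x c
    rw [← hΓ0]
    have h1 : Tendsto (fun t => Γ t (x + c • q)) (𝓝[≠] 0) (𝓝 (Γ 0 (x + c • q))) :=
      ((hc _).tendsto 0).mono_left nhdsWithin_le_nhds
    have h2 : ContinuousAt (fun t : ℂ => (1 + t * c) ^ m * ((1 + t * c) ^ m')⁻¹ * Γ (t / (1 + t * c)) x) 0 := by
      have h3 : ContinuousAt (fun t : ℂ => t / (1 + t * c)) 0 := by
        refine ContinuousAt.div (by fun_prop) (by fun_prop) (by simp)
      refine ContinuousAt.mul (ContinuousAt.mul (by fun_prop) (ContinuousAt.inv₀ (by fun_prop) (by simp))) ?_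
      exact ContinuousAt.comp (f := fun t : ℂ => t / (1 + t * c)) (hc x).continuousAt h3
    have h2' := h2.tendsto.mono_left (nhdsWithin_le_nhds (s := {0}ᶜ))
    simp only [zero_mul, add_zero, one_pow, inv_one, one_mul, zero_div] at h2'
    refine tendsto_nhds_unique (h1.congr' ?_) h2'
    have h4 : ∀ᶠ t : ℂ in 𝓝[≠] 0, 1 + t * c ≠ 0 := by
      refine (ContinuousAt.eventually_ne (by fun_prop) (by simp)).filter_mono nhdsWithin_le_nhds
    filter_upwards [h4, self_mem_nhdsWithin] with t ht ht0
    have h5 := hG t (x + c • q)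
    have h6 : q + t • (x + c • q) = (1 + t * c) • (q + (t / (1 + t * c)) • x) := by
      rw [smul_add, smul_add, smul_smul, smul_smul, mul_div_cancel₀ _ ht, add_smul, one_smul]; abel
    rw [h6, ev_hom hh, hG] at h5
    refine mul_left_cancel₀ (pow_ne_zero m' ht0) ?_
    rw [← h5, div_pow]; field_simp

lemma A_blow {G : MvPolynomial (Fin n) ℂ} (hG : G ≠ 0) (hG0 : ev G 0 = 0) (hG1 : fderiv ℂ (ev G) 0 = 0)
    {l : En n →L[ℂ] ℂ} {e : ℤ} {φ : En n → En n} {K r r' : ℝ} (hl : l ≠ 0) (hP : PP (ev G) l e φ K r r') :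
    ∃ (m : ℕ) (h : MvPolynomial (Fin n) ℂ) (Γ : ℂ → En n → ℂ) (φ₀ : En n → En n), h.IsHomogeneous m ∧ 2 ≤ m ∧ h ≠ 0 ∧
      Γ 0 = ev h ∧ Continuous (Function.uncurry Γ) ∧ (∀ t x, ev G (t • x) = t ^ m * Γ t x) ∧ PP (ev h) l e φ₀ K 1 K⁻¹ := by
  obtain ⟨m, h, Γ, h1, h2, h3, h4, h5, h6, h7⟩ := ev_initial hG
  obtain ⟨φ₀, h8⟩ := hP.blow hl h4 h5 h6 (by rw [h3]; exact ev_exists_ne h2)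
  exact ⟨m, h, Γ, φ₀, h1, h7 hG0 hG1, h2, h3, h4, h6, h3 ▸ h8⟩

lemma A_step {h : MvPolynomial (Fin n) ℂ} {m : ℕ} (hh : h.IsHomogeneous m) (hm : 2 ≤ m) (h0 : h ≠ 0)
    {l : En n →L[ℂ] ℂ} {e : ℤ} {φ : En n → En n} {K r r' : ℝ} (hl : l ≠ 0) (hP : PP (ev h) l e φ K r r')
    {q : En n} (hq : fderiv ℂ (ev h) q = 0) (hqL : q ∉ Linv h) :
    ∃ (h' : MvPolynomial (Fin n) ℂ) (m' : ℕ) (φ₀ : En n → En n), h'.IsHomogeneous m' ∧ 2 ≤ m' ∧ h' ≠ 0 ∧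
      Linv h < Linv h' ∧ PP (ev h') l e φ₀ K 1 K⁻¹ := by
  obtain ⟨ε, hε, htr⟩ := hP.translate
  obtain ⟨t, ht, htq⟩ := small_scale q hε
  have hm0 : (m : ℂ) ≠ 0 := by exact_mod_cast (by omega : m ≠ 0)
  have hq' : fderiv ℂ (ev h) (t • q) = 0 := by
    exact ev_fderiv_scale hh ht hq
  have hev : ev h (t • q) = 0 := by
    have := ev_euler hh (t • q)
    rw [hq', _root_.zero_apply, eq_comm] at this
    exact (mul_eq_zero.1 this).resolve_left hm0
  obtain ⟨φ', r₁, r₁', hP'⟩ := htr _ htq hev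
  obtain ⟨G, hG⟩ := ev_trans h (t • q)
  have hG' : ev G = fun y => ev h (t • q + y) := funext hG
  rw [← hG'] at hP'
  obtain ⟨m', h', Γ, φ₀, h1, h2, h3, h4, h5, h6, h7⟩ := A_blow (G := G) (by
      rintro rfl
      obtain ⟨x, hx⟩ := ev_exists_ne h0
      apply hx
      have := hG (x - t • q)
      rw [add_sub_cancel] at this
      rw [← this]; simp [ev]) (by rw [hG, add_zero, hev]) (by
      rw [hG', fderiv_comp_add_left, add_zero, hq']) hl hP'
  obtain ⟨h8, h9⟩ := A_grow hh (t • q) h4 h5 (fun s x => by rw [← hG]; exact h6 s x)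
  refine ⟨h', m', φ₀, h1, h2, h3, lt_of_le_of_ne h8 fun heq => hqL ?_, h7⟩
  rw [heq]
  have := (Linv h').smul_mem t⁻¹ h9
  rwa [smul_smul, inv_mul_cancel₀ ht, one_smul] at this

lemma A_term {h : MvPolynomial (Fin n) ℂ} {m : ℕ} (hh : h.IsHomogeneous m) (hm : 2 ≤ m) (h0 : h ≠ 0)
    {l : En n →L[ℂ] ℂ} {e : ℤ} {φ : En n → En n} {K r r' : ℝ} (hl : l ≠ 0) (he : e * e = 1) (hP : PP (ev h) l e φ K r r')
    (hq : ∀ q, fderiv ℂ (ev h) q = 0 → q ∈ Linv h) : False := by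
  set pr : En n →L[ℂ] (Linv h)ᗮ := (Linv h)ᗮ.orthogonalProjectionOnto with hpr
  set ι : (Linv h)ᗮ →L[ℂ] En n := (Linv h)ᗮ.subtypeL with hι
  have hpi : ∀ y, pr (ι y) = y := fun y => by simp [hpr, hι]
  have hsub : ∀ x, x - ι (pr x) ∈ Linv h := fun x => by
    have h1 := (Linv h)ᗮ.sub_starProjection_mem_orthogonal x
    rw [Submodule.orthogonal_orthogonal] at h1
    exact h1
  have hG : ∀ x, ev h x = ev h (ι (pr x)) := fun x => by
    have := hsub x (ι (pr x)) 1
    rwa [one_smul, add_sub_cancel] at this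
  have hg : HomIso (fun y => ev h (ι y)) m := by
    refine ⟨(ev_contDiff h).comp ι.contDiff, fun c y => by rw [map_smul, ev_hom hh], fun y hy hd => hy ?_⟩
    have h1 : fderiv ℂ (fun y => ev h (ι y)) y = (fderiv ℂ (ev h) (ι y)).comp ι := by
      have := fderiv_comp y (ev_diff h (ι y)) ι.differentiableAt
      rw [ι.fderiv] at this; exact this
    rw [h1] at hd
    have h2 : ∀ v ∈ Linv h, fderiv ℂ (ev h) (ι y) v = 0 := fun v hv => by
      have h3 : HasDerivAt (fun t : ℂ => ι y + t • v) v 0 := by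
        simpa using ((hasDerivAt_id (0 : ℂ)).smul_const v).const_add (ι y)
      have h4 : HasDerivAt (fun t : ℂ => ev h (ι y + t • v)) (fderiv ℂ (ev h) (ι y) v) 0 := by
        have h0 : HasFDerivAt (ev h) (fderiv ℂ (ev h) (ι y)) ((fun t : ℂ => ι y + t • v) 0) := by
          simp only [zero_smul, add_zero]; exact (ev_diff h _).hasFDerivAt
        exact h0.comp_hasDerivAt (0 : ℂ) h3
      simp only [hv (ι y)] at h4
      exact h4.unique (hasDerivAt_const _ _)
    have h5 : fderiv ℂ (ev h) (ι y) = 0 := by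
      ext v
      have h6 : v = (v - ι (pr v)) + ι (pr v) := by simp
      rw [h6, map_add, h2 _ (hsub v), zero_add]
      exact congrArg (fun A => A (pr v)) hd
    have h7 := hq _ h5
    have h8 := (Linv h).inner_right_of_mem_orthogonal h7 y.2
    exact Subtype.ext (inner_self_eq_zero.1 h8)
  obtain ⟨x, hx⟩ := ev_exists_ne h0
  rw [hG] at hx
  refine hP.terminal hl he hg hm pr ι hpi hG ⟨(rt m (ev h (ι (pr x))))⁻¹ • pr x, ?_⟩
  change ev h (ι _) = 1
  rw [map_smul, ev_hom hh, inv_pow, rt_pow (by omega) hx, inv_mul_cancel₀ hx]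

lemma A_hom (k : ℕ) : ∀ (h : MvPolynomial (Fin n) ℂ) (m : ℕ), h.IsHomogeneous m → 2 ≤ m → h ≠ 0 →
    n ≤ Module.finrank ℂ (Linv h) + k → ∀ {l : En n →L[ℂ] ℂ} {e : ℤ} {φ : En n → En n} {K r r' : ℝ}, l ≠ 0 → e * e = 1 →
    PP (ev h) l e φ K r r' → False := by
  induction k with
  | zero =>
    intro h m hh hm h0 hn l e φ K r r' hl he hP
    refine A_term hh hm h0 hl he hP fun q _ => ?_
    have : Linv h = ⊤ := Submodule.eq_top_of_finrank_eq (le_antisymm (Submodule.finrank_le _) (by simpa using hn))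
    rw [this]; trivial
  | succ k ih =>
    intro h m hh hm h0 hn l e φ K r r' hl he hP
    by_contra
    refine A_term hh hm h0 hl he hP fun q hq => ?_
    by_contra hqL
    obtain ⟨h', m', φ₀, h1, h2, h3, h4, h5⟩ := A_step hh hm h0 hl hP hq hqL
    exact ih h' m' h1 h2 h3 (by have := Submodule.finrank_lt_finrank_of_lt h4; omega) hl he h5

theorem lemma_A {G : MvPolynomial (Fin n) ℂ} (hG : G ≠ 0) (hG0 : ev G 0 = 0) (hG1 : fderiv ℂ (ev G) 0 = 0)
    {l : En n →L[ℂ] ℂ} {e : ℤ} {φ : En n → En n} {K r r' : ℝ} (hl : l ≠ 0) (he : e * e = 1)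
    (hP : PP (ev G) l e φ K r r') : False := by
  obtain ⟨m', h', Γ, φ₀, h1, h2, h3, h4, h5, h6, h7⟩ := A_blow hG hG0 hG1 hl hP
  exact A_hom n h' m' h1 h2 h3 (by omega) hl he h7
end

section
variable {E : Type*} [NormedAddCommGroup E] [InnerProductSpace ℂ E] [FiniteDimensional ℂ E]

structure BH (f g : E → ℂ) (φ ψ : E → E) (K r r' : ℝ) : Prop where
  rpos : 0 < r
  rpos' : 0 < r'
  Kpos : 0 < K
  zero : φ 0 = 0
  up : ∀ x ∈ ball (0 : E) r, ∀ y ∈ ball (0 : E) r, ‖φ x - φ y‖ ≤ K * ‖x - y‖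
  lo : ∀ x ∈ ball (0 : E) r, ∀ y ∈ ball (0 : E) r, ‖x - y‖ ≤ K * ‖φ x - φ y‖
  inv : ∀ y ∈ ball (0 : E) r', ψ y ∈ ball (0 : E) r ∧ φ (ψ y) = y
  inv' : ∀ x ∈ ball (0 : E) r, ψ (φ x) = x
  van : ∀ x ∈ ball (0 : E) r, g (φ x) = 0 ↔ f x = 0

variable {f g : E → ℂ} {φ ψ : E → E} {K r r' : ℝ}

lemma BH.cont (h : BH f g φ ψ K r r') : ContinuousOn φ (ball 0 r) := by
  have : LipschitzOnWith (Real.toNNReal K) φ (ball 0 r) := by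
    refine LipschitzOnWith.of_dist_le_mul fun x hx y hy => ?_
    rw [dist_eq_norm, dist_eq_norm, Real.coe_toNNReal _ h.Kpos.le]; exact h.up x hx y hy
  exact this.continuousOn

lemma BH.contψ (h : BH f g φ ψ K r r') : ContinuousOn ψ (ball 0 r') := by
  have : LipschitzOnWith (Real.toNNReal K) ψ (ball 0 r') := by
    refine LipschitzOnWith.of_dist_le_mul fun x hx y hy => ?_
    rw [dist_eq_norm, dist_eq_norm, Real.coe_toNNReal _ h.Kpos.le]
    have := h.lo _ (h.inv x hx).1 _ (h.inv y hy).1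
    rwa [(h.inv x hx).2, (h.inv y hy).2] at this
  exact this.continuousOn

lemma BH.nψ (h : BH f g φ ψ K r r') {y : E} (hy : y ∈ ball (0 : E) r') : ‖ψ y‖ ≤ K * ‖y‖ := by
  have := h.lo _ (h.inv y hy).1 0 (mem_ball_self h.rpos)
  rwa [(h.inv y hy).2, h.zero, sub_zero, sub_zero] at this

lemma BH.ψne (h : BH f g φ ψ K r r') {y : E} (hy : y ∈ ball (0 : E) r') (h0 : y ≠ 0) : ψ y ≠ 0 := fun hp => by
  have := (h.inv y hy).2
  rw [hp, h.zero] at this; exact h0 this.symm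

lemma BH.vanψ (h : BH f g φ ψ K r r') {y : E} (hy : y ∈ ball (0 : E) r') : f (ψ y) = 0 ↔ g y = 0 := by
  rw [← h.van _ (h.inv y hy).1, (h.inv y hy).2]

lemma BH.pp (h : BH f g φ ψ K r r') {p : E} (hp : p ∈ ball (0 : E) r) (hq : φ p ∈ ball (0 : E) r') {S T : E → E} {r0 s : ℝ}
    (hS : Straight f p S T r0 s) {e : ℤ} (hlog : HasLog f (g ∘ φ) e p) :
    ∃ φ' K' r1 r1', PP (fun y => g (φ p + y)) (fderiv ℂ f p) e φ' K' r1 r1' := by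
  obtain ⟨L, R, hR, hL, hLe⟩ := hlog
  rw [mem_ball_zero_iff] at hp
  set ρ := min r0 (min ((r - ‖p‖) / 2) (R / 2)) with hρ
  have hρp : 0 < ρ := lt_min hS.rpos (lt_min (by linarith) (by linarith))
  have hρ0 : ∀ x ∈ ball (0 : E) ρ, x ∈ ball (0 : E) r0 := fun x hx => ball_subset_ball (min_le_left _ _) hx
  have h00 : (0 : E) ∈ ball (0 : E) r0 := mem_ball_self hS.rpos
  have hSn : ∀ x ∈ ball (0 : E) ρ, ‖S x - p‖ < 2 * ρ := fun x hx => by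
    have h1 := hS.up x (hρ0 x hx) 0 h00
    rw [hS.S0, sub_zero] at h1
    rw [mem_ball_zero_iff] at hx
    linarith
  have hSr : ∀ x ∈ ball (0 : E) ρ, S x ∈ ball (0 : E) r := fun x hx => by
    rw [mem_ball_zero_iff]
    have h1 := hSn x hx
    have h2 : ρ ≤ (r - ‖p‖) / 2 := (min_le_right _ _).trans (min_le_left _ _)
    have h3 := norm_add_le (S x - p) p
    rw [sub_add_cancel] at h3
    linarith
  have hSR : ∀ x ∈ ball (0 : E) ρ, S x ∈ ball p R := fun x hx => by
    rw [mem_ball, dist_eq_norm]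
    have h1 := hSn x hx
    have h2 : ρ ≤ R / 2 := (min_le_right _ _).trans (min_le_right _ _)
    linarith
  have hK := h.Kpos
  have hc : ContinuousAt ψ (φ p) := h.contψ.continuousAt (isOpen_ball.mem_nhds hq)
  have hψp : ψ (φ p) = p := h.inv' p (mem_ball_zero_iff.2 hp)
  have hc2 : Tendsto (fun y => ψ (φ p + y)) (𝓝 0) (𝓝 p) := by
    rw [← hψp]
    have : Tendsto (fun y => φ p + y) (𝓝 0) (𝓝 (φ p)) :=
      (by fun_prop : Continuous fun y => φ p + y).tendsto' _ _ (by simp)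
    rw [hψp]
    have h2 := hc.tendsto.comp this
    rwa [hψp] at h2
  have hev : ∀ᶠ y in 𝓝 (0 : E), φ p + y ∈ ball (0 : E) r' ∧ ψ (φ p + y) ∈ ball p s ∧ T (ψ (φ p + y)) ∈ ball (0 : E) ρ := by
    refine Filter.Eventually.and ?_ (Filter.Eventually.and (hc2 (ball_mem_nhds _ hS.spos)) ?_)
    · have : Tendsto (fun y => φ p + y) (𝓝 0) (𝓝 (φ p)) :=
        (by fun_prop : Continuous fun y => φ p + y).tendsto' _ _ (by simp)
      exact this (isOpen_ball.mem_nhds hq)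
    · have := (hS.Tc.tendsto p).comp hc2
      rw [hS.T0] at this
      exact this (ball_mem_nhds _ hρp)
  obtain ⟨r1, hr1, hr1'⟩ := Metric.eventually_nhds_iff_ball.1 hev
  refine ⟨fun x => φ (S x) - φ p, 2 * K, ρ, r1, hρp, hr1, by positivity, by simp [hS.S0], fun x hx y hy => ?_,
    fun x hx y hy => ?_, fun y hy => ?_, fun x hx => ?_, ?_⟩
  · rw [sub_sub_sub_cancel_right]
    refine (h.up _ (hSr x hx) _ (hSr y hy)).trans ?_
    have := hS.up x (hρ0 x hx) y (hρ0 y hy)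
    nlinarith
  · rw [sub_sub_sub_cancel_right]
    refine (hS.lo x (hρ0 x hx) y (hρ0 y hy)).trans ?_
    have := h.lo _ (hSr x hx) _ (hSr y hy)
    linarith
  · obtain ⟨h1, h2, h3⟩ := hr1' y hy
    exact ⟨_, h3, by rw [hS.ST _ h2, (h.inv _ h1).2]; abel⟩
  · simp only [add_sub_cancel]
    rw [h.van _ (hSr x hx), hS.fS x (hρ0 x hx)]
  · refine ⟨fun x => L (S x), ρ, hρp, ?_, fun x hx hl => ?_⟩
    · refine hL.comp (hS.contS.mono fun x hx => hρ0 x hx.1) fun x hx => ⟨hSR x hx.1, ?_⟩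
      change f (S x) ≠ 0
      rw [hS.fS x (hρ0 x hx.1)]; exact hx.2
    · have h1 := hLe (S x) (hSR x hx) (by rw [hS.fS x (hρ0 x hx)]; exact hl)
      rw [hS.fS x (hρ0 x hx)] at h1
      rw [← h1]; simp

lemma HasLog.near {f u : E → ℂ} {e : ℤ} {p : E} (h : HasLog f u e p) : ∀ᶠ p' in 𝓝 p, HasLog f u e p' := by
  obtain ⟨L, R, hR, hL, hLe⟩ := h
  filter_upwards [ball_mem_nhds p hR] with p' hp'
  rw [mem_ball] at hp'
  have hs : ball p' (R - dist p' p) ⊆ ball p R := ball_subset_ball' (by linarith)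
  exact ⟨L, R - dist p' p, by linarith, hL.mono (inter_subset_inter_left _ hs), fun x hx => hLe x (hs hx)⟩

lemma cone_small {a : ℕ} (hf : HomIso f a) (hE : 3 ≤ Module.finrank ℂ E) (ha : 1 ≤ a) (hr : 0 < r) :
    IsPreconnected {x : E | f x = 0 ∧ x ≠ 0 ∧ ‖x‖ < r} := by
  have h1 := (hf.cone_preconnected hE ha).image (fun x => ((r / (r + ‖x‖) : ℝ) : ℂ) • x) (by
    refine Continuous.continuousOn ?_
    refine Continuous.smul (Complex.continuous_ofReal.comp (Continuous.div (by fun_prop) (by fun_prop) fun x => ?_)) continuous_id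
    positivity)
  convert h1 using 1
  ext y
  constructor
  · rintro ⟨h2, h3, h4⟩
    have h5 : 0 < r - ‖y‖ := by linarith
    have h6 : r / (r - ‖y‖) ≠ 0 := (div_pos hr h5).ne'
    refine ⟨((r / (r - ‖y‖) : ℝ) : ℂ) • y, ⟨by change f _ = 0; rw [hf.hom, h2, mul_zero], smul_ne_zero (by exact_mod_cast h6) h3⟩, ?_⟩
    simp only
    rw [smul_smul, norm_smul, Complex.norm_real, Real.norm_of_nonneg (div_pos hr h5).le, ← Complex.ofReal_mul]
    have : r / (r + r / (r - ‖y‖) * ‖y‖) * (r / (r - ‖y‖)) = 1 := by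
      have h7 : r + r / (r - ‖y‖) * ‖y‖ = r * r / (r - ‖y‖) := by field_simp; ring
      rw [h7]; field_simp
    rw [this]; simp
  · rintro ⟨x, ⟨h2, h3⟩, rfl⟩
    have h5 : 0 < r + ‖x‖ := by positivity
    have h6 : r / (r + ‖x‖) ≠ 0 := (div_pos hr h5).ne'
    refine ⟨by rw [hf.hom, h2, mul_zero], smul_ne_zero (by exact_mod_cast h6) h3, ?_⟩
    rw [norm_smul, Complex.norm_real, Real.norm_of_nonneg (div_pos hr h5).le, div_mul_eq_mul_div, div_lt_iff₀ h5]
    nlinarith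

lemma e_const {a : ℕ} (hf : HomIso f a) (hE : 3 ≤ Module.finrank ℂ E) (ha : 1 ≤ a) (hr : 0 < r) {u : E → ℂ}
    (hu : ContinuousOn u (ball 0 r)) (hne : ∀ x ∈ ball (0 : E) r, f x ≠ 0 → u x ≠ 0) :
    ∃ e : ℤ, ∀ p, f p = 0 → p ≠ 0 → ‖p‖ < r → HasLog f u e p := by
  classical
  have : CompleteSpace E := FiniteDimensional.complete ℂ E
  set A := {x : E | f x = 0 ∧ x ≠ 0 ∧ ‖x‖ < r} with hA
  have hex : ∀ p ∈ A, ∃ e, HasLog f u e p := fun p hp => by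
    obtain ⟨S, T, r0, s, hS⟩ := straighten hf.diff hp.1 (hf.iso p hp.2.1)
    have hs : ball p (r - ‖p‖) ⊆ ball 0 r := ball_subset_ball' (by rw [dist_zero_right]; linarith)
    exact hasLog_exists hS (hf.iso p hp.2.1) (by linarith [hp.2.2] : 0 < r - ‖p‖) (hu.mono hs) fun x hx => hne x (hs hx)
  choose! e he using hex
  have huniq : ∀ p ∈ A, ∀ e', HasLog f u e' p → e p = e' := fun p hp e' h' => by
    obtain ⟨S, T, r0, s, hS⟩ := straighten hf.diff hp.1 (hf.iso p hp.2.1)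
    exact hasLog_unique hS (hf.iso p hp.2.1) (he p hp) h'
  have hcont : ContinuousOn e A := fun p hp => by
    refine (continuousWithinAt_const (b := e p)).congr_of_eventuallyEq ?_ rfl
    filter_upwards [nhdsWithin_le_nhds (he p hp).near, self_mem_nhdsWithin] with x hx hxA
    exact huniq x hxA _ hx
  rcases A.eq_empty_or_nonempty with h0 | ⟨p0, hp0⟩
  · refine ⟨0, fun p h1 h2 h3 => ?_⟩
    have : p ∈ A := ⟨h1, h2, h3⟩
    rw [h0] at this; exact this.elim
  · refine ⟨e p0, fun p h1 h2 h3 => ?_⟩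
    rw [(cone_small hf hE ha hr).constant hcont hp0 (show p ∈ A from ⟨h1, h2, h3⟩)]
    exact he p ⟨h1, h2, h3⟩

lemma BH.e_unit (h : BH f g φ ψ K r r') (hf : Continuous f) (hg : ContDiff ℂ 2 g) {y : E} (hy : y ∈ ball (0 : E) r') (hgy : g y = 0)
    (hdy : fderiv ℂ g y ≠ 0) {e : ℤ} (he : HasLog f (g ∘ φ) e (ψ y)) : e * e = 1 := by
  have : CompleteSpace E := FiniteDimensional.complete ℂ E
  obtain ⟨L, R, hR, hL, hLe⟩ := he
  obtain ⟨S, T, r0, s, hS⟩ := straighten hg hgy hdy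
  have hc : ContinuousAt ψ y := h.contψ.continuousAt (isOpen_ball.mem_nhds hy)
  obtain ⟨ε, hε, hε'⟩ := Metric.eventually_nhds_iff_ball.1
    ((show ∀ᶠ x in 𝓝 y, x ∈ ball (0 : E) r' from isOpen_ball.mem_nhds hy).and
      (show ∀ᶠ x in 𝓝 y, ψ x ∈ ball (ψ y) R from hc (ball_mem_nhds _ hR)))
  obtain ⟨δ, hδ, γ, hγ, hper, hm, hgγ⟩ := hS.disc hdy hε
  have hgne : ∀ θ, g (γ θ) ≠ 0 := fun θ => by
    rw [hgγ]; exact mul_ne_zero (by exact_mod_cast hδ.ne') (Complex.exp_ne_zero _)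
  have hmr : ∀ θ, γ θ ∈ ball (0 : E) r' := fun θ => (hε' _ (hm θ)).1
  have hfne : ∀ θ, f (ψ (γ θ)) ≠ 0 := fun θ h0 => hgne θ ((h.vanψ (hmr θ)).1 h0)
  have hψγ : Continuous fun θ => ψ (γ θ) := h.contψ.comp_continuous hγ hmr
  obtain ⟨j, μ, hμ, hμp, hμe⟩ := wind_exists (u := fun θ => f (ψ (γ θ))) (hf.comp hψγ) hfne (fun θ => by rw [hper])
  have hLγ : Continuous fun θ => L (ψ (γ θ)) := hL.comp_continuous hψγ fun θ => ⟨(hε' _ (hm θ)).2, hfne θ⟩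
  have h2 : γ (2 * Real.pi) = γ 0 := by have := hper 0; rwa [zero_add] at this
  have h3 : (1 - e * j : ℤ) = 0 := by
    refine wind_zero (c := δ) (μ := fun θ => e * μ θ + L (ψ (γ θ))) ((continuous_const.mul hμ).add hLγ) ?_ (by exact_mod_cast hδ.ne') fun θ => ?_
    · have := hμp 0
      rw [zero_add] at this
      simp only [this, h2]
    · have h4 := hLe (ψ (γ θ)) (hε' _ (hm θ)).2 (hfne θ)
      change g (φ (ψ (γ θ))) = _ at h4
      have h5 := hμe θ
      rw [(h.inv _ (hmr θ)).2, hgγ, h5, ← Complex.exp_int_mul, ← Complex.exp_add] at h4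
      have h6 : ((1 - e * j : ℤ) : ℂ) * (θ * Complex.I) = θ * Complex.I + (-(e * (j * (θ * Complex.I)))) := by push_cast; ring
      rw [h6, Complex.exp_add, ← mul_assoc, h4, ← Complex.exp_add]
      congr 1; ring
  have h7 : e * j = 1 := by omega
  rcases Int.eq_one_or_neg_one_of_mul_eq_one h7 with h8 | h8 <;> simp [h8]
end

section
variable {n : ℕ} {f g : MvPolynomial (Fin n) ℂ}

lemma null_dvd (hg : Irreducible g) {q : MvPolynomial (Fin n) ℂ} (h : ∀ x : En n, ev g x = 0 → ev q x = 0) : g ∣ q := by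
  have h1 : q ∈ MvPolynomial.vanishingIdeal ℂ (MvPolynomial.zeroLocus ℂ (Ideal.span {g})) := by
    rw [MvPolynomial.mem_vanishingIdeal_iff]
    intro x hx
    rw [MvPolynomial.mem_zeroLocus_iff] at hx
    have h2 := hx g (Ideal.subset_span rfl)
    rw [MvPolynomial.aeval_eq_eval] at h2 ⊢
    exact h (WithLp.toLp 2 x) h2
  rw [MvPolynomial.vanishingIdeal_zeroLocus_eq_radical] at h1
  obtain ⟨k, hk⟩ := h1
  rw [Ideal.mem_span_singleton] at hk
  exact hg.prime.dvd_of_dvd_pow hk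

lemma irr_deg_pos (hg : Irreducible g) : 1 ≤ g.totalDegree := by
  by_contra h
  have h0 : g.totalDegree = 0 := by omega
  have h1 := MvPolynomial.totalDegree_eq_zero_iff_eq_C.1 h0
  have h2 : g.coeff 0 ≠ 0 := fun h3 => hg.ne_zero (by rw [h1, h3, map_zero])
  exact hg.not_isUnit (by rw [h1]; exact h2.isUnit.map _)

lemma homIso_of (hirr : Irreducible f) (hf : f.IsHomogeneous f.totalDegree) (hs : SingV f ⊆ {0}) :
    HomIso (ev f) f.totalDegree := by
  refine ⟨ev_contDiff f, ev_hom hf, fun x hx hd => hx (hs ((mem_SingV f x).2 ⟨?_, hd⟩))⟩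
  have h1 := ev_euler hf x
  rw [hd, _root_.zero_apply, eq_comm] at h1
  have := irr_deg_pos hirr
  exact (mul_eq_zero.1 h1).resolve_left (by exact_mod_cast (by omega : f.totalDegree ≠ 0))

lemma exists_fderiv_ne (hirr : Irreducible g) (hg : g.IsHomogeneous g.totalDegree) : ∃ i, MvPolynomial.pderiv i g ≠ 0 := by
  by_contra hcon
  push Not at hcon
  refine hirr.ne_zero (ev_ext fun x => ?_)
  have h1 := ev_euler hg x
  rw [(ev_fderiv_eq_zero g x).2 fun i => by rw [hcon i, map_zero], _root_.zero_apply, eq_comm] at h1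
  have := irr_deg_pos hirr
  exact (mul_eq_zero.1 h1).resolve_left (by exact_mod_cast (by omega : g.totalDegree ≠ 0))

lemma smooth_pt (hirr : Irreducible g) (hg : g.IsHomogeneous g.totalDegree) :
    ∃ y : En n, ev g y = 0 ∧ fderiv ℂ (ev g) y ≠ 0 := by
  by_contra hcon
  push Not at hcon
  obtain ⟨i, hi⟩ := exists_fderiv_ne hirr hg
  obtain ⟨s, hs⟩ := null_dvd hirr (q := MvPolynomial.pderiv i g) fun x hx => (ev_fderiv_eq_zero g x).1 (hcon x hx) i
  have h1 := (hg.pderiv (i := i)).totalDegree hi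
  have hs0 : s ≠ 0 := by rintro rfl; rw [mul_zero] at hs; exact hi hs
  rw [hs, MvPolynomial.totalDegree_mul_of_isDomain hirr.ne_zero hs0] at h1
  have := irr_deg_pos hirr
  omega

lemma deg1_const (hg : g.IsHomogeneous 1) (x : En n) : fderiv ℂ (ev g) x = fderiv ℂ (ev g) 0 := by
  ext v
  rw [ev_fderiv, ev_fderiv]
  refine Finset.sum_congr rfl fun i _ => ?_
  have := ev_hom (hg.pderiv (i := i)) 0 x
  simp [ev] at this
  rw [← this]; simp

lemma deg1_smooth (hirr : Irreducible g) (hg : g.IsHomogeneous g.totalDegree) (h1 : g.totalDegree = 1) (x : En n) :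
    fderiv ℂ (ev g) x ≠ 0 := by
  obtain ⟨y, hy, hy'⟩ := smooth_pt hirr hg
  rw [h1] at hg
  rwa [deg1_const hg, ← deg1_const hg y]

lemma deg_ge2_zero (hg : g.IsHomogeneous g.totalDegree) (h2 : 2 ≤ g.totalDegree) : fderiv ℂ (ev g) 0 = 0 := by
  rw [ev_fderiv_eq_zero]
  intro i
  have := ev_hom (hg.pderiv (i := i)) 0 0
  rw [zero_smul, zero_pow (by omega), zero_mul] at this
  exact this

/-- a nonzero zero of a degree one form -/
lemma deg1_zero (hn : 2 ≤ n) (hg : g.IsHomogeneous 1) : ∃ v : En n, v ≠ 0 ∧ ev g v = 0 := by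
  have h1 : 0 < Module.finrank ℂ (LinearMap.ker (fderiv ℂ (ev g) 0).toLinearMap) := by
    have h2 := LinearMap.finrank_range_add_finrank_ker (fderiv ℂ (ev g) 0).toLinearMap
    have h3 := Submodule.finrank_le (LinearMap.range (fderiv ℂ (ev g) 0).toLinearMap)
    rw [finrank_euclideanSpace_fin] at h2
    rw [Module.finrank_self] at h3
    omega
  have := Module.finrank_pos_iff.1 h1
  obtain ⟨v, hv⟩ := exists_ne (0 : LinearMap.ker (fderiv ℂ (ev g) 0).toLinearMap)
  refine ⟨v, fun h => hv (Subtype.ext h), ?_⟩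
  have h4 := ev_euler hg v
  rw [deg1_const hg] at h4
  have h5 : fderiv ℂ (ev g) 0 v = 0 := v.2
  rw [h5] at h4; simpa using h4.symm

lemma smooth_pt_ne (hn : 2 ≤ n) (hirr : Irreducible g) (hg : g.IsHomogeneous g.totalDegree) :
    ∃ y : En n, y ≠ 0 ∧ ev g y = 0 ∧ fderiv ℂ (ev g) y ≠ 0 := by
  have := irr_deg_pos hirr
  rcases this.eq_or_lt with h1 | h1
  · obtain ⟨v, hv, hv'⟩ := deg1_zero hn (h1 ▸ hg)
    exact ⟨v, hv, hv', deg1_smooth hirr hg h1.symm v⟩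
  · obtain ⟨y, hy, hy'⟩ := smooth_pt hirr hg
    refine ⟨y, ?_, hy, hy'⟩
    rintro rfl
    exact hy' (deg_ge2_zero hg h1)

lemma bh_of (h : BiLipGermHomeo (pV f) (pV g)) : ∃ φ ψ K r r', BH (ev f) (ev g) φ ψ K r r' := by
  obtain ⟨U, U', φ, ψ, K, hU, hU', h0, h0', hφ0, hm, hm', hl, hr, hLφ, hLψ, him⟩ := h
  obtain ⟨r, hr0, hrU⟩ := Metric.isOpen_iff.1 hU 0 h0
  obtain ⟨r', hr0', hrU'⟩ := Metric.isOpen_iff.1 hU' 0 h0'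
  have hψ0 : ψ 0 = 0 := by have := hl h0; rwa [hφ0] at this
  have hK : (0 : ℝ) ≤ K := K.2
  have hs : ball (0 : En n) (min r' (r / (K + 1))) ⊆ ball 0 r' := ball_subset_ball (min_le_left _ _)
  refine ⟨φ, ψ, K + 1, r, min r' (r / (K + 1)), hr0, lt_min hr0' (by positivity), by positivity, hφ0, fun x hx y hy => ?_,
    fun x hx y hy => ?_, fun y hy => ⟨?_, hr (hrU' (hs hy))⟩, fun x hx => hl (hrU hx), fun x hx => ⟨fun h1 => ?_, fun h1 => ?_⟩⟩
  · have := hLφ.dist_le_mul x (hrU hx) y (hrU hy)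
    rw [dist_eq_norm, dist_eq_norm] at this
    linarith [norm_nonneg (x - y)]
  · have := hLψ.dist_le_mul _ (hm (hrU hx)) _ (hm (hrU hy))
    rw [dist_eq_norm, dist_eq_norm, hl (hrU hx), hl (hrU hy)] at this
    linarith [norm_nonneg (φ x - φ y)]
  · have := hLψ.dist_le_mul y (hrU' (hs hy)) 0 h0'
    rw [hψ0, dist_zero_right, dist_zero_right] at this
    rw [mem_ball_zero_iff] at hy ⊢
    have h2 := hy.trans_le (min_le_right _ _)
    rw [lt_div_iff₀ (by positivity)] at h2
    nlinarith [norm_nonneg y]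
  · have h2 : φ x ∈ φ '' (pV f ∩ U) := by rw [him]; exact ⟨h1, hm (hrU hx)⟩
    obtain ⟨x', hx', hxx⟩ := h2
    have h3 : x' = x := by rw [← hl hx'.2, hxx, hl (hrU hx)]
    rw [← h3]; exact hx'.1
  · have h2 : φ x ∈ pV g ∩ U' := by rw [← him]; exact ⟨x, ⟨h1, hrU hx⟩, rfl⟩
    exact h2.1

lemma bilip_symm {X Y : Set (En n)} (h : BiLipGermHomeo X Y) : BiLipGermHomeo Y X := by
  obtain ⟨U, U', φ, ψ, K, hU, hU', h0, h0', hφ0, hm, hm', hl, hr, hLφ, hLψ, him⟩ := h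
  refine ⟨U', U, ψ, φ, K, hU', hU, h0', h0, by have := hl h0; rwa [hφ0] at this, hm', hm, hr, hl, hLψ, hLφ, ?_⟩
  rw [← him, ← image_comp]
  ext x
  constructor
  · rintro ⟨y, hy, rfl⟩
    rw [Function.comp_apply, hl hy.2]; exact hy
  · intro hx
    exact ⟨x, hx, hl hx.2⟩

theorem part1 (hn : 3 ≤ n) (hfirr : Irreducible f) (hgirr : Irreducible g)
    (hfhom : f.IsHomogeneous f.totalDegree) (hghom : g.IsHomogeneous g.totalDegree) (hfsing : SingV f ⊆ {0})
    {φ ψ : En n → En n} {K r r' : ℝ} (h : BH (ev f) (ev g) φ ψ K r r') :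
    SingV g ⊆ {0} ∧ (f.totalDegree = 1 → g.totalDegree = 1) ∧
      ∃ e : ℤ, e * e = 1 ∧ ∀ p, ev f p = 0 → p ≠ 0 → ‖p‖ < r → HasLog (ev f) (ev g ∘ φ) e p := by
  have hI := homIso_of hfirr hfhom hfsing
  have hg0 : ev g 0 = 0 := by
    have := ev_hom hghom 0 0
    have h1 := irr_deg_pos hgirr
    rwa [zero_smul, zero_pow (by omega), zero_mul] at this
  have hf0 : ev f 0 = 0 := hI.zero (irr_deg_pos hfirr)
  have hgc := (ev_diff g).continuous
  obtain ⟨e, he⟩ := e_const hI (by rw [finrank_euclideanSpace_fin]; exact hn) (irr_deg_pos hfirr) h.rpos (u := ev g ∘ φ)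
    (hgc.comp_continuousOn h.cont) (fun x hx hne h0 => hne ((h.van x hx).1 h0))
  have hee : e * e = 1 := by
    obtain ⟨y, hy, hgy, hdy⟩ := smooth_pt_ne (by omega) hgirr hghom
    obtain ⟨t, ht, hty⟩ := small_scale y h.rpos'
    rw [← mem_ball_zero_iff] at hty
    have hgty : ev g (t • y) = 0 := by rw [ev_hom hghom, hgy, mul_zero]
    refine h.e_unit (ev_diff f).continuous (ev_contDiff g) hty hgty ?_
      (he _ ((h.vanψ hty).2 hgty) (h.ψne hty (smul_ne_zero ht hy)) (mem_ball_zero_iff.1 (h.inv _ hty).1))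
    intro h0
    have := ev_fderiv_scale hghom (inv_ne_zero ht) h0
    rw [smul_smul, inv_mul_cancel₀ ht, one_smul] at this
    exact hdy this
  have key : ∀ q ∈ ball (0 : En n) r', ev g q = 0 → fderiv ℂ (ev g) q = 0 → fderiv ℂ (ev f) (ψ q) ≠ 0 →
      HasLog (ev f) (ev g ∘ φ) e (ψ q) → False := fun q hq hgq hdq hdf hlog => by
    obtain ⟨S, T, r0, s, hS⟩ := straighten (ev_contDiff f) ((h.vanψ hq).2 hgq) hdf
    obtain ⟨φ', K', r1, r1', hP⟩ := h.pp (h.inv q hq).1 (by rw [(h.inv q hq).2]; exact hq) hS hlog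
    rw [(h.inv q hq).2] at hP
    obtain ⟨G, hG⟩ := ev_trans g q
    have hG' : ev G = fun y => ev g (q + y) := funext hG
    rw [← hG'] at hP
    refine lemma_A (G := G) ?_ (by rw [hG, add_zero, hgq]) (by rw [hG', fderiv_comp_add_left, add_zero, hdq]) hdf hee hP
    rintro rfl
    obtain ⟨x, hx⟩ := ev_exists_ne hgirr.ne_zero
    apply hx
    have := hG (x - q)
    rw [add_sub_cancel] at this
    rw [← this]; simp [ev]
  refine ⟨fun q hq => ?_, fun h1 => ?_, e, hee, he⟩
  · by_contra hq0
    rw [mem_singleton_iff] at hq0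
    rw [mem_SingV] at hq
    obtain ⟨t, ht, htq⟩ := small_scale q h.rpos'
    rw [← mem_ball_zero_iff] at htq
    have hgtq : ev g (t • q) = 0 := by rw [ev_hom hghom, hq.1, mul_zero]
    have hne := h.ψne htq (smul_ne_zero ht hq0)
    exact key _ htq hgtq (ev_fderiv_scale hghom ht hq.2) (hI.iso _ hne)
      (he _ ((h.vanψ htq).2 hgtq) hne (mem_ball_zero_iff.1 (h.inv _ htq).1))
  · by_contra hb
    have hb2 : 2 ≤ g.totalDegree := by have := irr_deg_pos hgirr; omega
    have hψ0 : ψ 0 = 0 := by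
      have := h.inv' 0 (mem_ball_self h.rpos)
      rwa [h.zero] at this
    have hd0 := deg1_smooth hfirr hfhom h1 0
    obtain ⟨S, T, r0, s, hS⟩ := straighten (ev_contDiff f) hf0 hd0
    obtain ⟨e0, he0⟩ := hasLog_exists hS hd0 h.rpos (u := ev g ∘ φ)
      (hgc.comp_continuousOn h.cont) (fun x hx hne h0 => hne ((h.van x hx).1 h0))
    obtain ⟨v, hv, hfv⟩ := deg1_zero (by omega) (h1 ▸ hfhom)
    obtain ⟨ρ, hρ, hρ'⟩ := Metric.eventually_nhds_iff_ball.1 he0.near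
    obtain ⟨t, ht, htv⟩ := small_scale v (lt_min hρ h.rpos)
    have hftv : ev f (t • v) = 0 := by rw [ev_hom hfhom, hfv, mul_zero]
    have hne := smul_ne_zero ht hv
    have e1 := he _ hftv hne (htv.trans_le (min_le_right _ _))
    have e2 := hρ' (t • v) (mem_ball_zero_iff.2 (htv.trans_le (min_le_left _ _)))
    obtain ⟨S', T', r0', s', hS'⟩ := straighten (ev_contDiff f) hftv (hI.iso _ hne)
    have := hasLog_unique hS' (hI.iso _ hne) e1 e2
    rw [← this] at he0
    exact key 0 (mem_ball_self h.rpos') hg0 (deg_ge2_zero hghom hb2) (by rwa [hψ0]) (by rwa [hψ0])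
end

section
variable {n : ℕ}

lemma irr_X_comb {n : ℕ} {c : Fin n → ℂ} {i : Fin n} (hi : c i ≠ 0) :
    Irreducible (∑ j, MvPolynomial.C (c j) * MvPolynomial.X j : MvPolynomial (Fin n) ℂ) ∧
    (∑ j, MvPolynomial.C (c j) * MvPolynomial.X j : MvPolynomial (Fin n) ℂ).totalDegree = 1 := by
  classical
  set p : MvPolynomial (Fin n) ℂ := ∑ j, MvPolynomial.C (c j) * MvPolynomial.X j with hp
  have hh : p.IsHomogeneous 1 := MvPolynomial.IsHomogeneous.sum _ _ _ fun j _ => by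
    have := (MvPolynomial.isHomogeneous_C (Fin n) (c j)).mul (MvPolynomial.isHomogeneous_X ℂ j)
    simpa using this
  have hco : p.coeff (Finsupp.single i 1) = c i := by
    rw [hp, MvPolynomial.coeff_sum]
    simp only [MvPolynomial.coeff_C_mul, MvPolynomial.coeff_X, Finsupp.single_left_inj (one_ne_zero (α := ℕ))]
    simp
  have h0 : p ≠ 0 := fun h => by rw [h] at hco; simp at hco; exact hi hco.symm
  have h1 := hh.totalDegree h0
  refine ⟨MvPolynomial.irreducible_of_totalDegree_eq_one h1 fun x hx => ?_, h1⟩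
  have := hx (Finsupp.single i 1)
  rw [hco] at this
  exact isUnit_iff_ne_zero.2 fun h => hi (by rwa [h, zero_dvd_iff] at this)

lemma deg_one_of_line {f : MvPolynomial (Fin n) ℂ} (hirr : Irreducible f) {c : Fin n → ℂ} {i : Fin n} (hi : c i ≠ 0)
    (h : ∀ x : En n, ∑ j, c j * x j = 0 → ev f x = 0) : f.totalDegree = 1 := by
  obtain ⟨h1, h2⟩ := irr_X_comb hi
  have h3 := null_dvd h1 (q := f) fun x hx => h x (by simpa [ev] using hx)
  rw [← h2]
  have h4 := (h1.dvd_irreducible_iff_associated hirr).1 h3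
  refine le_antisymm ?_ ?_
  · exact MvPolynomial.totalDegree_le_of_dvd_of_isDomain h4.symm.dvd h1.ne_zero
  · exact MvPolynomial.totalDegree_le_of_dvd_of_isDomain h4.dvd hirr.ne_zero

lemma two_zero {f : MvPolynomial (Fin 2) ℂ} {a : ℕ} (ha : 1 ≤ a) (hf : f.IsHomogeneous a) :
    ∃ v : En 2, v ≠ 0 ∧ ev f v = 0 := by
  set P : Polynomial ℂ := MvPolynomial.aeval ![Polynomial.X, 1] f with hP
  have hev : ∀ t : ℂ, P.eval t = ev f !₂[t, 1] := fun t => by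
    rw [hP, MvPolynomial.aeval_def, ← Polynomial.coe_evalRingHom, MvPolynomial.hom_eval₂]
    unfold ev
    rw [MvPolynomial.eval, MvPolynomial.coe_eval₂Hom]
    congr 1
    · ext x; simp
    · ext i; fin_cases i <;> simp
  by_cases hd : P.degree = 0
  · refine ⟨!₂[1, 0], fun h => by have := congrArg (fun v : En 2 => v 0) h; simp at this, ?_⟩
    rw [Polynomial.eq_C_of_degree_eq_zero hd] at hev
    simp only [Polynomial.eval_C] at hev
    have h1 : Continuous fun s : ℂ => ev f !₂[1, s] := (ev_diff f).continuous.comp (by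
      refine (PiLp.continuous_toLp 2 _).comp ?_
      refine continuous_pi fun i => ?_
      fin_cases i <;> simp <;> fun_prop)
    have h2 : (fun s : ℂ => ev f !₂[1, s]) = fun s => s ^ a * P.coeff 0 := by
      refine Continuous.ext_on (dense_compl_singleton (0 : ℂ)) h1 (by fun_prop) fun s hs => ?_
      change ev f !₂[1, s] = s ^ a * P.coeff 0
      rw [hev s⁻¹, ← ev_hom hf]
      congr 1
      ext i
      fin_cases i
      · simp [mul_inv_cancel₀ hs]
      · simp
    have := congrFun h2 0
    rwa [zero_pow (by omega), zero_mul] at this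
  · obtain ⟨t, ht⟩ := IsAlgClosed.exists_root P hd
    refine ⟨!₂[t, 1], fun h => by have := congrArg (fun v : En 2 => v 1) h; simp at this, ?_⟩
    rw [← hev]; exact ht

lemma small_deg (hn : n ≤ 2) {f : MvPolynomial (Fin n) ℂ} (hirr : Irreducible f) (hf : f.IsHomogeneous f.totalDegree) :
    f.totalDegree = 1 := by
  have ha := irr_deg_pos hirr
  have hf0 : ev f 0 = 0 := by
    have := ev_hom hf 0 0
    rwa [zero_smul, zero_pow (by omega), zero_mul] at this
  interval_cases n
  · exfalso
    have : f.totalDegree = 0 := by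
      rw [MvPolynomial.eq_C_of_isEmpty f]; simp
    omega
  · refine deg_one_of_line hirr (c := fun _ => 1) (i := 0) one_ne_zero fun x hx => ?_
    have : x = 0 := by ext i; fin_cases i; simpa using hx
    rw [this, hf0]
  · obtain ⟨v, hv, hfv⟩ := two_zero ha hf
    have key : ∀ x : En 2, ∑ j, (![v 1, - v 0] : Fin 2 → ℂ) j * x j = 0 → ev f x = 0 := fun x hx => by
      simp [Fin.sum_univ_two] at hx
      have : ∃ c : ℂ, x = c • v := by
        by_cases h0 : v 0 = 0
        · have h1 : v 1 ≠ 0 := fun h1 => hv (by ext i; fin_cases i <;> simp [h0, h1])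
          refine ⟨x 1 / v 1, ?_⟩
          rw [h0] at hx
          have hx0 : x 0 = 0 := by simpa [h1] using hx
          ext i; fin_cases i
          · simp [h0, hx0]
          · simp [h1]
        · refine ⟨x 0 / v 0, ?_⟩
          ext i; fin_cases i
          · simp [h0]
          · simp; field_simp; linear_combination -hx
      obtain ⟨c, rfl⟩ := this
      rw [ev_hom hf, hfv, mul_zero]
    by_cases h0 : v 0 = 0
    · have h1 : v 1 ≠ 0 := fun h1 => hv (by ext i; fin_cases i <;> simp [h0, h1])
      exact deg_one_of_line hirr (i := 0) (by simpa using h1) key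
    · exact deg_one_of_line hirr (i := 1) (by simpa using h0) key
end

lemma disc_log {R : ℝ} (hR : 1 < R) (Z : Finset ℂ) : ∀ (u : ℂ → ℂ), (∀ z ∈ Z, ‖z‖ < 1) →
    (∀ z ∈ ball (0 : ℂ) R, z ∉ Z → ContinuousAt u z ∧ u z ≠ 0) →
    (∀ z ∈ Z, ∃ L : ℂ → ℂ, ∀ᶠ w in 𝓝[≠] z, ContinuousAt L w ∧ u w = Complex.exp (L w)) →
    ∃ M : ℂ → ℂ, ContinuousOn M (sphere 0 1) ∧ ∀ z ∈ sphere (0 : ℂ) 1, u z = Complex.exp (M z) := by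
  classical
  induction Z using Finset.induction_on with
  | empty =>
    intro u _ h2 _
    have hs : sphere (0 : ℂ) 1 ⊆ ball 0 R := fun z hz => by
      rw [mem_ball_zero_iff, mem_sphere_zero_iff_norm.1 hz]; exact hR
    obtain ⟨L, hL, hL1⟩ := log_star (u := u) (mem_ball_self (show 0 < R by linarith))
      ((convex_ball (0 : ℂ) R).starConvex (mem_ball_self (show 0 < R by linarith)))
      (fun z hz => (h2 z hz (by simp)).1.continuousWithinAt) (fun z hz => (h2 z hz (by simp)).2)
    exact ⟨L, hL.mono hs, fun z hz => hL1 z (hs hz)⟩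
  | insert z0 Z hz0 ih =>
    intro u h1 h2 h3
    obtain ⟨L, hL⟩ := h3 z0 (by simp)
    rw [eventually_nhdsWithin_iff, Metric.eventually_nhds_iff_ball] at hL
    obtain ⟨ρ1, hρ1, hL⟩ := hL
    have hev : ∀ᶠ w in 𝓝 z0, ‖w‖ < 1 ∧ w ∉ Z := by
      refine Filter.Eventually.and ?_ ?_
      · exact (continuous_norm.tendsto z0).eventually (gt_mem_nhds (h1 z0 (by simp)))
      · exact (Z.finite_toSet.isClosed.isOpen_compl).mem_nhds (by simpa using hz0)
    obtain ⟨ρ2, hρ2, hev⟩ := Metric.eventually_nhds_iff_ball.1 hev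
    set ρ := min ρ1 ρ2 / 2 with hρ
    have hρp : 0 < ρ := by have := lt_min hρ1 hρ2; positivity
    have hle1 : 2 * ρ ≤ ρ1 := by have := min_le_left ρ1 ρ2; linarith
    have hle2 : 2 * ρ ≤ ρ2 := by have := min_le_right ρ1 ρ2; linarith
    let χ : ℂ → ℝ := fun z => min 1 (max 0 (2 * ‖z - z0‖ / ρ - 1))
    have hχ : Continuous χ := by unfold χ; fun_prop
    have hχ0 : ∀ z, ‖z - z0‖ < ρ / 2 → χ z = 0 := fun z hz => by
      have : 2 * ‖z - z0‖ / ρ - 1 ≤ 0 := by rw [sub_nonpos, div_le_one hρp]; linarith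
      simp only [χ]; rw [max_eq_left this]; simp
    have hχ1 : ∀ z, ρ ≤ ‖z - z0‖ → χ z = 1 := fun z hz => by
      have : 1 ≤ 2 * ‖z - z0‖ / ρ - 1 := by rw [le_sub_iff_add_le, le_div_iff₀ hρp]; linarith
      simp only [χ]; exact min_eq_left (this.trans (le_max_right _ _))
    let u' : ℂ → ℂ := fun z => if ‖z - z0‖ < 2 * ρ then Complex.exp (χ z * L z) else u z
    have hu1 : ∀ z, ρ ≤ ‖z - z0‖ → u' z = u z := fun z hz => by
      simp only [u']
      split_ifs with h
      · have hne : z ≠ z0 := fun h => by rw [h] at hz; simp at hz; linarith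
        rw [hχ1 z hz, (hL z (by rw [mem_ball, dist_eq_norm]; linarith) hne).2]; simp
      · rfl
    have hue : ∀ z, ρ < ‖z - z0‖ → u' =ᶠ[𝓝 z] u := fun z hz => by
      have : ∀ᶠ w in 𝓝 z, ρ < ‖w - z0‖ :=
        ((by fun_prop : Continuous fun w : ℂ => ‖w - z0‖).tendsto z).eventually (lt_mem_nhds hz)
      filter_upwards [this] with w hw using hu1 w hw.le
    have hu2 : ∀ z, ‖z - z0‖ < 2 * ρ → u' =ᶠ[𝓝 z] fun z => Complex.exp (χ z * L z) := fun z hz => by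
      have : ∀ᶠ w in 𝓝 z, ‖w - z0‖ < 2 * ρ :=
        ((by fun_prop : Continuous fun w : ℂ => ‖w - z0‖).tendsto z).eventually (gt_mem_nhds hz)
      filter_upwards [this] with w hw using if_pos hw
    have hfar : ∀ z ∈ Z, ρ < ‖z - z0‖ := fun z hz => by
      by_contra hc
      exact (hev z (by rw [mem_ball, dist_eq_norm]; push Not at hc; linarith)).2 hz
    obtain ⟨M, hM, hM1⟩ := ih u' (fun z hz => h1 z (Finset.mem_insert_of_mem hz)) (fun z hz hzZ => by
        rcases lt_or_ge ‖z - z0‖ (2 * ρ) with h | h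
        · refine ⟨ContinuousAt.congr ?_ (hu2 z h).symm, by rw [(hu2 z h).eq_of_nhds]; exact Complex.exp_ne_zero _⟩
          rcases eq_or_ne z z0 with rfl | hne
          · have : ∀ᶠ w in 𝓝 z, ‖w - z‖ < ρ / 2 :=
              ((by fun_prop : Continuous fun w : ℂ => ‖w - z‖).tendsto z).eventually
                (gt_mem_nhds (by simp; positivity))
            refine (continuousAt_const (y := (1 : ℂ))).congr ?_
            filter_upwards [this] with w hw
            rw [hχ0 w hw]; simp
          · have := (hL z (by rw [mem_ball, dist_eq_norm]; linarith) hne).1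
            exact ((Complex.continuous_ofReal.comp hχ).continuousAt.mul this).cexp
        · have hz' : z ∉ insert z0 Z := by
            rw [Finset.mem_insert, not_or]
            refine ⟨fun h' => ?_, hzZ⟩
            rw [h'] at h; simp at h; linarith
          have h4 := h2 z hz hz'
          exact ⟨h4.1.congr (hue z (by linarith)).symm, by rw [hu1 z (by linarith)]; exact h4.2⟩)
      (fun z hz => by
        obtain ⟨L', hL'⟩ := h3 z (Finset.mem_insert_of_mem hz)
        refine ⟨L', ?_⟩
        filter_upwards [hL', (hue z (hfar z hz)).filter_mono nhdsWithin_le_nhds] with w hw hw2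
        exact ⟨hw.1, by rw [hw2]; exact hw.2⟩)
    refine ⟨M, hM, fun z hz => ?_⟩
    rw [← hM1 z hz, hu1]
    by_contra hc
    have := (hev z (by rw [mem_ball, dist_eq_norm]; push Not at hc; linarith)).1
    rw [mem_sphere_zero_iff_norm.1 hz] at this
    exact lt_irrefl _ this

section
variable {n : ℕ}

lemma line_poly (f : MvPolynomial (Fin n) ℂ) (p x : En n) :
    ∃ P : Polynomial ℂ, ∀ z, P.eval z = ev f (p + z • x) := by
  refine ⟨MvPolynomial.aeval (fun i => Polynomial.C (p i) + Polynomial.X * Polynomial.C (x i)) f, fun t => ?_⟩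
  rw [MvPolynomial.aeval_def, ← Polynomial.coe_evalRingHom, MvPolynomial.hom_eval₂]
  unfold ev
  rw [MvPolynomial.eval, MvPolynomial.coe_eval₂Hom]
  congr 1
  · ext x; simp
  · ext i; simp; ring

lemma small_indep (hn : 2 ≤ n) (x : En n) {δ : ℝ} (hδ : 0 < δ) :
    ∃ p : En n, ‖p‖ < δ ∧ ∀ z : ℂ, p + z • x ≠ 0 := by
  have h1 : ∃ q : En n, q ∉ Submodule.span ℂ {x} := by
    by_contra hc
    push Not at hc
    have h2 : Submodule.span ℂ {x} = ⊤ := eq_top_iff.2 fun y _ => hc y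
    have h3 := finrank_span_le_card (R := ℂ) ({x} : Set (En n))
    rw [h2, finrank_top, finrank_euclideanSpace] at h3
    simp at h3; omega
  obtain ⟨q, hq⟩ := h1
  obtain ⟨t, ht, htq⟩ := small_scale q hδ
  refine ⟨t • q, htq, fun z hz => hq ?_⟩
  rw [Submodule.mem_span_singleton]
  refine ⟨-(t⁻¹ * z), ?_⟩
  have h4 : t • q = -(z • x) := eq_neg_of_add_eq_zero_left hz
  rw [← inv_smul_smul₀ ht q, h4, smul_neg, neg_smul, mul_smul]

lemma wind_line (hn : 2 ≤ n) {f g : MvPolynomial (Fin n) ℂ} {a : ℕ} (hf : f.IsHomogeneous a)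
    {φ ψ : En n → En n} {K r r' : ℝ} (h : BH (ev f) (ev g) φ ψ K r r') {e : ℤ}
    (he : ∀ p, ev f p = 0 → p ≠ 0 → ‖p‖ < r → HasLog (ev f) (ev g ∘ φ) e p)
    {x : En n} (hx : ev f x ≠ 0) (hxr : 2 * ‖x‖ < r) :
    ∃ M : sphere (0 : ℂ) 1 → ℂ, Continuous M ∧ ∀ z : sphere (0 : ℂ) 1,
      ev g (φ ((z : ℂ) • x)) = ev f ((z : ℂ) • x) ^ e * Complex.exp (M z) := by
  have hfc := (ev_diff f).continuous
  obtain ⟨δ, hδ, hδf⟩ := Metric.eventually_nhds_iff_ball.1 (hfc.continuousAt.eventually_ne hx)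
  obtain ⟨p, hp, hp0⟩ := small_indep hn x (lt_min hδ (show 0 < r - 2 * ‖x‖ by linarith))
  have hpδ := hp.trans_le (min_le_left _ _)
  have hpr := hp.trans_le (min_le_right _ _)
  have hne1 : ∀ (s : ℝ) (z : ℂ), s ∈ Icc (0 : ℝ) 1 → 1 ≤ ‖z‖ → ev f ((s : ℂ) • p + z • x) ≠ 0 := by
    intro s z hs hz
    have hz0 : z ≠ 0 := fun h => by rw [h, norm_zero] at hz; linarith
    have : (s : ℂ) • p + z • x = z • (x + (z⁻¹ * s) • p) := by
      rw [smul_add, smul_smul, mul_inv_cancel_left₀ hz0, add_comm]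
    rw [this, ev_hom hf]
    refine mul_ne_zero (pow_ne_zero _ hz0) (hδf _ ?_)
    rw [mem_ball, dist_eq_norm, add_sub_cancel_left, norm_smul, norm_mul, norm_inv, Complex.norm_real,
      Real.norm_of_nonneg hs.1]
    have h1 : ‖z‖⁻¹ ≤ 1 := inv_le_one_of_one_le₀ hz
    have h2 : ‖z‖⁻¹ * s ≤ 1 := mul_le_one₀ h1 hs.1 hs.2
    have := mul_le_mul_of_nonneg_right h2 (norm_nonneg p)
    linarith
  have hin : ∀ (s : ℝ) (z : ℂ), s ∈ Icc (0 : ℝ) 1 → ‖z‖ < 2 → (s : ℂ) • p + z • x ∈ ball (0 : En n) r := by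
    intro s z hs hz
    rw [mem_ball_zero_iff]
    refine (norm_add_le _ _).trans_lt ?_
    rw [norm_smul, norm_smul, Complex.norm_real, Real.norm_of_nonneg hs.1]
    have h1 := mul_le_mul_of_nonneg_right hs.2 (norm_nonneg p)
    have h2 := mul_le_mul_of_nonneg_right hz.le (norm_nonneg x)
    linarith
  have h01 : (1 : ℝ) ∈ Icc (0 : ℝ) 1 := by simp
  obtain ⟨P, hP⟩ := line_poly f p x
  have hP0 : P ≠ 0 := fun h => by
    have h1 := hne1 1 1 h01 (by simp)
    have := hP 1
    rw [h, Polynomial.eval_zero] at this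
    exact h1 (by simpa using this.symm)
  have hmem : ∀ z, z ∈ P.roots.toFinset ↔ ev f (p + z • x) = 0 := fun z => by
    rw [Multiset.mem_toFinset, Polynomial.mem_roots hP0, Polynomial.IsRoot, hP]
  have hcφ : ∀ y ∈ ball (0 : En n) r, ContinuousAt (fun y => ev g (φ y)) y := fun y hy =>
    ((ev_diff g).continuous.continuousAt).comp (h.cont.continuousAt (isOpen_ball.mem_nhds hy))
  have hcu : ∀ y ∈ ball (0 : En n) r, ev f y ≠ 0 →
      ContinuousAt (fun y => ev g (φ y) / ev f y ^ e) y ∧ ev g (φ y) / ev f y ^ e ≠ 0 := fun y hy hfy =>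
    ⟨(hcφ y hy).div (hfc.continuousAt.zpow₀ e (Or.inl hfy)) (zpow_ne_zero e hfy),
      div_ne_zero (fun h0 => hfy ((h.van y hy).1 h0)) (zpow_ne_zero e hfy)⟩
  have hlc : Continuous fun z : ℂ => p + z • x := by fun_prop
  obtain ⟨M, hM, hM1⟩ := disc_log one_lt_two P.roots.toFinset
    (fun z => ev g (φ (p + z • x)) / ev f (p + z • x) ^ e)
    (fun z hz => by
      by_contra hc
      push Not at hc
      have := hne1 1 z h01 hc
      exact this (by simpa using (hmem z).1 hz))
    (fun z hz hzP => by
      rw [hmem] at hzP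
      have h1 := hin 1 z h01 (mem_ball_zero_iff.1 hz)
      rw [Complex.ofReal_one, one_smul] at h1
      have h2 := hcu _ h1 hzP
      exact ⟨ContinuousAt.comp (f := fun z : ℂ => p + z • x) (g := fun y => ev g (φ y) / ev f y ^ e) h2.1 hlc.continuousAt, h2.2⟩)
    (fun z hz => by
      have hz1 : ‖z‖ < 1 := by
        by_contra hc
        push Not at hc
        have := hne1 1 z h01 hc
        exact this (by simpa using (hmem z).1 hz)
      have h1 := hin 1 z h01 (by linarith)
      rw [Complex.ofReal_one, one_smul] at h1
      obtain ⟨L, ρ, hρ, hL, hLe⟩ := he _ ((hmem z).1 hz) (hp0 z) (mem_ball_zero_iff.1 h1)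
      refine ⟨fun z => L (p + z • x), ?_⟩
      have hb : ∀ᶠ w in 𝓝[≠] z, p + w • x ∈ ball (p + z • x) ρ :=
        (hlc.continuousAt.eventually (ball_mem_nhds _ hρ)).filter_mono nhdsWithin_le_nhds
      have hZ : ∀ᶠ w in 𝓝[≠] z, w ∉ P.roots.toFinset := by
        have h5 : ∀ᶠ w in 𝓝 z, w ∉ P.roots.toFinset.erase z :=
          ((P.roots.toFinset.erase z).finite_toSet.isClosed.isOpen_compl).mem_nhds (by simp)
        filter_upwards [h5.filter_mono nhdsWithin_le_nhds, self_mem_nhdsWithin] with w hw hwz hc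
        exact hw (Finset.mem_erase.2 ⟨hwz, hc⟩)
      filter_upwards [hb, hZ] with w hw hwZ
      rw [hmem] at hwZ
      have hop : IsOpen (ball (p + z • x) ρ ∩ {x | ev f x ≠ 0}) :=
        isOpen_ball.inter (isOpen_ne_fun hfc continuous_const)
      refine ⟨ContinuousAt.comp (f := fun z : ℂ => p + z • x) (g := L)
        (hL.continuousAt (hop.mem_nhds ⟨hw, hwZ⟩)) hlc.continuousAt, ?_⟩
      have := hLe _ hw hwZ
      rw [Function.comp] at this
      rw [this, mul_div_cancel_left₀ _ (zpow_ne_zero e hwZ)])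
  have hs1 : ∀ s : unitInterval, (1 - (s : ℝ)) ∈ Icc (0 : ℝ) 1 := fun s =>
    ⟨by linarith [s.2.2], by linarith [s.2.1]⟩
  have hz1 : ∀ z : sphere (0 : ℂ) 1, ‖(z : ℂ)‖ = 1 := fun z => mem_sphere_zero_iff_norm.1 z.2
  let γ : unitInterval × sphere (0 : ℂ) 1 → En n := fun q => ((1 - (q.1 : ℝ) : ℝ) : ℂ) • p + (q.2 : ℂ) • x
  have hγ : Continuous γ := by unfold γ; fun_prop
  have hγ1 : ∀ q, γ q ∈ ball (0 : En n) r ∧ ev f (γ q) ≠ 0 := fun q =>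
    ⟨hin _ _ (hs1 q.1) (by rw [hz1]; norm_num), hne1 _ _ (hs1 q.1) (hz1 _).ge⟩
  obtain ⟨L, hL, hL1, -⟩ := log_param (fun q => ev g (φ (γ q)) / ev f (γ q) ^ e)
    (continuous_iff_continuousAt.2 fun q => ContinuousAt.comp (f := γ) (g := fun y => ev g (φ y) / ev f y ^ e)
      (hcu _ (hγ1 q).1 (hγ1 q).2).1 hγ.continuousAt)
    (fun q => (hcu _ (hγ1 q).1 (hγ1 q).2).2) (fun z => M z) (continuousOn_iff_continuous_domRestrict.1 hM)
    (fun z => by rw [← hM1 z z.2]; simp [γ])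
  refine ⟨fun z => L (1, z), by fun_prop, fun z => ?_⟩
  have h1 := hL1 (1, z)
  have h2 : γ (1, z) = (z : ℂ) • x := by simp [γ]
  rw [h2] at h1
  have h3 := (hγ1 (1, z)).2
  rw [h2] at h3
  rw [h1, mul_div_cancel₀ _ (zpow_ne_zero e h3)]
end

section
variable {n : ℕ}

lemma no_lt (hn : 2 ≤ n) {f g : MvPolynomial (Fin n) ℂ} {a b : ℕ} (hf : f.IsHomogeneous a)
    (hg : HomIso (ev g) b) (ha : 2 ≤ a) (hab : a < b)
    {φ ψ : En n → En n} {K r r' : ℝ} (h : BH (ev f) (ev g) φ ψ K r r') {e : ℤ} (hee : e * e = 1)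
    (he : ∀ p, ev f p = 0 → p ≠ 0 → ‖p‖ < r → HasLog (ev f) (ev g ∘ φ) e p)
    {x0 : En n} (hx0 : ev g x0 = 1) : False := by
  have hb0 : (b : ℂ) ≠ 0 := by exact_mod_cast (show b ≠ 0 by omega)
  have hK := h.Kpos
  have hr := h.rpos
  have hr' := h.rpos'
  have : NeZero n := ⟨by omega⟩
  obtain ⟨C, hC, σ, hσ, hσC⟩ := sigma_bound hg (by omega)
  obtain ⟨ε, hε, hε1, hε2⟩ : ∃ ε : ℝ, 0 < ε ∧ ε * C < r' ∧ 2 * (K * (ε * C)) < r := by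
    refine ⟨min (r' / (2 * C)) (r / (4 * K * C)), by positivity, ?_, ?_⟩
    · have h1 := mul_le_mul_of_nonneg_right (min_le_left (r' / (2 * C)) (r / (4 * K * C))) hC.le
      have h2 : r' / (2 * C) * C = r' / 2 := by field_simp
      linarith
    · have h1 := mul_le_mul_of_nonneg_right (min_le_right (r' / (2 * C)) (r / (4 * K * C)))
        (by positivity : 0 ≤ 2 * K * C)
      have h2 : r / (4 * K * C) * (2 * K * C) = r / 2 := by field_simp; ring
      linarith
  have hεc : (ε : ℂ) ≠ 0 := by exact_mod_cast hε.ne'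
  have hgev : ∀ (c : ℂ) (x : En n), ev g (c • x) = c ^ b * ev g x := hg.hom
  let F : Set (En n) := {x | ev g x = 1}
  let q : F → En n := fun x => (ε : ℂ) • (σ x : En n)
  have hq : Continuous q := by unfold q; fun_prop
  have hgq : ∀ x, ev g (q x) = ε ^ b := fun x => by
    have : ev g (σ x : En n) = 1 := (σ x).2
    simp only [q]; rw [hgev, this, mul_one]
  have hqn : ∀ x, ‖q x‖ ≤ ε * C := fun x => by
    simp only [q]; rw [norm_smul, Complex.norm_real, Real.norm_of_nonneg hε.le]
    exact mul_le_mul_of_nonneg_left (hσC x) hε.le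
  have hqb : ∀ x, q x ∈ ball (0 : En n) r' := fun x => mem_ball_zero_iff.2 ((hqn x).trans_lt hε1)
  have hy : Continuous fun x => ψ (q x) := h.contψ.comp_continuous hq hqb
  have hyr : ∀ x, 2 * ‖ψ (q x)‖ < r := fun x => by
    have h1 := h.nψ (hqb x)
    have h2 := mul_le_mul_of_nonneg_left (hqn x) hK.le
    linarith
  have hfy : ∀ x, ev f (ψ (q x)) ≠ 0 := fun x hx => by
    rw [h.vanψ (hqb x), hgq] at hx
    exact pow_ne_zero b hεc hx
  let ex : unitInterval → ℂ := fun t => Complex.exp ((t : ℝ) * (2 * Real.pi * Complex.I))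
  have hex : Continuous ex := by unfold ex; fun_prop
  have hexn : ∀ t, ‖ex t‖ = 1 := fun t => by
    simp only [ex]
    rw [show (((t : ℝ) : ℂ) * (2 * Real.pi * Complex.I)) = ((t * (2 * Real.pi) : ℝ) : ℂ) * Complex.I by
      push_cast; ring]
    exact Complex.norm_exp_ofReal_mul_I _
  have hex0 : ∀ t, ex t ≠ 0 := fun t => Complex.exp_ne_zero _
  let Y : unitInterval × F → En n := fun p => ex p.1 • ψ (q p.2)
  have hY : Continuous Y := (hex.comp continuous_fst).smul (hy.comp continuous_snd)
  have hYb : ∀ p, Y p ∈ ball (0 : En n) r := fun p => by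
    rw [mem_ball_zero_iff]; simp only [Y]; rw [norm_smul, hexn, one_mul]
    linarith [hyr p.2, norm_nonneg (ψ (q p.2))]
  have hfY : ∀ p, ev f (Y p) ≠ 0 := fun p => by
    simp only [Y]; rw [ev_hom hf]; exact mul_ne_zero (pow_ne_zero _ (hex0 _)) (hfy _)
  have hφY : Continuous fun p => φ (Y p) := h.cont.comp_continuous hY hYb
  have hY0 : ∀ x, Y (0, x) = ψ (q x) := fun x => by simp [Y, ex]
  have hY1 : ∀ x, Y (1, x) = ψ (q x) := fun x => by
    simp [Y, ex, Complex.exp_two_pi_mul_I]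
  have hφq : ∀ x, φ (ψ (q x)) = q x := fun x => (h.inv _ (hqb x)).2
  obtain ⟨L, hL, hL1, hL0⟩ := log_param (fun p => ev g (φ (Y p)) / ε ^ b)
    (((ev_diff g).continuous.comp hφY).div_const _)
    (fun p => div_ne_zero (fun h0 => hfY p ((h.van _ (hYb p)).1 h0)) (pow_ne_zero _ hεc))
    (fun _ => 0) continuous_const (fun x => by
      rw [hY0, hφq, hgq, div_self (pow_ne_zero _ hεc), Complex.exp_zero])
  have hL2 : ∀ x, L (1, x) = e * a * (2 * Real.pi * Complex.I) := fun x => by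
    obtain ⟨M, hM, hM1⟩ := wind_line hn hf h he (hfy x) (hyr x)
    let c : unitInterval → sphere (0 : ℂ) 1 := fun t => ⟨ex t, mem_sphere_zero_iff_norm.2 (hexn t)⟩
    have hc : Continuous c := hex.subtype_mk _
    let A := Complex.log (ev f (ψ (q x)) ^ e / ε ^ b)
    have hA : Complex.exp A = ev f (ψ (q x)) ^ e / ε ^ b :=
      Complex.exp_log (div_ne_zero (zpow_ne_zero _ (hfy x)) (pow_ne_zero _ hεc))
    obtain ⟨k, hk⟩ := const_of_exp (K := (univ : Set unitInterval)) isPreconnected_univ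
      (h := fun t => L (t, x) - M (c t) - (t : ℝ) * (e * a * (2 * Real.pi * Complex.I)) - A)
      (by
        have h1 : Continuous fun t => L (t, x) := by fun_prop
        have h2 : Continuous fun t => M (c t) := hM.comp hc
        have h3 : Continuous fun t : unitInterval => ((t : ℝ) : ℂ) * (e * a * (2 * Real.pi * Complex.I)) := by
          fun_prop
        exact (((h1.sub h2).sub h3).sub continuous_const).continuousOn) (fun t _ => by
        rw [Complex.exp_sub, Complex.exp_sub, Complex.exp_sub, hL1, hA]
        have h1 := hM1 (c t)
        have h2 : φ (Y (t, x)) = φ ((c t : ℂ) • ψ (q x)) := rfl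
        rw [h2, h1, ev_hom hf]
        have h3 : Complex.exp ((t : ℝ) * (e * a * (2 * Real.pi * Complex.I))) = ((c t : ℂ) ^ a) ^ e := by
          change _ = ((ex t) ^ a) ^ e
          simp only [ex]
          rw [← Complex.exp_nat_mul, ← Complex.exp_int_mul]; congr 1; ring
        rw [h3, mul_zpow]
        have h4 := zpow_ne_zero e (hfy x)
        have h5 : ((c t : ℂ) ^ a) ^ e ≠ 0 := zpow_ne_zero _ (pow_ne_zero _ (hex0 t))
        have h6 := Complex.exp_ne_zero (M (c t))
        field_simp)
    have h1 := (hk 1 trivial).trans (hk 0 trivial).symm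
    have h2 : c 1 = c 0 := by
      apply Subtype.ext
      change ex 1 = ex 0
      simp [ex, Complex.exp_two_pi_mul_I]
    simp only [h2, hL0] at h1
    simp at h1
    linear_combination h1
  let ζ : ℂ := Complex.exp (-(e * a * (2 * Real.pi * Complex.I)) / b)
  have hζ : ζ ^ b = 1 := by
    simp only [ζ]
    rw [← Complex.exp_nat_mul, Complex.exp_eq_one_iff]
    exact ⟨-(e * a), by push_cast; field_simp⟩
  have hζ1 : ζ ≠ 1 := fun h1 => by
    obtain ⟨k, hk⟩ := Complex.exp_eq_one_iff.1 h1
    have h2 : -((e : ℂ) * a) = k * b := by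
      have h3 : (2 * Real.pi * Complex.I : ℂ) ≠ 0 := two_pi_I_ne
      rw [div_eq_iff hb0] at hk
      apply mul_right_cancel₀ h3
      linear_combination hk
    have h3 : -(e * a) = k * b := by exact_mod_cast h2
    have h4 : (b : ℤ) ∣ a := ⟨-(e * k), by linear_combination (-e) * h3 - (a : ℤ) * hee⟩
    have := Nat.le_of_dvd (by omega) (Int.natCast_dvd_natCast.1 h4)
    omega
  let H : unitInterval × F → En n := fun p => Complex.exp (-L p / b) • (ε : ℂ)⁻¹ • φ (Y p)
  have hH : Continuous H := by
    exact (hL.neg.div_const (b : ℂ)).cexp.smul (hφY.const_smul (ε : ℂ)⁻¹)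
  have hHF : ∀ p, H p ∈ F := fun p => by
    change ev g (H p) = 1
    simp only [H]
    rw [hgev, hgev, ← Complex.exp_nat_mul, mul_div_cancel₀ _ hb0, Complex.exp_neg, hL1]
    have h1 : ev g (φ (Y p)) ≠ 0 := fun h0 => hfY p ((h.van _ (hYb p)).1 h0)
    rw [inv_pow, inv_div, ← mul_assoc, div_mul_eq_mul_div, mul_inv_cancel₀ (pow_ne_zero _ hεc), one_div,
      inv_mul_cancel₀ h1]
  have hom : ContinuousMap.Homotopic σ ((rotF hg ζ hζ).comp σ) := ⟨{
    toFun := fun p => ⟨H p, hHF p⟩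
    continuous_toFun := hH.subtype_mk _
    map_zero_left := fun x => by
      apply Subtype.ext
      change H (0, x) = σ x
      simp only [H]
      rw [hL0, hY0, hφq]
      simp only [q]
      rw [inv_smul_smul₀ hεc]; simp
    map_one_left := fun x => by
      apply Subtype.ext
      change H (1, x) = ζ • (σ x : En n)
      simp only [H]
      rw [hL2, hY1, hφq]
      simp only [q]
      rw [inv_smul_smul₀ hεc] }⟩
  have : Nontrivial (En n) := inferInstance
  have h1 : ContinuousMap.Homotopic ((rotF hg ζ hζ).comp σ) (rotF hg ζ hζ) := by
    have := ContinuousMap.Homotopic.comp (ContinuousMap.Homotopic.refl (rotF hg ζ hζ)) hσ.symm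
    simpa using this
  exact hg.not_id (by omega) hζ hζ1 ⟨x0, hx0⟩ ((hσ.trans hom).trans h1)

lemma half (hn : 3 ≤ n) {f g : MvPolynomial (Fin n) ℂ} (hfirr : Irreducible f) (hgirr : Irreducible g)
    (hf : f.IsHomogeneous f.totalDegree) (hg : g.IsHomogeneous g.totalDegree)
    (hs : SingV f ⊆ {0}) (h : BiLipGermHomeo (pV f) (pV g)) :
    SingV g ⊆ {0} ∧ g.totalDegree ≤ f.totalDegree := by
  obtain ⟨φ, ψ, K, r, r', hB⟩ := bh_of h
  obtain ⟨h1, h2, e, hee, he⟩ := part1 hn hfirr hgirr hf hg hs hB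
  refine ⟨h1, ?_⟩
  by_contra hc
  push Not at hc
  have ha := irr_deg_pos hfirr
  rcases eq_or_ne f.totalDegree 1 with h3 | h3
  · rw [h2 h3, h3] at hc; exact lt_irrefl _ hc
  · obtain ⟨y, hy⟩ := ev_exists_ne hgirr.ne_zero
    have hb : g.totalDegree ≠ 0 := by omega
    obtain ⟨c, hc1⟩ := IsAlgClosed.exists_pow_nat_eq (ev g y)⁻¹ (Nat.pos_of_ne_zero hb)
    refine no_lt (by omega) hf (homIso_of hgirr hg h1) (by omega) hc hB hee he (x0 := c • y) ?_
    rw [ev_hom hg, hc1, inv_mul_cancel₀ hy]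
end

/-- Theorem: let `f, g` be irreducible homogeneous polynomials with `Sing V(f) ⊆ {0}`.
If there is a bi-Lipschitz homeomorphism `(ℂⁿ, V(f), 0) → (ℂⁿ, V(g), 0)`, then
`Sing V(g) ⊆ {0}` and `deg f = deg g`. -/
theorem bilip_invariance_degree_irreducible_homogeneous_isolated_sing
    (n : ℕ) (f g : MvPolynomial (Fin n) ℂ)
    (hfirr : Irreducible f) (hgirr : Irreducible g)
    (hfhom : f.IsHomogeneous f.totalDegree) (hghom : g.IsHomogeneous g.totalDegree)
    (hfsing : SingV f ⊆ {0})
    (hφ : BiLipGermHomeo (pV f) (pV g)) :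
    SingV g ⊆ {0} ∧ f.totalDegree = g.totalDegree := by
  rcases Nat.lt_or_ge 2 n with hn | hn
  · obtain ⟨h1, h2⟩ := half hn hfirr hgirr hfhom hghom hfsing hφ
    exact ⟨h1, le_antisymm (half hn hgirr hfirr hghom hfhom h1 (bilip_symm hφ)).2 h2⟩
  · have h1 := small_deg hn hgirr hghom
    refine ⟨fun x hx => ?_, (small_deg hn hfirr hfhom).trans h1.symm⟩
    exact absurd ((mem_SingV _ _).1 hx).2 (deg1_smooth hgirr hghom h1 x)
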